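/- Fix a squarefree integer d ∉ {0,1} and a square root s_d ∈ ℂ of d; for each fundamental discriminant Δ fix a square root s_Δ ∈ ℂ and set M_Δ := ℚ(s_Δ, s_d) ⊆ ℂ. Then there exist constants C_d > 0 and C′ > 0, depending only on d, such that for all real Y ≥ 2: | ∑_{Δ fundamental, Δ ≠ discr(ℚ(s_d)), |Δ| ≤ Y} c_{ℙ¹, M_Δ} − C_d · log Y | ≤ C′. -/

import Mathlib

/-!
Statement 18: the sum of Schanuel constants `c_{ℙ¹,M_Δ}` over fundamental discriminants
`|Δ| ≤ Y` equals `C_d · log Y + O(1)` (Lemma `lem:constsumxd`).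
-/

open NumberField

/-- `Δ` is a fundamental discriminant. -/
def IsFundamentalDiscriminant (Δ : ℤ) : Prop :=
  Δ ≠ 1 ∧ ((Δ % 4 = 1 ∧ Squarefree Δ) ∨
    ∃ m : ℤ, Δ = 4 * m ∧ Squarefree m ∧ (m % 4 = 2 ∨ m % 4 = 3))

/-- The discriminant of `ℚ(√d)` for a squarefree integer `d ∉ {0,1}`. -/
def DL (d : ℤ) : ℤ := if d % 4 = 1 then d else 4 * d

/-- `ζ_M(2)`, summed over the nonzero ideals of the ring of integers. -/
noncomputable def zetaTwo (M : Type*) [Field M] [NumberField M] : ℝ :=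
  ∑' I : {I : Ideal (𝓞 M) // I ≠ ⊥}, (((Ideal.absNorm I.1 : ℝ)) ^ 2)⁻¹

/-- Schanuel's constant for `ℙ¹` over `M`:
`c_{ℙ¹,M} = (h_M R_M)/(w_M ζ_M(2)) · (2^{r_M}(2π)^{s_M})² · 2^{r_M+s_M−1}/|Δ_M|`. -/
noncomputable def schanuel (M : Type*) [Field M] [NumberField M] : ℝ :=
  ((classNumber M) * Units.regulator M) / ((Units.torsionOrder M : ℕ) * zetaTwo M) *
    (2 ^ InfinitePlace.nrRealPlaces M * (2 * Real.pi) ^ InfinitePlace.nrComplexPlaces M) ^ 2 *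
    2 ^ (InfinitePlace.nrRealPlaces M + InfinitePlace.nrComplexPlaces M - 1) / |(discr M : ℝ)|

/-! ### Part I : a Polya-Vinogradov bound -/

section PV

open Finset

lemma pv_geom (m : ℕ) [NeZero m] (a : ZMod m) (ha : a ≠ 0) (J : ℕ) :
    ‖∑ j ∈ range J, ZMod.stdAddChar (a * (j : ZMod m))‖ ≤
      (m : ℝ) / 2 * (1 / (a.val : ℝ) + 1 / ((m : ℝ) - a.val)) := by
  have hm : (0 : ℝ) < m := by exact_mod_cast NeZero.pos m
  have hv : 0 < a.val := Nat.pos_of_ne_zero (by simpa [ZMod.val_eq_zero] using ha)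
  have hvm : a.val < m := ZMod.val_lt a
  set v : ℝ := (a.val : ℝ) with hvdef
  have hv0 : 0 < v := by rw [hvdef]; exact_mod_cast hv
  have hv1 : v < m := by rw [hvdef]; exact_mod_cast hvm
  set z : ℂ := ZMod.stdAddChar a with hz
  have hpow : ∀ j : ℕ, ZMod.stdAddChar (a * (j : ZMod m)) = z ^ j := by
    intro j
    rw [hz, ← AddChar.map_nsmul_eq_pow, nsmul_eq_mul, mul_comm]
  simp_rw [hpow]
  have hzexp : z = Complex.exp (Complex.I * ((2 * (Real.pi * v / m) : ℝ) : ℂ)) := by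
    rw [hz]
    have : a = ((a.val : ℤ) : ZMod m) := by simp
    rw [this, ZMod.stdAddChar_coe]
    congr 1
    push_cast
    rw [hvdef]
    push_cast
    ring
  have hnorm : ‖z‖ = 1 := by
    rw [hzexp, mul_comm, Complex.norm_exp_ofReal_mul_I]
  have hsub : ‖z - 1‖ = 2 * |Real.sin (Real.pi * v / m)| := by
    rw [hzexp, Complex.norm_exp_I_mul_ofReal_sub_one]
    rw [Real.norm_eq_abs, abs_mul]
    norm_num
  have hsinpos : 0 < Real.sin (Real.pi * v / m) := by
    apply Real.sin_pos_of_pos_of_lt_pi (by positivity)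
    rw [div_lt_iff₀ hm]
    exact mul_lt_mul_of_pos_left hv1 Real.pi_pos
  have hz1 : z ≠ 1 := by
    intro h
    rw [h] at hsub
    simp at hsub
    exact hsinpos.ne' hsub
  rw [geom_sum_eq hz1, norm_div, hsub, abs_of_pos hsinpos]
  have hnum : ‖z ^ J - 1‖ ≤ 2 := by
    calc ‖z ^ J - 1‖ ≤ ‖z ^ J‖ + ‖(1:ℂ)‖ := norm_sub_le _ _
      _ = 2 := by rw [norm_pow, hnorm]; norm_num
  have hsinlow : 2 * v * (m - v) / (m * m) ≤ Real.sin (Real.pi * v / m) := by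
    by_cases h : v ≤ m / 2
    · have h1 := Real.mul_le_sin (x := Real.pi * v / m) (by positivity)
        (by rw [div_le_div_iff₀ hm two_pos]; nlinarith [Real.pi_pos])
      have h2 : 2 / Real.pi * (Real.pi * v / m) = 2 * v / m := by
        field_simp
      rw [h2] at h1
      refine le_trans ?_ h1
      rw [div_le_div_iff₀ (by positivity) hm]
      nlinarith [mul_pos hv0 hm, mul_pos (mul_pos hv0 hm) hv0]
    · push Not at h
      have h1 := Real.mul_le_sin (x := Real.pi * (m - v) / m)
        (by apply div_nonneg (mul_nonneg Real.pi_pos.le (by linarith)) hm.le)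
        (by rw [div_le_div_iff₀ hm two_pos]; nlinarith [Real.pi_pos])
      have h2 : 2 / Real.pi * (Real.pi * (m - v) / m) = 2 * (m - v) / m := by
        field_simp
      have h3 : Real.pi * (m - v) / m = Real.pi - Real.pi * v / m := by
        field_simp
      rw [h2, h3, Real.sin_pi_sub] at h1
      refine le_trans ?_ h1
      rw [div_le_div_iff₀ (by positivity) hm]
      have : 0 < m - v := by linarith
      nlinarith [mul_pos this hm, mul_pos (mul_pos this hm) this]
  have hmv : 0 < m - v := by linarith
  have hlow : 0 < 2 * v * (m - v) / (m * m) := by positivity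
  calc ‖z ^ J - 1‖ / (2 * Real.sin (Real.pi * v / m))
      ≤ 2 / (2 * (2 * v * (m - v) / (m * m))) := by gcongr
    _ = (m : ℝ) / 2 * (1 / v + 1 / (m - v)) := by
        field_simp
        ring

lemma sum_val_bound (m : ℕ) [NeZero m] (hm : 1 < m) :
    ∑ a ∈ (univ : Finset (ZMod m)).erase 0,
      (m : ℝ) / 2 * (1 / (a.val : ℝ) + 1 / ((m : ℝ) - a.val)) ≤ m * (1 + Real.log m) := by
  have hmap : ∑ a ∈ (univ : Finset (ZMod m)).erase 0,
      (m : ℝ) / 2 * (1 / (a.val : ℝ) + 1 / ((m : ℝ) - a.val)) =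
      ∑ v ∈ Finset.Ico 1 m, (m : ℝ) / 2 * (1 / (v : ℝ) + 1 / ((m : ℝ) - v)) := by
    refine Finset.sum_bij (fun a _ => a.val) ?_ ?_ ?_ ?_
    · intro a ha
      simp only [mem_erase, mem_univ, and_true] at ha
      simp only [Finset.mem_Ico]
      exact ⟨Nat.pos_of_ne_zero (by simpa [ZMod.val_eq_zero] using ha), ZMod.val_lt a⟩
    · intro a _ b _ h
      exact ZMod.val_injective m h
    · intro v hv
      rw [Finset.mem_Ico] at hv
      refine ⟨(v : ZMod m), ?_, ZMod.val_cast_of_lt hv.2⟩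
      simp only [mem_erase, mem_univ, and_true]
      intro h
      have := ZMod.val_cast_of_lt hv.2
      rw [h] at this
      simp at this
      omega
    · intro a _
      rfl
  rw [hmap, ← Finset.mul_sum, Finset.sum_add_distrib]
  have hrefl : ∑ v ∈ Finset.Ico 1 m, 1 / ((m : ℝ) - v) = ∑ v ∈ Finset.Ico 1 m, 1 / (v : ℝ) := by
    have := Finset.sum_Ico_reflect (fun v => 1 / (v : ℝ)) 1 (m := m) (n := m) (by omega)
    simp only [Nat.add_sub_cancel_left] at this
    rw [show m + 1 - 1 = m by omega] at this
    rw [← this]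
    refine Finset.sum_congr rfl fun v hv => ?_
    rw [Finset.mem_Ico] at hv
    rw [Nat.cast_sub hv.2.le]
  rw [hrefl]
  have hh : ∑ v ∈ Finset.Ico 1 m, 1 / (v : ℝ) ≤ 1 + Real.log m := by
    have h1 := harmonic_le_one_add_log m
    rw [harmonic_eq_sum_Icc] at h1
    push_cast at h1
    refine le_trans ?_ h1
    simp only [one_div]
    apply Finset.sum_le_sum_of_subset_of_nonneg
    · intro v hv
      simp only [Finset.mem_Ico, Finset.mem_Icc] at *
      omega
    · intros; positivity
  have hm0 : (0 : ℝ) ≤ m := by positivity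
  nlinarith

/-- Abstract Polya-Vinogradov inequality. -/
lemma pv_abstract (m : ℕ) [NeZero m] (hm : 1 < m) (f : ZMod m → ℂ)
    (hmul : ∀ x y, f (x * y) = f x * f y) (h1 : f 1 = 1) (hb : ∀ x, ‖f x‖ ≤ 1)
    (h0 : ∀ x, ¬ IsUnit x → f x = 0)
    (htw : ∀ a, ¬ IsUnit a → ∃ c, IsUnit c ∧ c * a = a ∧ f c ≠ 1) (u : ZMod m) (J : ℕ) :
    ‖∑ j ∈ range J, f (u + (j : ZMod m))‖ ≤ Real.sqrt m * (1 + Real.log m) := by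
  classical
  have hmR : (0 : ℝ) < m := by exact_mod_cast NeZero.pos m
  set e := ZMod.stdAddChar (N := m) with he
  have hprim := ZMod.isPrimitive_stdAddChar m
  set F : ZMod m → ℂ := fun a => ∑ x, f x * e (x * a) with hF
  have hF0 : ∀ a, ¬ IsUnit a → F a = 0 := by
    intro a ha
    obtain ⟨c, hc, hca, hfc⟩ := htw a ha
    have : F a = f c * F a := by
      calc F a = ∑ x, f (c * x) * e ((c * x) * a) := by
            rw [hF]
            exact (Fintype.sum_equiv (Units.mulLeft hc.unit) _ _ (fun x => by simp)).symm
        _ = f c * F a := by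
            rw [hF, Finset.mul_sum]
            refine Finset.sum_congr rfl fun x _ => ?_
            rw [hmul, show c * x * a = x * (c * a) by ring, hca]
            ring
    have h2 : (1 - f c) * F a = 0 := by linear_combination this
    rcases mul_eq_zero.mp h2 with h | h
    · exact absurd (by linear_combination -h) hfc
    · exact h
  have hunit : ∀ a, IsUnit a → ‖f a‖ = 1 := by
    intro a ha
    have h2 : f a * f (↑(ha.unit⁻¹) : ZMod m) = 1 := by
      rw [← hmul]; simp [h1]
    have h3 : ‖f a‖ * ‖f (↑(ha.unit⁻¹) : ZMod m)‖ = 1 := by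
      rw [← norm_mul, h2, norm_one]
    nlinarith [hb a, hb (↑(ha.unit⁻¹) : ZMod m), norm_nonneg (f a),
      norm_nonneg (f (↑(ha.unit⁻¹) : ZMod m))]
  have hF1 : ∀ a, IsUnit a → ‖F a‖ = ‖F 1‖ := by
    intro a ha
    have : f a * F a = F 1 := by
      calc f a * F a = ∑ x, f (a * x) * e ((a * x) * 1) := by
            rw [hF, Finset.mul_sum]
            refine Finset.sum_congr rfl fun x _ => ?_
            rw [hmul, show a * x * 1 = x * a by ring]
            ring
        _ = F 1 := by
            rw [hF]
            exact (Fintype.sum_equiv (Units.mulLeft ha.unit) _ _ (fun x => by simp))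
    rw [← this, norm_mul, hunit a ha, one_mul]
  have hconj : ∀ x, (starRingEnd ℂ) (e x) = e (-x) := by
    intro x
    rw [AddChar.map_neg_eq_conj]
  have hsumshift : ∀ b : ZMod m, ∑ a, e (a * b) = if b = 0 then (m : ℂ) else 0 := by
    intro b
    have := AddChar.sum_mulShift b hprim
    simpa [ZMod.card] using this
  -- Plancherel
  have hpl : ∑ a, ‖F a‖ ^ 2 = m * ∑ x, ‖f x‖ ^ 2 := by
    have hc : (∑ a, F a * (starRingEnd ℂ) (F a)) = m * ∑ x, f x * (starRingEnd ℂ) (f x) := by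
      calc ∑ a, F a * (starRingEnd ℂ) (F a)
          = ∑ a, ∑ x, ∑ y, (f x * (starRingEnd ℂ) (f y)) * e (a * (x - y)) := by
            refine Finset.sum_congr rfl fun a _ => ?_
            rw [hF]
            simp only [map_sum, map_mul, hconj]
            rw [Finset.sum_mul_sum]
            refine Finset.sum_congr rfl fun x _ => Finset.sum_congr rfl fun y _ => ?_
            rw [show a * (x - y) = x * a + -(y * a) by ring, AddChar.map_add_eq_mul]
            ring
        _ = ∑ x, ∑ y, (f x * (starRingEnd ℂ) (f y)) * ∑ a, e (a * (x - y)) := by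
            rw [Finset.sum_comm]
            refine Finset.sum_congr rfl fun x _ => ?_
            rw [Finset.sum_comm]
            refine Finset.sum_congr rfl fun y _ => ?_
            rw [Finset.mul_sum]
        _ = m * ∑ x, f x * (starRingEnd ℂ) (f x) := by
            rw [Finset.mul_sum]
            refine Finset.sum_congr rfl fun x _ => ?_
            simp only [hsumshift, sub_eq_zero]
            simp
            ring
    have h2 : ∀ z : ℂ, z * (starRingEnd ℂ) z = ((‖z‖ ^ 2 : ℝ) : ℂ) := by
      intro z; rw [Complex.mul_conj']; push_cast; rfl
    simp only [h2] at hc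
    exact_mod_cast hc
  have hcard : (∑ a : ZMod m, if IsUnit a then (1 : ℝ) else 0) > 0 := by
    have : (1 : ℝ) ≤ ∑ a : ZMod m, if IsUnit a then (1 : ℝ) else 0 := by
      have := Finset.single_le_sum (f := fun a : ZMod m => if IsUnit a then (1 : ℝ) else 0)
        (fun a _ => by positivity) (Finset.mem_univ (1 : ZMod m))
      simpa using this
    linarith
  have hτ : ‖F 1‖ ^ 2 ≤ m := by
    set c := ∑ a : ZMod m, if IsUnit a then (1 : ℝ) else 0 with hcdef
    have h3 : ∑ a, ‖F a‖ ^ 2 = c * ‖F 1‖ ^ 2 := by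
      rw [hcdef, Finset.sum_mul]
      refine Finset.sum_congr rfl fun a _ => ?_
      by_cases h : IsUnit a
      · simp [h, hF1 a h]
      · simp [h, hF0 a h]
    have h4 : ∑ x, ‖f x‖ ^ 2 = c := by
      rw [hcdef]
      refine Finset.sum_congr rfl fun a _ => ?_
      by_cases h : IsUnit a
      · simp [h, hunit a h]
      · simp [h, h0 a h]
    rw [h3, h4] at hpl
    have : c * ‖F 1‖ ^ 2 = c * m := by rw [hpl]; ring
    exact (mul_left_cancel₀ hcard.ne' this).le
  have hFle : ∀ a, ‖F a‖ ≤ Real.sqrt m := by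
    intro a
    by_cases h : IsUnit a
    · rw [hF1 a h]; exact Real.le_sqrt_of_sq_le hτ
    · rw [hF0 a h]; simp
  have hinv : ∀ x, (m : ℂ) * f x = ∑ a, F a * e (-(a * x)) := by
    intro x
    rw [hF]
    simp only [Finset.sum_mul]
    rw [Finset.sum_comm]
    calc (m : ℂ) * f x = ∑ y, f y * (if y - x = 0 then (m : ℂ) else 0) := by
          simp [sub_eq_zero, mul_comm]
      _ = ∑ y, ∑ a, f y * e (y * a) * e (-(a * x)) := by
          refine Finset.sum_congr rfl fun y _ => ?_
          rw [← hsumshift, Finset.mul_sum]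
          refine Finset.sum_congr rfl fun a _ => ?_
          rw [show a * (y - x) = y * a + -(a * x) by ring, AddChar.map_add_eq_mul]
          ring
  have hF00 : F 0 = 0 := by
    apply hF0
    have : Fact (1 < m) := ⟨hm⟩
    exact not_isUnit_zero
  have hmain : (m : ℂ) * ∑ j ∈ range J, f (u + (j : ZMod m)) =
      ∑ a ∈ (univ : Finset (ZMod m)).erase 0,
        F a * e (-(a * u)) * ∑ j ∈ range J, e ((-a) * (j : ZMod m)) := by
    rw [Finset.mul_sum]
    simp only [hinv]
    rw [Finset.sum_comm, ← Finset.add_sum_erase _ _ (Finset.mem_univ (0 : ZMod m))]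
    simp only [hF00, zero_mul, Finset.sum_const_zero, zero_add]
    refine Finset.sum_congr rfl fun a _ => ?_
    rw [Finset.mul_sum]
    refine Finset.sum_congr rfl fun j _ => ?_
    rw [show -(a * (u + (j : ZMod m))) = -(a * u) + (-a) * j by ring, AddChar.map_add_eq_mul]
    ring
  have hnorme : ∀ x, ‖e x‖ = 1 := fun x => by simp
  have hbd : m * ‖∑ j ∈ range J, f (u + (j : ZMod m))‖ ≤ Real.sqrt m * (m * (1 + Real.log m)) := by
    have : ‖(m : ℂ) * ∑ j ∈ range J, f (u + (j : ZMod m))‖ =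
        m * ‖∑ j ∈ range J, f (u + (j : ZMod m))‖ := by
      rw [norm_mul]; simp
    rw [← this, hmain]
    refine (norm_sum_le _ _).trans ?_
    calc ∑ a ∈ (univ : Finset (ZMod m)).erase 0,
          ‖F a * e (-(a * u)) * ∑ j ∈ range J, e ((-a) * (j : ZMod m))‖
        ≤ ∑ a ∈ (univ : Finset (ZMod m)).erase 0, Real.sqrt m *
          ((m : ℝ) / 2 * (1 / ((-a).val : ℝ) + 1 / ((m : ℝ) - (-a).val))) := by
          refine Finset.sum_le_sum fun a ha => ?_
          rw [norm_mul, norm_mul, hnorme, mul_one]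
          have ha0 : -a ≠ 0 := by simpa using ha
          have := pv_geom m (-a) ha0 J
          exact mul_le_mul (hFle a) this (norm_nonneg _) (Real.sqrt_nonneg _)
      _ = Real.sqrt m * ∑ a ∈ (univ : Finset (ZMod m)).erase 0,
          ((m : ℝ) / 2 * (1 / (a.val : ℝ) + 1 / ((m : ℝ) - a.val))) := by
          rw [← Finset.mul_sum]
          congr 1
          refine Finset.sum_bij (fun a _ => -a) ?_ ?_ ?_ ?_
          · intro a ha; simpa using ha
          · intro a _ b _ h; simpa using h
          · intro b hb; exact ⟨-b, by simpa using hb, by simp⟩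
          · intro a _; rfl
      _ ≤ _ := by
          gcongr
          exact sum_val_bound m hm
  have : m * ‖∑ j ∈ range J, f (u + (j : ZMod m))‖ ≤ m * (Real.sqrt m * (1 + Real.log m)) := by
    linarith
  exact le_of_mul_le_mul_left this hmR

end PV

section JacAP

set_option linter.style.haveILetI false

open Finset

lemma exists_twist_prime (p : ℕ) (hp : p.Prime) (hp2 : p ≠ 2) (k : ℕ) (hk : Nat.Coprime k p) :
    ∃ c : ℕ, c ≡ 1 [MOD k] ∧ jacobiSym (c : ℤ) p = -1 := by
  haveI : Fact p.Prime := ⟨hp⟩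
  obtain ⟨a, ha⟩ := FiniteField.exists_nonsquare (F := ZMod p) (by rwa [ZMod.ringChar_zmod_n])
  obtain ⟨c, hc1, hc2⟩ := Nat.chineseRemainder hk 1 a.val
  refine ⟨c, hc1, ?_⟩
  rw [← jacobiSym.legendreSym.to_jacobiSym, legendreSym.eq_neg_one_iff]
  have : ((c : ℤ) : ZMod p) = a := by
    have := (ZMod.natCast_eq_natCast_iff _ _ _).mpr hc2
    push_cast
    rw [this]
    simp
  rw [this]
  exact ha

lemma exists_twist (m : ℕ) (hodd : Odd m) (hsq : Squarefree m) (k p : ℕ) (hp : p.Prime)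
    (hpm : p ∣ m) (hk : Nat.Coprime k p) :
    ∃ c : ℕ, c ≡ 1 [MOD k] ∧ c ≡ 1 [MOD (m / p)] ∧ jacobiSym (c : ℤ) m = -1 := by
  obtain ⟨q, rfl⟩ := hpm
  have hp0 : 0 < p := hp.pos
  rw [Nat.mul_div_cancel_left _ hp0]
  have hcop : Nat.Coprime p q := (Nat.squarefree_mul_iff.mp hsq).1
  have hp2 : p ≠ 2 := by
    rintro rfl
    rcases hodd with ⟨t, ht⟩
    omega
  obtain ⟨c, hc1, hc2⟩ := exists_twist_prime p hp hp2 (k * q) (Nat.Coprime.mul_left hk hcop.symm)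
  have h1 : c ≡ 1 [MOD k] := hc1.of_mul_right q
  have h2 : c ≡ 1 [MOD q] := Nat.ModEq.of_mul_left k hc1
  refine ⟨c, h1, h2, ?_⟩
  haveI : NeZero p := ⟨hp.ne_zero⟩
  haveI : NeZero q := ⟨by rintro rfl; simp at hsq⟩
  rw [jacobiSym.mul_right, hc2]
  have : jacobiSym (c : ℤ) q = jacobiSym 1 q := by
    apply jacobiSym.mod_left'
    have := (Int.natCast_modEq_iff.mpr h2)
    exact_mod_cast this
  rw [this, jacobiSym.one_left]
  norm_num

lemma jac_zmod (m : ℕ) [NeZero m] (k : ℤ) : jacobiSym (((k : ZMod m).val : ℕ) : ℤ) m = jacobiSym k m := by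
  rw [ZMod.val_intCast]
  exact (jacobiSym.mod_left k m).symm

lemma jac_pv (m : ℕ) (hodd : Odd m) (hsq : Squarefree m) (hm : 1 < m) (u : ZMod m) (J : ℕ) :
    |∑ j ∈ range J, (jacobiSym (((u + (j : ZMod m)).val : ℕ) : ℤ) m : ℝ)| ≤
      Real.sqrt m * (1 + Real.log m) := by
  haveI : NeZero m := ⟨by omega⟩
  have key := pv_abstract m hm (fun x => ((jacobiSym (x.val : ℤ) m : ℤ) : ℂ)) ?_ ?_ ?_ ?_ ?_ u J
  · rw [← Real.norm_eq_abs, ← Complex.norm_real]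
    push_cast
    exact key
  · intro x y
    rw [← Int.cast_mul, ← jacobiSym.mul_left]
    congr 1
    rw [ZMod.val_mul]
    push_cast
    exact (jacobiSym.mod_left _ m).symm
  · haveI : Fact (1 < m) := ⟨hm⟩
    simp [ZMod.val_one]
  · intro x
    rcases jacobiSym.trichotomy (x.val : ℤ) m with h | h | h <;> (simp only [h]; norm_num)
  · intro x hx
    rw [Int.cast_eq_zero, jacobiSym.eq_zero_iff]
    refine ⟨by omega, ?_⟩
    intro h
    apply hx
    have h2 : Nat.Coprime x.val m := by
      rw [Int.gcd_natCast_natCast] at h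
      exact h
    have := (ZMod.isUnit_iff_coprime x.val m).mpr h2
    simpa using this
  · intro a ha
    have hnc : ¬ Nat.Coprime a.val m := by
      intro h
      apply ha
      have := (ZMod.isUnit_iff_coprime a.val m).mpr h
      simpa using this
    obtain ⟨p, hp, hpa, hpm⟩ := Nat.Prime.not_coprime_iff_dvd.mp hnc
    obtain ⟨c, -, hc1, hc2⟩ := exists_twist m hodd hsq 1 p hp hpm (by simp)
    refine ⟨(c : ZMod m), ?_, ?_, ?_⟩
    · rw [ZMod.isUnit_iff_coprime]
      by_contra h
      have : jacobiSym (c : ℤ) m = 0 := by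
        rw [jacobiSym.eq_zero_iff]
        exact ⟨by omega, by rw [Int.gcd_natCast_natCast]; exact h⟩
      omega
    · have h3 : ((m : ℤ)) ∣ (c * a.val - a.val : ℤ) := by
        obtain ⟨q, rfl⟩ := hpm
        rw [Nat.mul_div_cancel_left _ hp.pos] at hc1
        have h4 : (q : ℤ) ∣ (c - 1 : ℤ) := by
          have := (Nat.modEq_iff_dvd.mp hc1.symm)
          simpa using this
        have h5 : (p : ℤ) ∣ (a.val : ℤ) := by exact_mod_cast hpa
        have := mul_dvd_mul h5 h4
        rw [Nat.cast_mul, show (c * a.val - a.val : ℤ) = a.val * (c - 1) by ring]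
        exact this
      have := (ZMod.intCast_zmod_eq_zero_iff_dvd _ m).mpr h3
      push_cast at this
      rw [sub_eq_zero] at this
      simpa using this
    · have := jac_zmod m (c : ℤ)
      push_cast at this
      rw [this, hc2]
      norm_num

/-- Parametrization of an arithmetic progression. -/
lemma ap_param (Q : ℕ) (hQ : 0 < Q) (c : ZMod Q) (K : ℕ) :
    ∃ c0 J : ℕ, (∀ g : ℕ → ℝ, ∑ k ∈ (Icc 1 K).filter (fun k : ℕ => (k : ZMod Q) = c), g k =
      ∑ j ∈ range J, g (c0 + Q * j)) ∧ |(J : ℝ) - K / Q| ≤ 1 := by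
  haveI : NeZero Q := ⟨hQ.ne'⟩
  set c0 : ℕ := if c.val = 0 then Q else c.val with hc0
  have hc0pos : 1 ≤ c0 := by
    rw [hc0]; split_ifs <;> omega
  have hc0le : c0 ≤ Q := by
    rw [hc0]; split_ifs
    · exact le_rfl
    · exact (ZMod.val_lt c).le
  have hc0c : (c0 : ZMod Q) = c := by
    rw [hc0]; split_ifs with h
    · rw [ZMod.natCast_self]
      exact ((ZMod.val_eq_zero c).mp h).symm
    · simp
  have hiff : ∀ j, j < (K + Q - c0) / Q ↔ c0 + Q * j ≤ K := by
    intro j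
    rw [Nat.lt_iff_add_one_le, Nat.le_div_iff_mul_le hQ, add_mul, mul_comm j Q]
    omega
  refine ⟨c0, (K + Q - c0) / Q, ?_, ?_⟩
  · intro g
    symm
    refine Finset.sum_bij (fun j _ => c0 + Q * j) ?_ ?_ ?_ ?_
    · intro j hj
      rw [mem_range, hiff] at hj
      simp only [mem_filter, mem_Icc]
      refine ⟨⟨by omega, hj⟩, ?_⟩
      push_cast
      rw [hc0c, ZMod.natCast_self]
      ring
    · intro a _ b _ h
      have : Q * a = Q * b := by omega
      exact Nat.eq_of_mul_eq_mul_left hQ this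
    · intro k hk
      simp only [mem_filter, mem_Icc] at hk
      obtain ⟨⟨h1, h2⟩, h3⟩ := hk
      have h4 : c0 ≡ k [MOD Q] := (ZMod.natCast_eq_natCast_iff _ _ _).mp (by rw [hc0c, h3])
      have hle : c0 ≤ k := by
        by_contra hlt
        push Not at hlt
        have h5 := (Nat.modEq_iff_dvd' hlt.le).mp h4.symm
        have := Nat.le_of_dvd (by omega) h5
        omega
      obtain ⟨j, hj⟩ := (Nat.modEq_iff_dvd' hle).mp h4
      refine ⟨j, ?_, by omega⟩
      rw [mem_range, hiff]
      omega
    · intro j _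
      rfl
  · have hQR : (0 : ℝ) < Q := by exact_mod_cast hQ
    have h1 : (((K + Q - c0) / Q : ℕ) : ℝ) ≤ (K : ℝ) / Q + 1 := by
      refine Nat.cast_div_le.trans ?_
      rw [div_add_one hQR.ne']
      gcongr
      rw [Nat.cast_sub (by omega)]
      push_cast
      linarith [(Nat.cast_nonneg c0 : (0:ℝ) ≤ c0)]
    have h2 : (K : ℝ) / Q - 1 ≤ (((K + Q - c0) / Q : ℕ) : ℝ) := by
      have h3 := Nat.lt_mul_div_succ (K + Q - c0) hQ
      have h4 : K ≤ Q * ((K + Q - c0) / Q + 1) := by omega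
      have h5 : (K : ℝ) ≤ Q * ((((K + Q - c0) / Q : ℕ) : ℝ) + 1) := by exact_mod_cast h4
      rw [sub_le_iff_le_add, div_le_iff₀ hQR]
      linarith
    rw [abs_le]
    constructor <;> linarith

lemma jac_ap_sqfree (Q m : ℕ) (hQ : 0 < Q) (hodd : Odd m) (hsq : Squarefree m) (hm : 1 < m)
    (hcop : Nat.Coprime Q m) (c : ZMod Q) (K : ℕ) :
    |∑ k ∈ (Icc 1 K).filter (fun k : ℕ => (k : ZMod Q) = c), (jacobiSym (k : ℤ) m : ℝ)| ≤
      Real.sqrt m * (1 + Real.log m) := by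
  haveI : NeZero m := ⟨by omega⟩
  obtain ⟨c0, J, hJ, -⟩ := ap_param Q hQ c K
  rw [hJ]
  set u : ZMod m := (Q : ZMod m)⁻¹ * c0 with hu
  have hQinv : (Q : ZMod m) * (Q : ZMod m)⁻¹ = 1 := ZMod.coe_mul_inv_eq_one Q hcop
  have hterm : ∀ j : ℕ, (jacobiSym ((c0 + Q * j : ℕ) : ℤ) m : ℝ) =
      (jacobiSym (Q : ℤ) m : ℝ) * (jacobiSym (((u + (j : ZMod m)).val : ℕ) : ℤ) m : ℝ) := by
    intro j
    rw [← Int.cast_mul, ← jacobiSym.mul_left]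
    congr 1
    apply jacobiSym.mod_left'
    have : (((c0 + Q * j : ℕ) : ℤ) : ZMod m) = (((Q : ℤ) * (((u + (j : ZMod m)).val : ℕ) : ℤ) : ℤ) : ZMod m) := by
      push_cast
      rw [ZMod.natCast_zmod_val, hu]
      linear_combination -(c0 : ZMod m) * hQinv
    exact (ZMod.intCast_eq_intCast_iff _ _ _).mp this
  simp_rw [hterm]
  rw [← Finset.mul_sum, abs_mul]
  have h1 : |(jacobiSym (Q : ℤ) m : ℝ)| ≤ 1 := by
    rcases jacobiSym.trichotomy (Q : ℤ) m with h | h | h <;> simp [h]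
  calc _ ≤ 1 * |∑ j ∈ range J, (jacobiSym (((u + (j : ZMod m)).val : ℕ) : ℤ) m : ℝ)| := by gcongr
    _ ≤ _ := by rw [one_mul]; exact jac_pv m hodd hsq hm u J

lemma sum_moebius_div (f : ℕ) (hf : 0 < f) :
    ∑ e ∈ f.divisors, (ArithmeticFunction.moebius e : ℝ) / e = (f.totient : ℝ) / f := by
  have h := (ArithmeticFunction.sum_eq_iff_sum_mul_moebius_eq (R := ℝ)
    (f := fun n => (n.totient : ℝ)) (g := fun n => (n : ℝ))).mp (by
      intro n _
      have := Nat.sum_totient n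
      exact_mod_cast this) f hf
  have hfR : (0 : ℝ) < f := by exact_mod_cast hf
  rw [← h, Nat.sum_divisorsAntidiagonal (fun i j => (ArithmeticFunction.moebius i : ℝ) * (j : ℝ)),
    Finset.sum_div]
  refine Finset.sum_congr rfl fun e he => ?_
  have hdvd := Nat.dvd_of_mem_divisors he
  have he0 : (e : ℝ) ≠ 0 := by
    have := Nat.pos_of_mem_divisors he
    exact_mod_cast this.ne'
  rw [Nat.cast_div hdvd he0]
  field_simp

lemma coprime_indicator (k f : ℕ) (hf : 0 < f) :
    (if Nat.Coprime k f then (1 : ℝ) else 0) =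
      ∑ e ∈ f.divisors, if e ∣ k then (ArithmeticFunction.moebius e : ℝ) else 0 := by
  rw [← Finset.sum_filter]
  have hset : f.divisors.filter (fun e => e ∣ k) = (Nat.gcd k f).divisors := by
    ext e
    simp only [mem_filter, Nat.mem_divisors, Nat.dvd_gcd_iff]
    constructor
    · rintro ⟨⟨h1, _⟩, h3⟩
      exact ⟨⟨h3, h1⟩, (Nat.gcd_pos_of_pos_right _ hf).ne'⟩
    · rintro ⟨⟨h1, h2⟩, _⟩
      exact ⟨⟨h2, hf.ne'⟩, h1⟩
  rw [hset]
  have := congrArg (fun g : ArithmeticFunction ℤ => g (Nat.gcd k f)) ArithmeticFunction.moebius_mul_coe_zeta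
  simp only [ArithmeticFunction.coe_mul_zeta_apply, ArithmeticFunction.one_apply] at this
  have h2 : (∑ i ∈ (Nat.gcd k f).divisors, (ArithmeticFunction.moebius i : ℝ)) =
     ((∑ i ∈ (Nat.gcd k f).divisors, ArithmeticFunction.moebius i : ℤ) : ℝ) := by push_cast; rfl
  rw [h2, this]
  simp only [Nat.Coprime]
  split_ifs <;> simp

lemma totient_sq (f : ℕ) (hf : 0 < f) : ((f ^ 2).totient : ℝ) / (f ^ 2 : ℕ) = (f.totient : ℝ) / f := by
  have h := Nat.totient_gcd_mul_totient_mul f f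
  rw [Nat.gcd_self, mul_assoc] at h
  have h2 := Nat.eq_of_mul_eq_mul_left (Nat.totient_pos.mpr hf) h
  rw [sq, h2]
  have hfR : (0 : ℝ) < f := by exact_mod_cast hf
  push_cast
  field_simp

/-- Sums of Jacobi symbols along an arithmetic progression. -/
lemma jac_ap (Q m : ℕ) (hQ : 0 < Q) (hodd : Odd m) (hcop : Nat.Coprime Q m) (c : ZMod Q) (K : ℕ) :
    |∑ k ∈ (Icc 1 K).filter (fun k : ℕ => (k : ZMod Q) = c), (jacobiSym (k : ℤ) m : ℝ)
      - (if IsSquare m then (K : ℝ) / Q * ((m.totient : ℝ) / m) else 0)| ≤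
      2 * (Real.sqrt m * (1 + Real.log m)) := by
  obtain ⟨m0, f, hmf, hsq⟩ := Nat.sq_mul_squarefree m
  have hm0 : 0 < m := hodd.pos
  have hf0 : 0 < f := by
    rcases Nat.eq_zero_or_pos f with h | h
    · subst h; simp at hmf; omega
    · exact h
  have hm00 : 0 < m0 := by
    rcases Nat.eq_zero_or_pos m0 with h | h
    · subst h; simp at hmf; omega
    · exact h
  have hodd' : Odd (f ^ 2 * m0) := hmf ▸ hodd
  have hm0odd : Odd m0 := (Nat.odd_mul.mp hodd').2
  have hcop' : Nat.Coprime Q (f ^ 2 * m0) := hmf ▸ hcop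
  have hcm0 : Nat.Coprime Q m0 := Nat.Coprime.coprime_mul_left_right hcop'
  have hcf : Nat.Coprime Q f := by
    have := Nat.Coprime.coprime_mul_right_right hcop'
    exact Nat.Coprime.coprime_dvd_right (dvd_pow_self f two_ne_zero) this
  haveI : NeZero m0 := ⟨hm00.ne'⟩
  haveI : NeZero f := ⟨hf0.ne'⟩
  haveI : NeZero Q := ⟨hQ.ne'⟩
  have hQR : (0 : ℝ) < Q := by exact_mod_cast hQ
  -- the inner sums
  set I : ℕ → ℝ := fun e => (jacobiSym (e : ℤ) m0 : ℝ) *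
    ∑ k ∈ (Icc 1 (K / e)).filter (fun k : ℕ => (k : ZMod Q) = (e : ZMod Q)⁻¹ * c),
      (jacobiSym (k : ℤ) m0 : ℝ) with hI
  have hsum : ∑ k ∈ (Icc 1 K).filter (fun k : ℕ => (k : ZMod Q) = c), (jacobiSym (k : ℤ) m : ℝ) =
      ∑ e ∈ f.divisors, (ArithmeticFunction.moebius e : ℝ) * I e := by
    have hterm : ∀ k : ℕ, (jacobiSym (k : ℤ) m : ℝ) =
        ∑ e ∈ f.divisors, if e ∣ k then (ArithmeticFunction.moebius e : ℝ) * (jacobiSym (k : ℤ) m0 : ℝ) else 0 := by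
      intro k
      have h1 : (jacobiSym (k : ℤ) m : ℝ) = (if Nat.Coprime k f then (1 : ℝ) else 0) * (jacobiSym (k : ℤ) m0 : ℝ) := by
        rw [← hmf, sq, jacobiSym.mul_right, jacobiSym.mul_right]
        push_cast
        congr 1
        by_cases hc : Nat.Coprime k f
        · have : jacobiSym (k : ℤ) f = 1 ∨ jacobiSym (k : ℤ) f = -1 :=
            jacobiSym.eq_one_or_neg_one (by rw [Int.gcd_natCast_natCast]; exact hc)
          rcases this with h | h <;> simp [h, hc]
        · have : jacobiSym (k : ℤ) f = 0 := by
            rw [jacobiSym.eq_zero_iff]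
            exact ⟨hf0.ne', by rw [Int.gcd_natCast_natCast]; exact hc⟩
          simp [this, hc]
      rw [h1, coprime_indicator k f hf0, Finset.sum_mul]
      refine Finset.sum_congr rfl fun e _ => ?_
      split_ifs <;> simp
    simp_rw [hterm]
    rw [Finset.sum_comm]
    refine Finset.sum_congr rfl fun e he => ?_
    have hepos := Nat.pos_of_mem_divisors he
    have hecop : Nat.Coprime Q e := Nat.Coprime.coprime_dvd_right (Nat.dvd_of_mem_divisors he) hcf
    have heinv : (e : ZMod Q) * (e : ZMod Q)⁻¹ = 1 := ZMod.coe_mul_inv_eq_one e hecop.symm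
    simp only [hI]
    rw [Finset.mul_sum, Finset.mul_sum, ← Finset.sum_filter]
    symm
    refine Finset.sum_bij (fun k _ => e * k) ?_ ?_ ?_ ?_
    · intro k hk
      simp only [mem_filter, mem_Icc] at hk ⊢
      obtain ⟨⟨h1, h2⟩, h3⟩ := hk
      refine ⟨⟨⟨Nat.mul_pos hepos h1, ?_⟩, ?_⟩, Dvd.intro _ rfl⟩
      · exact (Nat.mul_le_mul_left e h2).trans (Nat.mul_div_le K e)
      · push_cast
        rw [h3, ← mul_assoc, heinv, one_mul]
    · intro a _ b _ h
      exact Nat.eq_of_mul_eq_mul_left hepos h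
    · intro k hk
      simp only [mem_filter, mem_Icc] at hk
      obtain ⟨⟨⟨h1, h2⟩, h3⟩, ⟨k', rfl⟩⟩ := hk
      refine ⟨k', ?_, rfl⟩
      simp only [mem_filter, mem_Icc]
      refine ⟨⟨Nat.pos_of_mul_pos_left h1, ?_⟩, ?_⟩
      · rw [Nat.le_div_iff_mul_le hepos, mul_comm]; exact h2
      · push_cast at h3
        rw [← h3, ← mul_assoc, mul_comm _ (e : ZMod Q), heinv, one_mul]
    · intro k _
      push_cast
      rw [jacobiSym.mul_left]
      push_cast
      ring
  rw [hsum]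
  have hmu : ∀ e : ℕ, |(ArithmeticFunction.moebius e : ℝ)| ≤ 1 := by
    intro e
    have := ArithmeticFunction.abs_moebius_le_one (n := e)
    exact_mod_cast this
  have hcard : (f.divisors.card : ℝ) ≤ f := by exact_mod_cast Nat.card_divisors_le_self f
  have hfsqrt : Real.sqrt m = f * Real.sqrt m0 := by
    rw [← hmf]
    push_cast
    rw [Real.sqrt_mul (by positivity), Real.sqrt_sq (by positivity)]
  have hlogm : 0 ≤ Real.log m := Real.log_natCast_nonneg m
  rcases Nat.lt_or_ge 1 m0 with h1 | h1
  · -- nonsquare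
    have hns : ¬ IsSquare m := by
      rintro ⟨r, hr⟩
      have h2 : f ∣ r := by
        have : f ^ 2 ∣ r ^ 2 := ⟨m0, by rw [sq r, ← hr, hmf]⟩
        exact (Nat.pow_dvd_pow_iff two_ne_zero).mp this
      obtain ⟨t, rfl⟩ := h2
      have h3 : m0 = t * t := by
        have : f ^ 2 * m0 = f ^ 2 * (t * t) := by rw [hmf, hr]; ring
        exact Nat.eq_of_mul_eq_mul_left (by positivity) this
      have h4 := hsq t ⟨1, by rw [h3]; ring⟩
      rw [Nat.isUnit_iff] at h4
      subst h4
      omega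
    rw [if_neg hns, sub_zero]
    have hlog0 : Real.log m0 ≤ Real.log m := by
      apply Real.log_le_log (by exact_mod_cast hm00)
      exact_mod_cast Nat.le_of_dvd hm0 ⟨f ^ 2, by rw [← hmf]; ring⟩
    calc |∑ e ∈ f.divisors, (ArithmeticFunction.moebius e : ℝ) * I e|
        ≤ ∑ e ∈ f.divisors, |(ArithmeticFunction.moebius e : ℝ) * I e| := Finset.abs_sum_le_sum_abs _ _
      _ ≤ ∑ e ∈ f.divisors, Real.sqrt m0 * (1 + Real.log m) := by
          refine Finset.sum_le_sum fun e _ => ?_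
          rw [abs_mul, hI, abs_mul]
          have hj : |(jacobiSym (e : ℤ) m0 : ℝ)| ≤ 1 := by
            rcases jacobiSym.trichotomy (e : ℤ) m0 with h | h | h <;> simp [h]
          have := jac_ap_sqfree Q m0 hQ hm0odd hsq h1 hcm0 ((e : ZMod Q)⁻¹ * c) (K / e)
          calc _ ≤ 1 * (1 * (Real.sqrt m0 * (1 + Real.log m0))) := by
                gcongr
                exact hmu e
            _ ≤ _ := by rw [one_mul, one_mul]; gcongr
      _ = f.divisors.card * (Real.sqrt m0 * (1 + Real.log m)) := by simp
      _ ≤ f * (Real.sqrt m0 * (1 + Real.log m)) := by gcongr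
      _ ≤ 2 * (Real.sqrt m * (1 + Real.log m)) := by
          rw [hfsqrt]
          have : 0 ≤ f * Real.sqrt m0 * (1 + Real.log m) := by positivity
          linarith
  · have hm01 : m0 = 1 := by omega
    subst hm01
    have hmf2 : m = f ^ 2 := by rw [← hmf]; ring
    have hs : IsSquare m := ⟨f, by rw [hmf2]; ring⟩
    rw [if_pos hs, hmf2, totient_sq f hf0, ← sum_moebius_div f hf0, Finset.mul_sum,
      ← Finset.sum_sub_distrib]
    have hsq2 : Real.sqrt ((f ^ 2 : ℕ) : ℝ) = f := by push_cast; exact Real.sqrt_sq (by positivity)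
    rw [hsq2]
    calc _ ≤ ∑ e ∈ f.divisors, |(ArithmeticFunction.moebius e : ℝ) * I e -
            (K : ℝ) / Q * ((ArithmeticFunction.moebius e : ℝ) / e)| := Finset.abs_sum_le_sum_abs _ _
      _ ≤ ∑ e ∈ f.divisors, 2 := by
          refine Finset.sum_le_sum fun e he => ?_
          have hepos := Nat.pos_of_mem_divisors he
          have heR : (0 : ℝ) < e := by exact_mod_cast hepos
          rw [show (ArithmeticFunction.moebius e : ℝ) * I e -
            (K : ℝ) / Q * ((ArithmeticFunction.moebius e : ℝ) / e) =
            (ArithmeticFunction.moebius e : ℝ) * (I e - (K : ℝ) / e / Q) by field_simp, abs_mul]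
          obtain ⟨c0, J, hJ, hJ2⟩ := ap_param Q hQ ((e : ZMod Q)⁻¹ * c) (K / e)
          have hIe : I e = J := by
            rw [hI]
            simp only [jacobiSym.one_right, Int.cast_one, one_mul]
            rw [hJ]
            simp
          rw [hIe]
          have hfl : |(((K / e : ℕ) : ℝ)) / Q - (K : ℝ) / e / Q| ≤ 1 := by
            rw [← sub_div, abs_div, abs_of_pos hQR, div_le_one hQR]
            have h2 : ((K / e : ℕ) : ℝ) ≤ (K : ℝ) / e := Nat.cast_div_le
            have h3 : (K : ℝ) / e ≤ ((K / e : ℕ) : ℝ) + 1 := by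
              rw [div_le_iff₀ heR]
              have := Nat.lt_mul_div_succ K hepos
              have : K ≤ (K / e + 1) * e := by rw [mul_comm]; exact this.le
              exact_mod_cast this
            have hQ1 : (1 : ℝ) ≤ Q := by exact_mod_cast hQ
            rw [abs_le]
            constructor <;> linarith
          have h4 : |(J : ℝ) - (K : ℝ) / e / Q| ≤ 2 := by
            have := abs_add_le ((J : ℝ) - ((K / e : ℕ) : ℝ) / Q) ((((K / e : ℕ) : ℝ)) / Q - (K : ℝ) / e / Q)
            rw [show (J : ℝ) - ((K / e : ℕ) : ℝ) / Q + ((((K / e : ℕ) : ℝ)) / Q - (K : ℝ) / e / Q) =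
              (J : ℝ) - (K : ℝ) / e / Q by ring] at this
            linarith
          have h5 := mul_le_mul (hmu e) h4 (abs_nonneg _) zero_le_one
          linarith
      _ = 2 * f.divisors.card := by simp [mul_comm]
      _ ≤ 2 * (f * (1 + Real.log ((f ^ 2 : ℕ) : ℝ))) := by
          have : 0 ≤ Real.log ((f ^ 2 : ℕ) : ℝ) := Real.log_natCast_nonneg _
          have hf' : (0 : ℝ) ≤ f := by positivity
          nlinarith

end JacAP

section DedekindEuler

set_option linter.style.haveILetI false

open Filter Topology NumberField IsDedekindDomain

variable (K : Type*) [Field K] [NumberField K]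

/-- The term of the Dedekind zeta function at a real point. -/
noncomputable def zfun (s : ℝ) (I : Ideal (𝓞 K)) : ℝ := (Ideal.absNorm I : ℝ) ^ (-s)

/-- Dedekind zeta function at a real point. -/
noncomputable def ZZ (s : ℝ) : ℝ := ∑' I : Ideal (𝓞 K), zfun K s I

lemma zfun_nonneg (s : ℝ) (I : Ideal (𝓞 K)) : 0 ≤ zfun K s I := by
  unfold zfun; positivity

lemma zfun_bot (s : ℝ) (hs : s ≠ 0) : zfun K s ⊥ = 0 := by
  simp [zfun, hs]

lemma zfun_top (s : ℝ) : zfun K s ⊤ = 1 := by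
  simp [zfun]

lemma zfun_mul (s : ℝ) (I J : Ideal (𝓞 K)) : zfun K s (I * J) = zfun K s I * zfun K s J := by
  unfold zfun
  rw [map_mul, Nat.cast_mul, Real.mul_rpow (by positivity) (by positivity)]

lemma icard_sum (n : ℕ) : (∑ k ∈ Finset.Icc 1 n, (Nat.card {I : Ideal (𝓞 K) // Ideal.absNorm I = k} : ℝ)) =
    (Nat.card {I : nonZeroDivisors (Ideal (𝓞 K)) // (Ideal.absNorm (I : Ideal (𝓞 K)) : ℝ) ≤ (n : ℝ)} : ℝ) := by
  simp only [Nat.cast_le, ← Nat.cast_sum]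
  congr 1
  rw [← add_left_inj 1, ← Ideal.card_norm_le_eq_card_norm_le_add_one,
    show Finset.Icc 1 n = Finset.Ioc 0 n from Finset.Icc_succ_left_eq_Ioc _ _,
    show 1 = Nat.card {I : Ideal (𝓞 K) // Ideal.absNorm I = 0} by simp [Ideal.absNorm_eq_zero_iff],
    Finset.sum_Ioc_add_eq_sum_Icc (n.zero_le),
    ← Finset.card_preimage_eq_sum_card_image_eq (fun k _ ↦ Ideal.finite_setOfPred_absNorm_eq k)]
  simp [Set.coe_eq_subtype]

lemma icard_summable (s : ℝ) (hs : 1 < s) :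
    LSeriesSummable (fun n ↦ ((Nat.card {I : Ideal (𝓞 K) // Ideal.absNorm I = n} : ℝ) : ℂ)) s := by
  refine LSeriesSummable_of_sum_norm_bigO_and_nonneg (r := 1) ?_ (fun _ => Nat.cast_nonneg _) zero_le_one (by simpa using hs)
  refine Asymptotics.isBigO_atTop_natCast_rpow_of_tendsto_div_rpow (a := (dedekindZeta_residue K)) ?_
  refine ((Ideal.tendsto_norm_le_div_atTop₀ K).comp tendsto_natCast_atTop_atTop).congr fun n ↦ ?_
  rw [icard_sum]
  simp

lemma term_icard (s : ℝ) (hs : 1 < s) (n : ℕ) :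
    HasSum (fun I : {I : Ideal (𝓞 K) // Ideal.absNorm I = n} => zfun K s I.1)
      ((LSeries.term (fun n ↦ ((Nat.card {I : Ideal (𝓞 K) // Ideal.absNorm I = n} : ℝ) : ℂ)) s n).re) := by
  haveI : Finite {I : Ideal (𝓞 K) // Ideal.absNorm I = n} := Ideal.finite_setOfPred_absNorm_eq n
  haveI := Fintype.ofFinite {I : Ideal (𝓞 K) // Ideal.absNorm I = n}
  have h1 : ∀ I : {I : Ideal (𝓞 K) // Ideal.absNorm I = n}, zfun K s I.1 = (n : ℝ) ^ (-s) := by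
    rintro ⟨I, rfl⟩
    rfl
  have h2 := hasSum_fintype (fun I : {I : Ideal (𝓞 K) // Ideal.absNorm I = n} => zfun K s I.1)
  convert h2 using 1
  simp_rw [h1]
  rw [Finset.sum_const, Finset.card_univ, ← Nat.card_eq_fintype_card, nsmul_eq_mul]
  rcases Nat.eq_zero_or_pos n with h | h
  · subst h
    simp [Real.zero_rpow (show -s ≠ 0 by linarith)]
  · rw [LSeries.term_of_ne_zero h.ne', Real.rpow_neg (by positivity),
      ← Complex.ofReal_natCast n, ← Complex.ofReal_cpow (by positivity), ← Complex.ofReal_div,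
      Complex.ofReal_re]
    rfl

lemma zfun_hasSum (s : ℝ) (hs : 1 < s) : HasSum (zfun K s) (dedekindZeta K s).re := by
  have h1 : HasSum (fun n => ((LSeries.term (fun n ↦ ((Nat.card {I : Ideal (𝓞 K) // Ideal.absNorm I = n} : ℝ) : ℂ)) s n).re))
      (dedekindZeta K s).re := Complex.hasSum_re (icard_summable K s hs).hasSum
  have h2 : Summable (fun x : (Σ n : ℕ, {I : Ideal (𝓞 K) // Ideal.absNorm I = n}) => zfun K s x.2.1) := by
    rw [summable_sigma_of_nonneg (fun x => zfun_nonneg K s _)]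
    refine ⟨fun n => (term_icard K s hs n).summable, ?_⟩
    refine h1.summable.congr fun n => ?_
    exact (term_icard K s hs n).tsum_eq.symm
  have h3 : HasSum (fun x : (Σ n : ℕ, {I : Ideal (𝓞 K) // Ideal.absNorm I = n}) => zfun K s x.2.1)
      (dedekindZeta K s).re := HasSum.of_sigma (fun n => term_icard K s hs n) h1 h2.hasSum.cauchySeq
  exact ((Equiv.sigmaFiberEquiv (fun I : Ideal (𝓞 K) => Ideal.absNorm I)).hasSum_iff (f := zfun K s)).mp h3

lemma zfun_summable (s : ℝ) (hs : 1 < s) : Summable (zfun K s) := (zfun_hasSum K s hs).summable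

lemma ZZ_tendsto : Tendsto (fun s : ℝ => (s - 1) * ZZ K s) (𝓝[>] 1) (𝓝 (dedekindZeta_residue K)) := by
  have h := (Complex.continuous_re.tendsto _).comp (tendsto_sub_one_mul_dedekindZeta_nhdsGT K)
  refine h.congr' ?_
  filter_upwards [self_mem_nhdsWithin] with s hs
  rw [ZZ, (zfun_hasSum K s hs).tsum_eq, Function.comp_apply, ← Complex.ofReal_one, ← Complex.ofReal_sub,
    Complex.re_ofReal_mul]

lemma ZZ_pos (s : ℝ) (hs : 1 < s) : 0 < ZZ K s := by
  have h := (zfun_summable K s hs).sum_le_tsum {⊤} (fun I _ => zfun_nonneg K s I)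
  simp only [Finset.sum_singleton, zfun_top] at h
  exact lt_of_lt_of_le one_pos h

/-- Ideals not divisible by the primes of a finite set. -/
def sievedIdeals (S : Finset (HeightOneSpectrum (𝓞 K))) : Set (Ideal (𝓞 K)) :=
  {I | ∀ P ∈ S, ¬ P.asIdeal ∣ I}

lemma sieved_hasSum (s : ℝ) (hs : 1 < s) (S : Finset (HeightOneSpectrum (𝓞 K))) :
    HasSum ((sievedIdeals K S).indicator (zfun K s)) (ZZ K s * ∏ P ∈ S, (1 - zfun K s P.asIdeal)) := by
  classical
  induction S using Finset.induction_on with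
  | empty =>
    have : sievedIdeals K ∅ = Set.univ := by ext; simp [sievedIdeals]
    rw [this, Set.indicator_univ]
    simpa [ZZ] using (zfun_summable K s hs).hasSum
  | insert P S hP ih =>
    have hinj : Function.Injective (fun I : Ideal (𝓞 K) => P.asIdeal * I) :=
      mul_right_injective₀ P.ne_bot
    set g : Ideal (𝓞 K) → ℝ := (sievedIdeals K S ∩ {I | P.asIdeal ∣ I}).indicator (zfun K s) with hg
    have h1 : HasSum g (zfun K s P.asIdeal * (ZZ K s * ∏ P ∈ S, (1 - zfun K s P.asIdeal))) := by
      rw [← hinj.hasSum_iff]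
      · refine (ih.mul_left (zfun K s P.asIdeal)).congr_fun fun I => ?_
        simp only [hg, Function.comp_apply, Set.indicator_apply]
        have : (P.asIdeal * I ∈ sievedIdeals K S ∩ {I | P.asIdeal ∣ I}) ↔ I ∈ sievedIdeals K S := by
          simp only [sievedIdeals, Set.mem_inter_iff, Set.mem_ofPred_eq]
          constructor
          · rintro ⟨h, -⟩ R hR hRI
            exact h R hR (hRI.mul_left _)
          · intro h
            refine ⟨fun R hR hd => ?_, Dvd.intro _ rfl⟩
            rcases R.prime.dvd_or_dvd hd with h' | h'
            · have : P.asIdeal = R.asIdeal := by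
                have h2 := Ideal.dvd_iff_le.mp h'
                exact (P.isMaximal.eq_of_le R.isPrime.ne_top h2)
              have : P = R := HeightOneSpectrum.ext this
              subst this
              exact hP hR
            · exact h R hR h'
        simp only [this, zfun_mul]
        split_ifs <;> simp
      · intro I hI
        simp only [hg, Set.indicator_apply]
        rw [if_neg]
        rintro ⟨-, J, hJ⟩
        exact hI ⟨J, hJ.symm⟩
    have h2 := ih.sub h1
    rw [Finset.prod_insert hP]
    convert! h2 using 1
    · ext I
      simp only [hg, Set.indicator_apply, sievedIdeals, Set.mem_inter_iff, Set.mem_ofPred_eq,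
        Finset.forall_mem_insert]
      by_cases ha : P.asIdeal ∣ I <;> by_cases hb : ∀ P ∈ S, ¬ P.asIdeal ∣ I <;> simp [ha, hb]
    · ring

/-- The primes above a rational number. -/
noncomputable def primesAbove (p : ℕ) : Finset (HeightOneSpectrum (𝓞 K)) := by
  classical
  exact if h : p = 0 then ∅ else
    (Ideal.finite_factors (I := Ideal.span {(p : 𝓞 K)}) (by simpa using h)).toFinset

variable {K} in
lemma mem_primesAbove {p : ℕ} (hp : p ≠ 0) (P : HeightOneSpectrum (𝓞 K)) :
    P ∈ primesAbove K p ↔ (p : 𝓞 K) ∈ P.asIdeal := by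
  simp [primesAbove, hp, Ideal.dvd_span_singleton]

/-- inverse of the local factor. -/
noncomputable def locf (s : ℝ) (p : ℕ) : ℝ := ∏ P ∈ primesAbove K p, (1 - zfun K s P.asIdeal)

lemma exists_prime_mem (P : HeightOneSpectrum (𝓞 K)) : ∃ p : ℕ, p.Prime ∧ (p : 𝓞 K) ∈ P.asIdeal := by
  have h1 : (Ideal.absNorm P.asIdeal : 𝓞 K) ∈ P.asIdeal := Ideal.absNorm_mem P.asIdeal
  have h0 : Ideal.absNorm P.asIdeal ≠ 0 := by
    rw [Ne, Ideal.absNorm_eq_zero_iff]; exact P.ne_bot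
  have key : ∀ n : ℕ, n ≠ 0 → (n : 𝓞 K) ∈ P.asIdeal → ∃ p : ℕ, p.Prime ∧ (p : 𝓞 K) ∈ P.asIdeal := by
    intro n
    induction n using Nat.recOnMul with
    | zero => intro h; exact absurd rfl h
    | one =>
      intro _ h
      exact absurd ((Ideal.eq_top_iff_one _).mpr (by simpa using h)) P.isPrime.ne_top
    | prime p hp => intro _ h; exact ⟨p, hp, h⟩
    | mul a b iha ihb =>
      intro h hm
      push_cast at hm
      rcases P.isPrime.mem_or_mem hm with h' | h'
      · exact iha (left_ne_zero_of_mul h) h'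
      · exact ihb (right_ne_zero_of_mul h) h'
  exact key _ h0 h1

lemma prime_mem_unique (P : HeightOneSpectrum (𝓞 K)) (p q : ℕ) (hp : p.Prime) (hq : q.Prime)
    (h1 : (p : 𝓞 K) ∈ P.asIdeal) (h2 : (q : 𝓞 K) ∈ P.asIdeal) : p = q := by
  by_contra hne
  have hc : Nat.Coprime p q := (Nat.coprime_primes hp hq).mpr hne
  have := Nat.isCoprime_iff_coprime.mpr hc
  obtain ⟨a, b, hab⟩ := this
  apply P.isPrime.ne_top
  rw [Ideal.eq_top_iff_one]
  have h3 : ((a : 𝓞 K) * p + b * q) = 1 := by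
    have := congrArg (Int.cast : ℤ → 𝓞 K) hab
    push_cast at this
    exact this
  rw [← h3]
  exact P.asIdeal.add_mem (P.asIdeal.mul_mem_left _ h1) (P.asIdeal.mul_mem_left _ h2)

lemma dedekind_euler (s : ℝ) (hs : 1 < s) :
    Tendsto (fun N : ℕ => ∏ p ∈ N.primesBelow, locf K s p) atTop (𝓝 (ZZ K s)⁻¹) := by
  classical
  set S : ℕ → Finset (HeightOneSpectrum (𝓞 K)) := fun N => N.primesBelow.biUnion (primesAbove K) with hS
  have hprod : ∀ N, ∏ p ∈ N.primesBelow, locf K s p = ∏ P ∈ S N, (1 - zfun K s P.asIdeal) := by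
    intro N
    rw [hS, Finset.prod_biUnion]
    · rfl
    · intro p hp q hq hpq
      have hp' := Nat.prime_of_mem_primesBelow hp
      have hq' := Nat.prime_of_mem_primesBelow hq
      rw [Function.onFun, Finset.disjoint_left]
      intro P h1 h2
      rw [mem_primesAbove hp'.ne_zero] at h1
      rw [mem_primesAbove hq'.ne_zero] at h2
      exact hpq (prime_mem_unique K P p q hp' hq' h1 h2)
  have hlim : Tendsto (fun N : ℕ => ∑' I, (sievedIdeals K (S N)).indicator (zfun K s) I) atTop
      (𝓝 (∑' I, ({⊤} : Set (Ideal (𝓞 K))).indicator (zfun K s) I)) := by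
    refine tendsto_tsum_of_dominated_convergence (zfun_summable K s hs) ?_ ?_
    · intro I
      by_cases hI : I = ⊤
      · subst hI
        refine tendsto_const_nhds.congr fun N => ?_
        rw [Set.indicator_of_mem (by simp), Set.indicator_of_mem]
        intro P _ hd
        exact P.isPrime.ne_top (top_le_iff.mp (Ideal.dvd_iff_le.mp hd))
      · rw [Set.indicator_of_notMem (by simpa using hI)]
        by_cases hb : I = ⊥
        · subst hb
          refine tendsto_const_nhds.congr fun N => ?_
          rw [Set.indicator_apply]
          split_ifs
          · rw [zfun_bot K s (by linarith)]
          · rfl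
        · obtain ⟨m, hm, hIm⟩ := Ideal.exists_le_maximal I hI
          have hmb : m ≠ ⊥ := by
            rintro rfl
            exact hb (le_bot_iff.mp hIm)
          obtain ⟨p, hp, hpm⟩ := exists_prime_mem K ⟨m, hm.isPrime, hmb⟩
          refine tendsto_const_nhds.congr' ?_
          filter_upwards [eventually_gt_atTop p] with N hN
          rw [Set.indicator_of_notMem]
          intro h
          refine h ⟨m, hm.isPrime, hmb⟩ ?_ (Ideal.dvd_iff_le.mpr hIm)
          simp only [hS, Finset.mem_biUnion]
          exact ⟨p, Nat.mem_primesBelow.mpr ⟨hN, hp⟩, (mem_primesAbove hp.ne_zero _).mpr hpm⟩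
    · refine Eventually.of_forall fun N I => ?_
      rw [Real.norm_eq_abs, abs_of_nonneg (Set.indicator_nonneg (fun _ _ => zfun_nonneg K s _) _)]
      exact Set.indicator_le_self' (fun _ _ => zfun_nonneg K s _) I
  have h1 : ∑' I, ({⊤} : Set (Ideal (𝓞 K))).indicator (zfun K s) I = 1 := by
    rw [tsum_eq_single ⊤]
    · simp [zfun_top]
    · intro I hI
      rw [Set.indicator_of_notMem (by simpa using hI)]
  rw [h1] at hlim
  have h2 := hlim.const_mul (ZZ K s)⁻¹
  rw [mul_one] at h2
  refine h2.congr fun N => ?_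
  rw [(sieved_hasSum K s hs (S N)).tsum_eq, hprod, ← mul_assoc, inv_mul_cancel₀ (ZZ_pos K s hs).ne', one_mul]

end DedekindEuler

section Biquad

set_option linter.style.haveILetI false

open NumberField

/-- The data of a biquadratic field. -/
structure Biq (d Δ : ℤ) (M : Type*) [Field M] [NumberField M] (c s : M) : Prop where
  hc : c ^ 2 = (d : M)
  hs : s ^ 2 = (Δ : M)
  rank : Module.finrank ℚ M = 4
  nd : ∀ q : ℚ, q ^ 2 ≠ (d : ℚ)
  nD : ∀ q : ℚ, q ^ 2 ≠ (Δ : ℚ)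
  ndD : ∀ q : ℚ, (d : ℚ) * q ^ 2 ≠ (Δ : ℚ)
  sqd : Squarefree d
  fund : ∃ m : ℤ, Squarefree m ∧ (Δ = m ∨ Δ = 4 * m)

/-- A rational number is an integer. -/
def IsI (q : ℚ) : Prop := ∃ z : ℤ, q = z

lemma IsI.add {a b : ℚ} (ha : IsI a) (hb : IsI b) : IsI (a + b) := by
  obtain ⟨x, rfl⟩ := ha; obtain ⟨y, rfl⟩ := hb; exact ⟨x + y, by push_cast; ring⟩

lemma IsI.sub {a b : ℚ} (ha : IsI a) (hb : IsI b) : IsI (a - b) := by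
  obtain ⟨x, rfl⟩ := ha; obtain ⟨y, rfl⟩ := hb; exact ⟨x - y, by push_cast; ring⟩

lemma IsI.mul {a b : ℚ} (ha : IsI a) (hb : IsI b) : IsI (a * b) := by
  obtain ⟨x, rfl⟩ := ha; obtain ⟨y, rfl⟩ := hb; exact ⟨x * y, by push_cast; ring⟩

lemma IsI.int (a : ℤ) : IsI (a : ℚ) := ⟨a, rfl⟩

lemma IsI.of_sq {a : ℚ} (h : IsI (a ^ 2)) : IsI a := by
  obtain ⟨z, hz⟩ := h
  have h1 : IsIntegral ℤ (a ^ 2) := by rw [hz]; exact isIntegral_algebraMap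
  have h2 : IsIntegral ℤ a := IsIntegral.of_pow two_pos h1
  obtain ⟨y, hy⟩ := IsIntegrallyClosed.isIntegral_iff.mp h2
  exact ⟨y, by rw [← hy]; rfl⟩

section El

variable {M : Type*} [Field M] [NumberField M]

/-- elements in coordinates -/
def el (c s : M) (a b e f : ℚ) : M := (a : M) + (b : M) * c + (e : M) * s + (f : M) * (c * s)

variable {d Δ : ℤ} {c s : M}

lemma el_add (a b e f a' b' e' f' : ℚ) :
    el c s a b e f + el c s a' b' e' f' = el c s (a + a') (b + b') (e + e') (f + f') := by
  simp only [el]; push_cast; ring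

lemma el_smul (q a b e f : ℚ) : (q : M) * el c s a b e f = el c s (q * a) (q * b) (q * e) (q * f) := by
  simp only [el]; push_cast; ring

lemma Biq.el_mul (h : Biq d Δ M c s) (a b e f a' b' e' f' : ℚ) :
    el c s a b e f * el c s a' b' e' f' =
      el c s (a * a' + d * b * b' + Δ * (e * e' + d * f * f'))
        (a * b' + b * a' + Δ * (e * f' + f * e'))
        (a * e' + e * a' + d * (b * f' + f * b'))
        (a * f' + f * a' + b * e' + e * b') := by
  have hc := h.hc
  have hs := h.hs
  simp only [el]
  push_cast
  linear_combination (b * b' + (e * f' + f * e' * 0) * 0 + f * f' * s ^ 2 + (b * f' + f * b') * s : M) * hc +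
    (e * e' + (e * f' + f * e') * c + f * f' * d : M) * hs

lemma Biq.quad_zero (h : Biq d Δ M c s) (u v : ℚ) (huv : (u : M) + v * c = 0) : u = 0 ∧ v = 0 := by
  have hc := h.hc
  by_cases hv : v = 0
  · subst hv
    simp at huv
    exact ⟨by exact_mod_cast huv, rfl⟩
  · exfalso
    have hvM : (v : M) ≠ 0 := by exact_mod_cast hv
    have h1 : c = ((-u / v : ℚ) : M) := by
      push_cast
      field_simp
      linear_combination huv
    rw [h1] at hc
    exact h.nd _ (by exact_mod_cast hc)

lemma Biq.el_zero (h : Biq d Δ M c s) (a b e f : ℚ) (h0 : el c s a b e f = 0) :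
    a = 0 ∧ b = 0 ∧ e = 0 ∧ f = 0 := by
  have hc := h.hc
  have hs := h.hs
  have h1 : ((a : M) + b * c) + ((e : M) + f * c) * s = 0 := by
    rw [← h0, el]; ring
  by_cases hb : (e : M) + f * c = 0
  · obtain ⟨he, hf⟩ := h.quad_zero e f hb
    rw [hb] at h1
    simp at h1
    obtain ⟨ha, hb⟩ := h.quad_zero a b h1
    exact ⟨ha, hb, he, hf⟩
  · exfalso
    -- norm of the coefficient
    have hN : (e ^ 2 - d * f ^ 2 : ℚ) ≠ 0 := by
      intro hN
      by_cases hf : f = 0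
      · subst hf
        simp at hN
        subst hN
        simp at hb
      · apply h.nd (e / f)
        field_simp
        linarith
    have hNM : ((e ^ 2 - d * f ^ 2 : ℚ) : M) ≠ 0 := by exact_mod_cast hN
    obtain ⟨u, v, huv⟩ : ∃ u v : ℚ, s = (u : M) + v * c := by
      refine ⟨-(a * e - d * b * f) / (e ^ 2 - d * f ^ 2), -(b * e - a * f) / (e ^ 2 - d * f ^ 2), ?_⟩
      push_cast at hNM ⊢
      field_simp
      linear_combination (e - f * c : M) * h1 + (-(f * b + f ^ 2 * s) * (-1) : M) * hc
    have h2 : ((u ^ 2 + d * v ^ 2 - Δ : ℚ) : M) + ((2 * u * v : ℚ) : M) * c = 0 := by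
      rw [huv] at hs
      push_cast
      linear_combination hs - (v : M) ^ 2 * hc
    obtain ⟨h3, h4⟩ := h.quad_zero _ _ h2
    rcases mul_eq_zero.mp h4 with h5 | h5
    · have : u = 0 := by linarith
      subst this
      exact h.ndD v (by linarith)
    · subst h5
      exact h.nD u (by linarith)

lemma Biq.linInd (h : Biq d Δ M c s) : LinearIndependent ℚ ![1, c, s, c * s] := by
  rw [Fintype.linearIndependent_iff]
  intro g hg
  simp only [Fin.sum_univ_four, Matrix.cons_val, Rat.smul_def] at hg
  have := h.el_zero (g 0) (g 1) (g 2) (g 3) (by rw [← hg, el]; simp)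
  intro i
  fin_cases i <;> simp [this]

/-- The coordinate basis. -/
noncomputable def Biq.basis (h : Biq d Δ M c s) : Module.Basis (Fin 4) ℚ M :=
  basisOfLinearIndependentOfCardEqFinrank h.linInd (by rw [h.rank]; rfl)

lemma Biq.basis_coe (h : Biq d Δ M c s) : ⇑h.basis = ![1, c, s, c * s] :=
  coe_basisOfLinearIndependentOfCardEqFinrank _ _

lemma Biq.el_surj (h : Biq d Δ M c s) (x : M) : ∃ a b e f : ℚ, x = el c s a b e f := by
  refine ⟨h.basis.repr x 0, h.basis.repr x 1, h.basis.repr x 2, h.basis.repr x 3, ?_⟩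
  conv_lhs => rw [← h.basis.sum_repr x]
  simp [Fin.sum_univ_four, h.basis_coe, Rat.smul_def, el]

lemma Biq.el_inj (h : Biq d Δ M c s) {a b e f a' b' e' f' : ℚ}
    (hh : el c s a b e f = el c s a' b' e' f') : a = a' ∧ b = b' ∧ e = e' ∧ f = f' := by
  have := h.el_zero (a - a') (b - b') (e - e') (f - f') (by
    rw [show el c s (a - a') (b - b') (e - e') (f - f') = el c s a b e f - el c s a' b' e' f' by
      simp only [el]; push_cast; ring, hh, sub_self])
  obtain ⟨h1, h2, h3, h4⟩ := this
  exact ⟨by linarith, by linarith, by linarith, by linarith⟩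

/-- The ℚ-linear coordinate map to another field. -/
noncomputable def Biq.map (h : Biq d Δ M c s) {L : Type*} [Field L] [NumberField L] (c' s' : L) :
    M →ₗ[ℚ] L := h.basis.constr ℚ ![1, c', s', c' * s']

lemma Biq.map_el (h : Biq d Δ M c s) {L : Type*} [Field L] [NumberField L] (c' s' : L) (a b e f : ℚ) :
    h.map c' s' (el c s a b e f) = el c' s' a b e f := by
  have h0 := h.basis.constr_basis ℚ ![1, c', s', c' * s'] 0
  have h1 := h.basis.constr_basis ℚ ![1, c', s', c' * s'] 1
  have h2 := h.basis.constr_basis ℚ ![1, c', s', c' * s'] 2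
  have h3 := h.basis.constr_basis ℚ ![1, c', s', c' * s'] 3
  simp only [h.basis_coe, Matrix.cons_val] at h0 h1 h2 h3
  have : el c s a b e f = a • (1 : M) + b • c + e • s + f • (c * s) := by
    simp [el, Rat.smul_def]
  rw [this]
  simp only [Biq.map, map_add, map_smul, h0, h1, h2, h3]
  simp [el, Rat.smul_def]

/-- ring homs given by signs -/
lemma Biq.exists_hom (h : Biq d Δ M c s) (c' s' : M) (hc' : c' ^ 2 = (d : M)) (hs' : s' ^ 2 = (Δ : M)) :
    ∃ φ : M →+* M, ∀ a b e f : ℚ, φ (el c s a b e f) = el c' s' a b e f := by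
  refine ⟨⟨⟨⟨h.map c' s', ?_⟩, ?_⟩, ?_, ?_⟩, fun a b e f => h.map_el c' s' a b e f⟩
  · have : (1 : M) = el c s 1 0 0 0 := by simp [el]
    rw [this, h.map_el]
    simp [el]
  · intro x y
    obtain ⟨a, b, e, f, rfl⟩ := h.el_surj x
    obtain ⟨a', b', e', f', rfl⟩ := h.el_surj y
    simp only
    rw [h.el_mul, h.map_el, h.map_el, h.map_el]
    simp only [el]
    push_cast
    linear_combination -(b * b' + f * f' * s' ^ 2 + (b * f' + f * b') * s' : M) * hc' -
      (e * e' + (e * f' + f * e') * c' + f * f' * d : M) * hs'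
  · exact map_zero (h.map c' s')
  · exact map_add (h.map c' s')

lemma isInt_rat (q : ℚ) : IsIntegral ℤ (q : M) ↔ IsI q := by
  constructor
  · intro h
    have h1 : IsIntegral ℤ (algebraMap ℚ M q) := by simpa using h
    have h2 : IsIntegral ℤ q := (isIntegral_algebraMap_iff (algebraMap ℚ M).injective).mp h1
    obtain ⟨y, hy⟩ := IsIntegrallyClosed.isIntegral_iff.mp h2
    exact ⟨y, by rw [← hy]; rfl⟩
  · rintro ⟨z, rfl⟩
    have : ((z : ℚ) : M) = algebraMap ℤ M z := by simp
    rw [this]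
    exact isIntegral_algebraMap

/-- root of a monic quadratic with integral coefficients. -/
lemma isInt_quad (x t n : M) (ht : IsIntegral ℤ t) (hn : IsIntegral ℤ n) (hx : x ^ 2 - t * x + n = 0) :
    IsIntegral ℤ x := by
  have : IsIntegral (integralClosure ℤ M) x := by
    refine ⟨Polynomial.X ^ 2 - Polynomial.C ⟨t, ht⟩ * Polynomial.X + Polynomial.C ⟨n, hn⟩, ?_, ?_⟩
    · monicity!
    · simp only [Polynomial.eval₂_add, Polynomial.eval₂_sub, Polynomial.eval₂_mul, Polynomial.eval₂_pow,
        Polynomial.eval₂_X, Polynomial.eval₂_C]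
      exact hx
  exact isIntegral_trans (R := ℤ) (A := integralClosure ℤ M) x this

lemma Biq.isInt_c (h : Biq d Δ M c s) (u v : ℚ) :
    IsIntegral ℤ (el c s u v 0 0) ↔ IsI (2 * u) ∧ IsI (u ^ 2 - d * v ^ 2) := by
  constructor
  · intro hx
    obtain ⟨φ, hφ⟩ := h.exists_hom (-c) s (by rw [neg_sq, h.hc]) h.hs
    have h1 : IsIntegral ℤ (φ (el c s u v 0 0)) := hx.map φ.toIntAlgHom
    rw [hφ] at h1
    constructor
    · rw [← isInt_rat (M := M)]
      have h3 := hx.add h1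
      rwa [show el c s u v 0 0 + el (-c) s u v 0 0 = ((2 * u : ℚ) : M) by
        simp only [el]; push_cast; ring] at h3
    · rw [← isInt_rat (M := M)]
      have h3 := hx.mul h1
      have hc := h.hc
      rwa [show el c s u v 0 0 * el (-c) s u v 0 0 = ((u ^ 2 - d * v ^ 2 : ℚ) : M) by
        simp only [el]; push_cast
        linear_combination (-v ^ 2 : M) * hc] at h3
  · rintro ⟨h1, h2⟩
    refine isInt_quad _ _ _ ((isInt_rat (M := M) _).mpr h1) ((isInt_rat (M := M) _).mpr h2) ?_
    have hc := h.hc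
    simp only [el]; push_cast
    linear_combination (v ^ 2 : M) * hc

lemma Biq.isInt_el (h : Biq d Δ M c s) (a b e f : ℚ) :
    IsIntegral ℤ (el c s a b e f) ↔ (IsI (4 * a) ∧ IsI (4 * (a ^ 2 - d * b ^ 2))) ∧
      (IsI (2 * (a ^ 2 + d * b ^ 2 - Δ * (e ^ 2 + d * f ^ 2))) ∧
       IsI ((a ^ 2 + d * b ^ 2 - Δ * (e ^ 2 + d * f ^ 2)) ^ 2 - d * (2 * (a * b - Δ * e * f)) ^ 2)) := by
  have e1 : (IsI (4 * a) ∧ IsI (4 * (a ^ 2 - d * b ^ 2))) ↔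
      (IsI (2 * (2 * a)) ∧ IsI ((2 * a) ^ 2 - d * (2 * b) ^ 2)) := by
    rw [show 2 * (2 * a) = 4 * a by ring, show (2 * a) ^ 2 - d * (2 * b) ^ 2 = 4 * (a ^ 2 - d * b ^ 2) by ring]
  rw [e1, ← h.isInt_c, ← h.isInt_c]
  constructor
  · intro hx
    obtain ⟨φ, hφ⟩ := h.exists_hom c (-s) h.hc (by rw [neg_sq, h.hs])
    have h1 : IsIntegral ℤ (φ (el c s a b e f)) := hx.map φ.toIntAlgHom
    rw [hφ] at h1
    constructor
    · have h3 := hx.add h1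
      rwa [show el c s a b e f + el c (-s) a b e f = el c s (2 * a) (2 * b) 0 0 by
        simp only [el]; push_cast; ring] at h3
    · have h3 := hx.mul h1
      have hc := h.hc
      have hs := h.hs
      rwa [show el c s a b e f * el c (-s) a b e f =
          el c s (a ^ 2 + d * b ^ 2 - Δ * (e ^ 2 + d * f ^ 2)) (2 * (a * b - Δ * e * f)) 0 0 by
        simp only [el]; push_cast
        linear_combination (b ^ 2 - Δ * f ^ 2 : M) * hc - ((e + f * c) ^ 2 : M) * hs] at h3
  · rintro ⟨h1, h2⟩
    refine isInt_quad _ _ _ h1 h2 ?_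
    have hc := h.hc
    have hs := h.hs
    simp only [el]; push_cast
    linear_combination (-b ^ 2 + Δ * f ^ 2 : M) * hc + ((e + f * c) ^ 2 : M) * hs

end El

end Biquad

section Transfer

set_option linter.style.haveILetI false

open NumberField IsDedekindDomain

lemma isI_of_sq_mul_squarefree (q : ℚ) (m : ℤ) (hm : Squarefree m) (h : IsI (q ^ 2 * m)) : IsI q := by
  obtain ⟨z, hz⟩ := h
  have hden : (q.den : ℚ) ≠ 0 := by exact_mod_cast q.den_ne_zero
  have h1 : (q.num : ℚ) ^ 2 * m = z * (q.den : ℚ) ^ 2 := by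
    rw [← hz]
    nth_rewrite 2 [← Rat.num_div_den q]
    field_simp
  have h2 : q.num ^ 2 * m = z * (q.den : ℤ) ^ 2 := by exact_mod_cast h1
  have hcop : IsCoprime ((q.den : ℤ) ^ 2) (q.num ^ 2) := by
    apply IsCoprime.pow
    rw [Int.isCoprime_iff_gcd_eq_one, Int.gcd_comm]
    have := q.reduced
    simpa [Int.gcd, Nat.Coprime] using this
  have h3 : (q.den : ℤ) ^ 2 ∣ m := hcop.dvd_of_dvd_mul_left ⟨z, by rw [h2]; ring⟩
  have h4 := hm (q.den : ℤ) (by rw [← sq]; exact h3)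
  have h5 : q.den = 1 := by
    have := Int.isUnit_iff.mp h4
    omega
  exact ⟨q.num, ((Rat.den_eq_one_iff q).mp h5).symm⟩

lemma isI_of_coprime (q : ℚ) (U V : ℤ) (hUV : IsCoprime U V) (h1 : IsI (q * U)) (h2 : IsI (q * V)) : IsI q := by
  obtain ⟨a, b, hab⟩ := hUV
  have : q = a * (q * U) + b * (q * V) := by
    have : ((a * U + b * V : ℤ) : ℚ) = 1 := by rw [hab]; norm_num
    push_cast at this
    linear_combination -q * this
  rw [this]
  exact ((IsI.int a).mul h1).add ((IsI.int b).mul h2)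

lemma denom_aux (d Δ : ℤ) (hf : ∃ m : ℤ, Squarefree m ∧ (Δ = m ∨ Δ = 4 * m)) (u v : ℚ)
    (h1 : IsI (2 * Δ * (u ^ 2 + d * v ^ 2))) (h2 : IsI (4 * d * Δ * u * v)) :
    IsI (4 * d * u) ∧ IsI (4 * d * v) := by
  obtain ⟨m, hm, hΔ⟩ := hf
  obtain ⟨q, U, V, hUV, rfl, rfl⟩ : ∃ (q : ℚ) (U V : ℤ), IsCoprime U V ∧ u = q * U ∧ v = q * V := by
    by_cases h0 : u = 0 ∧ v = 0
    · exact ⟨0, 1, 0, isCoprime_one_left, by simp [h0.1], by simp [h0.2]⟩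
    · have hud : (u.den : ℚ) ≠ 0 := by exact_mod_cast u.den_ne_zero
      have hvd : (v.den : ℚ) ≠ 0 := by exact_mod_cast v.den_ne_zero
      set U0 : ℤ := u.num * v.den with hU0
      set V0 : ℤ := v.num * u.den with hV0
      have hne : Int.gcd U0 V0 ≠ 0 := by
        intro hg
        rw [Int.gcd_eq_zero_iff] at hg
        apply h0
        constructor
        · rcases mul_eq_zero.mp hg.1 with h | h
          · exact Rat.num_eq_zero.mp h
          · exact absurd h (by exact_mod_cast v.den_ne_zero)
        · rcases mul_eq_zero.mp hg.2 with h | h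
          · exact Rat.num_eq_zero.mp h
          · exact absurd h (by exact_mod_cast u.den_ne_zero)
      obtain ⟨U, hU⟩ := Int.gcd_dvd_left (a := U0) (b := V0)
      obtain ⟨V, hV⟩ := Int.gcd_dvd_right (a := U0) (b := V0)
      refine ⟨(Int.gcd U0 V0 : ℚ) / (u.den * v.den), U, V, ?_, ?_, ?_⟩
      · rw [Int.isCoprime_iff_gcd_eq_one]
        have h3 : Int.gcd U0 V0 = Int.gcd U0 V0 * Int.gcd U V := by
          have h4 := Int.gcd_mul_left (Int.gcd U0 V0 : ℤ) U V
          rw [← hU, ← hV] at h4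
          simpa using h4
        exact Nat.eq_of_mul_eq_mul_left (Nat.pos_of_ne_zero hne) (by rw [← h3, mul_one])
      · have : (U0 : ℚ) = (Int.gcd U0 V0 : ℚ) * U := by exact_mod_cast hU
        rw [div_mul_eq_mul_div, ← this, hU0]
        push_cast
        rw [mul_div_mul_right _ _ hvd, Rat.num_div_den]
      · have : (V0 : ℚ) = (Int.gcd U0 V0 : ℚ) * V := by exact_mod_cast hV
        rw [div_mul_eq_mul_div, ← this, hV0]
        push_cast
        rw [mul_comm (u.den : ℚ), mul_div_mul_right _ _ hud, Rat.num_div_den]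
  have h3 : IsI ((4 * d ^ 2 * Δ * q ^ 2) * ((U ^ 3 : ℤ) : ℚ)) := by
    have := ((IsI.int (2 * d ^ 2 * U)).mul h1).sub ((IsI.int (d ^ 2 * V)).mul h2)
    convert this using 1
    push_cast; ring
  have h4 : IsI ((4 * d ^ 2 * Δ * q ^ 2) * ((V ^ 3 : ℤ) : ℚ)) := by
    have := ((IsI.int (2 * d * V)).mul h1).sub ((IsI.int U).mul h2)
    convert this using 1
    push_cast; ring
  have h5 := isI_of_coprime _ _ _ (hUV.pow (m := 3) (n := 3)) h3 h4
  have h6 : IsI ((4 * d * q) ^ 2 * m) := by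
    rcases hΔ with h | h
    · convert (IsI.int 4).mul h5 using 1
      rw [h]; push_cast; ring
    · convert h5 using 1
      rw [h]; push_cast; ring
  have h7 := isI_of_sq_mul_squarefree _ _ hm h6
  constructor
  · convert h7.mul (IsI.int U) using 1; ring
  · convert h7.mul (IsI.int V) using 1; ring

variable {M : Type*} [Field M] [NumberField M] {d Δ : ℤ} {c s : M}

lemma Biq.denom (h : Biq d Δ M c s) (a b e f : ℚ) (hx : IsIntegral ℤ (el c s a b e f)) :
    (IsI (8 * d * a) ∧ IsI (8 * d * b)) ∧ IsI (8 * d * e) ∧ IsI (8 * d * f) := by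
  obtain ⟨⟨h1, h2⟩, h3, h4⟩ := (h.isInt_el a b e f).mp hx
  have hb : IsI (4 * d * b) := by
    apply IsI.of_sq
    convert (IsI.int d).mul ((h1.mul h1).sub ((IsI.int 4).mul h2)) using 1
    push_cast; ring
  have hint1 := (h.isInt_c (2 * a) (2 * b)).mpr ⟨by convert h1 using 1; ring, by convert h2 using 1; ring⟩
  have hint2 := (h.isInt_c _ _).mpr ⟨h3, h4⟩
  have hint3 : IsIntegral ℤ (el c s (Δ * ((2 * e) ^ 2 + d * (2 * f) ^ 2)) (2 * Δ * (2 * e) * (2 * f)) 0 0) := by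
    have h4M : IsIntegral ℤ ((4 : ℚ) : M) := (isInt_rat (M := M) 4).mpr (IsI.int 4)
    have h5 := (hint1.mul hint1).sub (h4M.mul hint2)
    rw [h.el_mul, el_smul] at h5
    rw [sub_eq_add_neg, ← neg_one_mul, show (-1 : M) = ((-1 : ℚ) : M) by norm_num, el_smul, el_add] at h5
    have h6 : ∀ x y : M, x = y → IsIntegral ℤ x → IsIntegral ℤ y := fun x y hxy hx => hxy ▸ hx
    refine h6 _ _ ?_ h5
    congr 1 <;> ring
  obtain ⟨h5, h6⟩ := (h.isInt_c _ _).mp hint3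
  have h7 : IsI (4 * d * Δ * (2 * e) * (2 * f)) := by
    apply IsI.of_sq
    convert (IsI.int d).mul ((h5.mul h5).sub ((IsI.int 4).mul h6)) using 1
    push_cast; ring
  obtain ⟨h8, h9⟩ := denom_aux d Δ h.fund (2 * e) (2 * f) (by convert h5 using 1; ring) h7
  refine ⟨⟨?_, ?_⟩, ?_, ?_⟩
  · convert (IsI.int (2 * d)).mul h1 using 1; push_cast; ring
  · convert (IsI.int 2).mul hb using 1; push_cast; ring
  · convert h8 using 1; ring
  · convert h9 using 1; ring

lemma Biq.d_ne (h : Biq d Δ M c s) : (d : ℚ) ≠ 0 := fun h0 => h.nd 0 (by rw [h0]; norm_num)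

lemma Biq.D_ne (h : Biq d Δ M c s) : (Δ : ℚ) ≠ 0 := fun h0 => h.nD 0 (by rw [h0]; norm_num)

/-- Coordinates with denominators. -/
lemma Biq.coords (h : Biq d Δ M c s) (x : M) (hx : IsIntegral ℤ x) :
    ∃ A B E F : ℤ, x = el c s (A / (8 * d)) (B / (8 * d)) (E / (8 * d)) (F / (8 * d)) := by
  obtain ⟨a, b, e, f, rfl⟩ := h.el_surj x
  obtain ⟨⟨⟨A, hA⟩, B, hB⟩, ⟨E, hE⟩, F, hF⟩ := h.denom a b e f hx
  refine ⟨A, B, E, F, ?_⟩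
  have hd := h.d_ne
  rw [← hA, ← hB, ← hE, ← hF]
  congr 1 <;> field_simp

variable {M' : Type*} [Field M'] [NumberField M'] {Δ' : ℤ} {c' s' : M'}

lemma Biq.transfer (h : Biq d Δ M c s) (h' : Biq d Δ' M' c' s') (k : ℤ) (hk : Δ' = Δ + (8 * d) ^ 5 * k)
    (a b e f : ℚ) (hx : IsIntegral ℤ (el c s a b e f)) : IsIntegral ℤ (el c' s' a b e f) := by
  obtain ⟨⟨⟨A, hA⟩, B, hB⟩, ⟨E, hE⟩, F, hF⟩ := h.denom a b e f hx
  obtain ⟨⟨h1, h2⟩, h3, h4⟩ := (h.isInt_el a b e f).mp hx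
  rw [h'.isInt_el]
  have hk' : (Δ' : ℚ) = Δ + (8 * d) ^ 5 * k := by rw [hk]; push_cast; ring
  refine ⟨⟨h1, h2⟩, ?_, ?_⟩
  · convert h3.sub (IsI.int (2 * (8 * d) ^ 3 * k * (E ^ 2 + d * F ^ 2))) using 1
    push_cast
    rw [← hE, ← hF, hk']
    ring
  · set p : ℤ := A ^ 2 + d * B ^ 2 - Δ * (E ^ 2 + d * F ^ 2) with hp
    set r : ℤ := A * B - Δ * E * F with hr
    have := h4.add (IsI.int (-2 * p * (8 * d) * k * (E ^ 2 + d * F ^ 2) + (8 * d) ^ 6 * k ^ 2 * (E ^ 2 + d * F ^ 2) ^ 2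
      - 4 * d * (-2 * r * (8 * d) * k * (E * F) + (8 * d) ^ 6 * k ^ 2 * (E * F) ^ 2)))
    convert this using 1
    rw [hp, hr]
    push_cast
    rw [← hE, ← hF, ← hA, ← hB, hk']
    have hd := h.d_ne
    field_simp
    ring

end Transfer

section BadPrimes

set_option linter.style.haveILetI false

open NumberField IsDedekindDomain

lemma locf_eq_of_surj {K : Type*} [Field K] [NumberField K] (s : ℝ) (p : ℕ) (hp : p ≠ 0)
    {A : Type*} [CommRing A] [Fintype (PrimeSpectrum A)] (f : 𝓞 K →+* A) (hf : Function.Surjective f)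
    (hker : RingHom.ker f = Ideal.span {(p : 𝓞 K)}) :
    locf K s p = ∏ q : PrimeSpectrum A, (1 - ((Nat.card (A ⧸ q.asIdeal) : ℕ) : ℝ) ^ (-s)) := by
  symm
  have hpK : (p : 𝓞 K) ≠ 0 := by exact_mod_cast hp
  have hmem : ∀ q : PrimeSpectrum A, (p : 𝓞 K) ∈ Ideal.comap f q.asIdeal := by
    intro q
    have : (p : 𝓞 K) ∈ RingHom.ker f := by rw [hker]; exact Ideal.mem_span_singleton_self _
    rw [Ideal.mem_comap, (RingHom.mem_ker).mp this]
    exact zero_mem _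
  unfold locf
  refine Finset.prod_bij (fun q _ => (⟨Ideal.comap f q.asIdeal, ?_, ?_⟩ : HeightOneSpectrum (𝓞 K))) ?_ ?_ ?_ ?_
  · exact q.isPrime.comap f
  · intro h0
    have := hmem q
    rw [h0] at this
    exact hpK this
  · intro q _
    rw [mem_primesAbove hp]
    exact hmem q
  · intro q _ q' _ h
    have h1 := congrArg HeightOneSpectrum.asIdeal h
    simp only at h1
    exact PrimeSpectrum.ext (Ideal.comap_injective_of_surjective f hf h1)
  · intro P hP
    rw [mem_primesAbove hp] at hP
    have hle : RingHom.ker f ≤ P.asIdeal := by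
      rw [hker, Ideal.span_le]; simpa using hP
    haveI := P.isPrime
    refine ⟨⟨Ideal.map f P.asIdeal, Ideal.map_isPrime_of_surjective hf hle⟩, Finset.mem_univ _, ?_⟩
    apply HeightOneSpectrum.ext
    simp only
    rw [Ideal.comap_map_of_surjective f hf]
    exact sup_eq_left.mpr hle
  · intro q _
    simp only [zfun]
    congr 2
    rw [Ideal.absNorm_apply, Submodule.cardQuot_apply]
    have hs : Function.Surjective ((Ideal.Quotient.mk q.asIdeal).comp f) :=
      Ideal.Quotient.mk_surjective.comp hf
    have e := RingHom.quotientKerEquivOfSurjective hs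
    have hk : RingHom.ker ((Ideal.Quotient.mk q.asIdeal).comp f) = Ideal.comap f q.asIdeal := by
      ext x; simp [RingHom.mem_ker, Ideal.Quotient.eq_zero_iff_mem]
    rw [← Nat.card_congr e.toEquiv, hk]

variable {M : Type*} [Field M] [NumberField M] {d Δ : ℤ} {c s : M}
variable {M' : Type*} [Field M'] [NumberField M'] {Δ' : ℤ} {c' s' : M'}

lemma Biq.map_int (h : Biq d Δ M c s) (h' : Biq d Δ' M' c' s') (k : ℤ) (hk : Δ' = Δ + (8 * d) ^ 5 * k)
    (x : M) (hx : IsIntegral ℤ x) : IsIntegral ℤ (h.map c' s' x) := by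
  obtain ⟨a, b, e, f, rfl⟩ := h.el_surj x
  rw [h.map_el]
  exact h.transfer h' k hk a b e f hx

lemma Biq.map_map (h : Biq d Δ M c s) (h' : Biq d Δ' M' c' s') (x : M) : h'.map c s (h.map c' s' x) = x := by
  obtain ⟨a, b, e, f, rfl⟩ := h.el_surj x
  rw [h.map_el, h'.map_el]

/-- The additive map between rings of integers. -/
noncomputable def Biq.psi (h : Biq d Δ M c s) (h' : Biq d Δ' M' c' s') (k : ℤ)
    (hk : Δ' = Δ + (8 * d) ^ 5 * k) : 𝓞 M →+ 𝓞 M' where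
  toFun x := ⟨h.map c' s' x, h.map_int h' k hk x x.2⟩
  map_zero' := by
    apply RingOfIntegers.coe_injective
    exact map_zero (h.map c' s')
  map_add' x y := by
    apply RingOfIntegers.coe_injective
    exact map_add (h.map c' s') (x : M) (y : M)

lemma Biq.psi_coe (h : Biq d Δ M c s) (h' : Biq d Δ' M' c' s') (k : ℤ)
    (hk : Δ' = Δ + (8 * d) ^ 5 * k) (x : 𝓞 M) : ((h.psi h' k hk x : 𝓞 M') : M') = h.map c' s' (x : M) := rfl

lemma Biq.psi_psi (h : Biq d Δ M c s) (h' : Biq d Δ' M' c' s') (k : ℤ)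
    (hk : Δ' = Δ + (8 * d) ^ 5 * k) (hk' : Δ = Δ' + (8 * d) ^ 5 * (-k)) (x : 𝓞 M) :
    h'.psi h (-k) hk' (h.psi h' k hk x) = x := by
  ext
  rw [Biq.psi_coe, Biq.psi_coe, h.map_map h']

lemma Biq.isInt_c' (h : Biq d Δ M c s) : IsIntegral ℤ c := by
  apply IsIntegral.of_pow two_pos
  rw [h.hc]
  exact_mod_cast isIntegral_algebraMap (R := ℤ) (A := M) (x := d)

lemma Biq.isInt_s' (h : Biq d Δ M c s) : IsIntegral ℤ s := by
  apply IsIntegral.of_pow two_pos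
  rw [h.hs]
  exact_mod_cast isIntegral_algebraMap (R := ℤ) (A := M) (x := Δ)

lemma Biq.psi_mul (h : Biq d Δ M c s) (h' : Biq d Δ' M' c' s') (k : ℤ)
    (hk : Δ' = Δ + (8 * d) ^ 5 * k) (x y : 𝓞 M) :
    ∃ z : 𝓞 M', h.psi h' k hk x * h.psi h' k hk y = h.psi h' k hk (x * y) + ((8 * d : ℤ) : 𝓞 M') * z := by
  obtain ⟨A, B, E, F, hx⟩ := h.coords x x.2
  obtain ⟨A', B', E', F', hy⟩ := h.coords y y.2
  have hd := h.d_ne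
  obtain ⟨C, hC⟩ : ∃ C : 𝓞 M', algebraMap (𝓞 M') M' C = c' := ⟨⟨c', h'.isInt_c'⟩, rfl⟩
  refine ⟨(((8 * d) ^ 2 * k * (E * E' + d * F * F') : ℤ) : 𝓞 M') +
    (((8 * d) ^ 2 * k * (E * F' + F * E') : ℤ) : 𝓞 M') * C, ?_⟩
  apply RingOfIntegers.coe_injective
  change algebraMap (𝓞 M') M' _ = algebraMap (𝓞 M') M' _
  have hk' : (Δ' : ℚ) = Δ + (8 * d) ^ 5 * k := by rw [hk]; push_cast; ring
  simp only [map_mul, map_add, Biq.psi_coe, map_intCast, hC]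
  have hx' : algebraMap (𝓞 M) M x = _ := hx
  have hy' : algebraMap (𝓞 M) M y = _ := hy
  rw [hx', hy', hx, hy, h.el_mul, h.map_el, h.map_el, h.map_el, h'.el_mul]
  rw [hk']
  have e2 : ((8 * d : ℤ) : M') * ((((8 * d) ^ 2 * k * (E * E' + d * F * F') : ℤ) : M') +
      (((8 * d) ^ 2 * k * (E * F' + F * E') : ℤ) : M') * c') =
      el c' s' (((8 * d) ^ 3 * k * (E * E' + d * F * F') : ℤ) : ℚ) (((8 * d) ^ 3 * k * (E * F' + F * E') : ℤ) : ℚ) 0 0 := by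
    simp only [el]; push_cast; ring
  rw [e2, el_add]
  congr 1
  · push_cast; field_simp; ring
  · push_cast; field_simp; ring
  · ring
  · ring

lemma Biq.locf_transfer (h : Biq d Δ M c s) (h' : Biq d Δ' M' c' s') (k : ℤ)
    (hk : Δ' = Δ + (8 * d) ^ 5 * k) (p : ℕ) (hp : p.Prime) (hpd : (p : ℤ) ∣ 8 * d) (σ : ℝ) :
    locf M σ p = locf M' σ p := by
  have hk' : Δ = Δ' + (8 * d) ^ 5 * (-k) := by rw [hk]; ring
  have hp0 : (p : 𝓞 M') ≠ 0 := by exact_mod_cast hp.ne_zero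
  have hI : Ideal.span {(p : 𝓞 M')} ≠ ⊥ := by
    rw [Ne, Ideal.span_singleton_eq_bot]; exact hp0
  haveI : Finite (𝓞 M' ⧸ Ideal.span {(p : 𝓞 M')}) := Ideal.finiteQuotientOfFreeOfNeBot _ hI
  haveI : Finite (PrimeSpectrum (𝓞 M' ⧸ Ideal.span {(p : 𝓞 M')})) := by
    apply Finite.of_injective (fun q => (q.asIdeal : Set (𝓞 M' ⧸ Ideal.span {(p : 𝓞 M')})))
    intro q q' hq
    exact PrimeSpectrum.ext (SetLike.coe_injective hq)
  letI : Fintype (PrimeSpectrum (𝓞 M' ⧸ Ideal.span {(p : 𝓞 M')})) := Fintype.ofFinite _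
  rw [locf_eq_of_surj σ p hp.ne_zero (Ideal.Quotient.mk (Ideal.span {(p : 𝓞 M')}))
    Ideal.Quotient.mk_surjective Ideal.mk_ker]
  have one : h.psi h' k hk 1 = 1 := by
    ext
    rw [Biq.psi_coe]
    have : ((1 : 𝓞 M) : M) = el c s 1 0 0 0 := by simp [el]
    rw [this, h.map_el]
    simp [el]
  let f : 𝓞 M →+* (𝓞 M' ⧸ Ideal.span {(p : 𝓞 M')}) :=
    { toFun := fun x => Ideal.Quotient.mk _ (h.psi h' k hk x)
      map_one' := by rw [one, map_one]
      map_zero' := by simp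
      map_add' := by intro x y; simp
      map_mul' := by
        intro x y
        obtain ⟨z, hz⟩ := h.psi_mul h' k hk x y
        rw [← map_mul, hz, map_add, left_eq_add, Ideal.Quotient.eq_zero_iff_mem, Ideal.mem_span_singleton]
        obtain ⟨t, ht⟩ := hpd
        rw [ht]
        exact ⟨(t : 𝓞 M') * z, by push_cast; ring⟩ }
  have hfx : ∀ x, f x = Ideal.Quotient.mk _ (h.psi h' k hk x) := fun x => rfl
  refine locf_eq_of_surj σ p hp.ne_zero f ?_ ?_
  · intro y
    obtain ⟨y, rfl⟩ := Ideal.Quotient.mk_surjective y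
    refine ⟨h'.psi h (-k) hk' y, ?_⟩
    rw [hfx]
    congr 1
    ext
    rw [Biq.psi_coe, Biq.psi_coe, h'.map_map h]
  · ext x
    rw [RingHom.mem_ker, hfx, Ideal.Quotient.eq_zero_iff_mem, Ideal.mem_span_singleton, Ideal.mem_span_singleton]
    constructor
    · rintro ⟨y, hy⟩
      refine ⟨h'.psi h (-k) hk' y, ?_⟩
      rw [← h.psi_psi h' k hk hk' x, hy, ← nsmul_eq_mul, map_nsmul, nsmul_eq_mul]
    · rintro ⟨y, rfl⟩
      exact ⟨h.psi h' k hk y, by rw [← nsmul_eq_mul, map_nsmul, nsmul_eq_mul]⟩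

end BadPrimes

section GoodPrimes

set_option linter.style.haveILetI false

open NumberField IsDedekindDomain

variable {M : Type*} [Field M] [NumberField M] {d Δ : ℤ} {c s : M}

lemma Biq.coordsO (h : Biq d Δ M c s) (x : 𝓞 M) :
    ∃ v : ℤ × ℤ × ℤ × ℤ, (8 * d : M) * algebraMap (𝓞 M) M x = el c s v.1 v.2.1 v.2.2.1 v.2.2.2 := by
  obtain ⟨A, B, E, F, hx⟩ := h.coords (algebraMap (𝓞 M) M x) x.2
  refine ⟨(A, B, E, F), ?_⟩
  have hd := h.d_ne
  rw [hx, show (8 * d : M) = ((8 * d : ℚ) : M) by push_cast; rfl, el_smul]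
  congr 1 <;> field_simp

/-- integral coordinates -/
noncomputable def Biq.co (h : Biq d Δ M c s) (x : 𝓞 M) : ℤ × ℤ × ℤ × ℤ := (h.coordsO x).choose

lemma Biq.co_spec (h : Biq d Δ M c s) (x : 𝓞 M) :
    (8 * d : M) * algebraMap (𝓞 M) M x = el c s (h.co x).1 (h.co x).2.1 (h.co x).2.2.1 (h.co x).2.2.2 :=
  (h.coordsO x).choose_spec

lemma Biq.co_unique (h : Biq d Δ M c s) (x : 𝓞 M) (A B E F : ℤ)
    (hx : (8 * d : M) * algebraMap (𝓞 M) M x = el c s A B E F) : h.co x = (A, B, E, F) := by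
  rw [h.co_spec x] at hx
  obtain ⟨h1, h2, h3, h4⟩ := h.el_inj hx
  ext <;> simp only <;> assumption_mod_cast

lemma Biq.co_mul (h : Biq d Δ M c s) (x y : 𝓞 M) (A B E F A' B' E' F' A2 B2 E2 F2 : ℤ) (hx : h.co x = (A, B, E, F))
    (hy : h.co y = (A', B', E', F')) (hxy : h.co (x * y) = (A2, B2, E2, F2)) :
    8 * d * A2 = A * A' + d * B * B' + Δ * (E * E' + d * F * F') ∧
    8 * d * B2 = A * B' + B * A' + Δ * (E * F' + F * E') ∧
    8 * d * E2 = A * E' + E * A' + d * (B * F' + F * B') ∧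
    8 * d * F2 = A * F' + F * A' + B * E' + E * B' := by
  have h1 := h.co_spec x
  have h2 := h.co_spec y
  have h3 := h.co_spec (x * y)
  rw [hx] at h1
  rw [hy] at h2
  rw [hxy, map_mul] at h3
  simp only at h1 h2 h3
  have h4 : ((8 * d : ℚ) : M) * el c s A2 B2 E2 F2 = el c s A B E F * el c s A' B' E' F' := by
    rw [← h1, ← h2, ← h3]; push_cast; ring
  rw [el_smul, h.el_mul] at h4
  obtain ⟨h5, h6, h7, h8⟩ := h.el_inj h4
  exact ⟨by exact_mod_cast h5, by exact_mod_cast h6, by exact_mod_cast h7, by exact_mod_cast h8⟩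

/-- evaluate in a field -/
noncomputable def Biq.ev (h : Biq d Δ M c s) {k : Type*} [Field k] (r t : k) (x : 𝓞 M) : k :=
  ((h.co x).1 + (h.co x).2.1 * r + (h.co x).2.2.1 * t + (h.co x).2.2.2 * (r * t)) / (8 * d : ℤ)

lemma Biq.ev_mul (h : Biq d Δ M c s) {k : Type*} [Field k] (hn : ((8 * d : ℤ) : k) ≠ 0) (r t : k)
    (hr : r ^ 2 = (d : k)) (ht : t ^ 2 = (Δ : k)) (x y : 𝓞 M) :
    h.ev r t (x * y) = h.ev r t x * h.ev r t y := by
  obtain ⟨⟨A, B, E, F⟩, hx⟩ : ∃ v, h.co x = v := ⟨_, rfl⟩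
  obtain ⟨⟨A', B', E', F'⟩, hy⟩ : ∃ v, h.co y = v := ⟨_, rfl⟩
  obtain ⟨⟨A2, B2, E2, F2⟩, hxy⟩ : ∃ v, h.co (x * y) = v := ⟨_, rfl⟩
  obtain ⟨h1, h2, h3, h4⟩ := h.co_mul x y _ _ _ _ _ _ _ _ _ _ _ _ hx hy hxy
  have h1' := congrArg (Int.cast : ℤ → k) h1
  have h2' := congrArg (Int.cast : ℤ → k) h2
  have h3' := congrArg (Int.cast : ℤ → k) h3
  have h4' := congrArg (Int.cast : ℤ → k) h4
  push_cast at h1' h2' h3' h4'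
  simp only [Biq.ev, hx, hy, hxy]
  push_cast at hn ⊢
  rw [div_mul_div_comm, div_eq_div_iff hn (mul_ne_zero hn hn)]
  linear_combination (8 * d : k) * (h1' + r * h2' + t * h3' + r * t * h4') -
    (8 * d : k) * ((B * B' + F * F' * t ^ 2 + (B * F' + F * B') * t : k) * hr +
    (E * E' + (E * F' + F * E') * r + F * F' * d : k) * ht)

/-- hom to a field -/
noncomputable def Biq.hom (h : Biq d Δ M c s) {k : Type*} [Field k] (hn : ((8 * d : ℤ) : k) ≠ 0) (r t : k)
    (hr : r ^ 2 = (d : k)) (ht : t ^ 2 = (Δ : k)) : 𝓞 M →+* k where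
  toFun := h.ev r t
  map_one' := by
    have : h.co 1 = (8 * d, 0, 0, 0) := by
      apply h.co_unique; simp [el]
    simp only [Biq.ev, this]
    push_cast at hn ⊢
    rw [div_eq_iff hn]
    ring
  map_zero' := by
    have : h.co 0 = (0, 0, 0, 0) := by
      apply h.co_unique; simp [el]
    simp [Biq.ev, this]
  map_mul' := h.ev_mul hn r t hr ht
  map_add' x y := by
    have : h.co (x + y) = ((h.co x).1 + (h.co y).1, (h.co x).2.1 + (h.co y).2.1,
        (h.co x).2.2.1 + (h.co y).2.2.1, (h.co x).2.2.2 + (h.co y).2.2.2) := by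
      apply h.co_unique
      rw [map_add, mul_add, h.co_spec x, h.co_spec y, el_add]
      push_cast
      rfl
    simp only [Biq.ev, this]
    push_cast
    ring

lemma Biq.hom_apply (h : Biq d Δ M c s) {k : Type*} [Field k] (hn : ((8 * d : ℤ) : k) ≠ 0) (r t : k)
    (hr : r ^ 2 = (d : k)) (ht : t ^ 2 = (Δ : k)) (x : 𝓞 M) : h.hom hn r t hr ht x = h.ev r t x := rfl

/-- c in the ring of integers -/
noncomputable def Biq.cO (h : Biq d Δ M c s) : 𝓞 M := ⟨c, h.isInt_c'⟩
/-- s in the ring of integers -/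
noncomputable def Biq.sO (h : Biq d Δ M c s) : 𝓞 M := ⟨s, h.isInt_s'⟩

lemma Biq.cO_coe (h : Biq d Δ M c s) : algebraMap (𝓞 M) M h.cO = c := rfl
lemma Biq.sO_coe (h : Biq d Δ M c s) : algebraMap (𝓞 M) M h.sO = s := rfl

lemma Biq.cO_sq (h : Biq d Δ M c s) : h.cO ^ 2 = (d : 𝓞 M) := by
  apply RingOfIntegers.coe_injective
  change algebraMap (𝓞 M) M _ = algebraMap (𝓞 M) M _
  rw [map_pow, h.cO_coe, h.hc, map_intCast]

lemma Biq.sO_sq (h : Biq d Δ M c s) : h.sO ^ 2 = (Δ : 𝓞 M) := by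
  apply RingOfIntegers.coe_injective
  change algebraMap (𝓞 M) M _ = algebraMap (𝓞 M) M _
  rw [map_pow, h.sO_coe, h.hs, map_intCast]

lemma Biq.rel (h : Biq d Δ M c s) (x : 𝓞 M) : ((8 * d : ℤ) : 𝓞 M) * x =
    (h.co x).1 + (h.co x).2.1 * h.cO + (h.co x).2.2.1 * h.sO + (h.co x).2.2.2 * (h.cO * h.sO) := by
  apply RingOfIntegers.coe_injective
  change algebraMap (𝓞 M) M _ = algebraMap (𝓞 M) M _
  have := h.co_spec x
  simp only [map_add, map_mul, map_intCast, h.cO_coe, h.sO_coe]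
  push_cast
  rw [this, el]
  push_cast
  rfl

/-- any hom is determined by images of c and s -/
lemma Biq.hom_unique (h : Biq d Δ M c s) {k : Type*} [Field k] (hn : ((8 * d : ℤ) : k) ≠ 0) (φ : 𝓞 M →+* k)
    (x : 𝓞 M) : φ x = h.ev (φ h.cO) (φ h.sO) x := by
  have := congrArg φ (h.rel x)
  simp only [map_add, map_mul, map_intCast] at this
  rw [Biq.ev, eq_div_iff hn, ← this]
  ring

lemma Biq.hom_cO (h : Biq d Δ M c s) {k : Type*} [Field k] (hn : ((8 * d : ℤ) : k) ≠ 0) (r t : k)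
    (hr : r ^ 2 = (d : k)) (ht : t ^ 2 = (Δ : k)) : h.hom hn r t hr ht h.cO = r := by
  have : h.co h.cO = (0, 8 * d, 0, 0) := by
    apply h.co_unique; rw [h.cO_coe]; simp [el]
  rw [h.hom_apply]
  simp only [Biq.ev, this]
  push_cast at hn ⊢
  rw [div_eq_iff hn]
  ring

lemma Biq.hom_sO (h : Biq d Δ M c s) {k : Type*} [Field k] (hn : ((8 * d : ℤ) : k) ≠ 0) (r t : k)
    (hr : r ^ 2 = (d : k)) (ht : t ^ 2 = (Δ : k)) : h.hom hn r t hr ht h.sO = t := by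
  have : h.co h.sO = (0, 0, 8 * d, 0) := by
    apply h.co_unique; rw [h.sO_coe]; simp [el]
  rw [h.hom_apply]
  simp only [Biq.ev, this]
  push_cast at hn ⊢
  rw [div_eq_iff hn]
  ring

/-- an element which is a square root of an integer which is a square mod p is determined by kernel -/
lemma ker_det {O k : Type*} [CommRing O] [Field k] {p : ℕ} [Fact p.Prime] [CharP k p] (φ φ' : O →+* k)
    (hker : RingHom.ker φ = RingHom.ker φ') (w : O) (D : ℤ) (hw : w ^ 2 = (D : O))
    (hD : legendreSym p D ≠ -1) : φ w = φ' w := by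
  have hsq : IsSquare (D : ZMod p) := by
    by_contra hns
    exact hD ((legendreSym.eq_neg_one_iff p).mpr hns)
  obtain ⟨z, hz⟩ := hsq
  obtain ⟨z, rfl⟩ := ZMod.intCast_surjective z
  have hz' : (D : k) = (z : k) * z := by
    have h1 : ((D - z * z : ℤ) : ZMod p) = 0 := by push_cast; rw [hz, sub_self]
    rw [ZMod.intCast_zmod_eq_zero_iff_dvd] at h1
    have h2 : ((D - z * z : ℤ) : k) = 0 := (CharP.intCast_eq_zero_iff k p _).mpr h1
    push_cast at h2
    linear_combination h2
  have h1 : (φ w - z) * (φ w + z) = 0 := by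
    have := congrArg φ hw
    rw [map_pow, map_intCast, hz'] at this
    linear_combination this
  rcases mul_eq_zero.mp h1 with h2 | h2
  · have : (w - (z : O)) ∈ RingHom.ker φ := by rw [RingHom.mem_ker, map_sub, map_intCast, h2]
    rw [hker, RingHom.mem_ker, map_sub, map_intCast] at this
    linear_combination h2 - this
  · have : (w + (z : O)) ∈ RingHom.ker φ := by rw [RingHom.mem_ker, map_add, map_intCast, h2]
    rw [hker, RingHom.mem_ker, map_add, map_intCast] at this
    linear_combination h2 - this

lemma frob_root {k : Type*} [Field k] (p : ℕ) [Fact p.Prime] [CharP k p] (hp2 : p ≠ 2) (r : k) (D : ℤ) (hr : r ^ 2 = (D : k)) :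
    r ^ p = (legendreSym p D : k) * r := by
  have hodd := (Fact.out : p.Prime).eq_two_or_odd.resolve_left hp2
  have h1 : p = 2 * (p / 2) + 1 := by omega
  have h2 := legendreSym.eq_pow p D
  have h3 : ((legendreSym p D : ℤ) : k) = (D : k) ^ (p / 2) := by
    have h1 : ((legendreSym p D - D ^ (p / 2) : ℤ) : ZMod p) = 0 := by push_cast; rw [h2, sub_self]
    rw [ZMod.intCast_zmod_eq_zero_iff_dvd] at h1
    have h2 : ((legendreSym p D - D ^ (p / 2) : ℤ) : k) = 0 := (CharP.intCast_eq_zero_iff k p _).mpr h1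
    push_cast at h2
    linear_combination h2
  rw [h3]
  conv_lhs => rw [h1, pow_succ, pow_mul, hr]

lemma Biq.ev_frob (h : Biq d Δ M c s) {k : Type*} [Field k] (p : ℕ) [Fact p.Prime] [CharP k p] (r t : k) (x : 𝓞 M) :
    (h.ev r t x) ^ p = h.ev (r ^ p) (t ^ p) x := by
  change frobenius k p _ = _
  simp only [Biq.ev, map_div₀, map_add, map_mul, map_intCast]
  rfl

lemma card_field_of_pow {k : Type*} [Field k] [Finite k] (p : ℕ) [Fact p.Prime] [CharP k p] (j : ℕ) (hj : 1 ≤ j)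
    (h : ∀ x : k, x ^ p ^ j = x) : Nat.card k ≤ p ^ j := by
  have hp : p.Prime := Fact.out
  haveI := Fintype.ofFinite k
  have h1 : ∀ x : kˣ, x ^ (p ^ j - 1) = 1 := by
    intro x
    ext
    push_cast
    have := h (x : k)
    have h2 : p ^ j = (p ^ j - 1) + 1 := by have := pow_pos hp.pos j; omega
    rw [h2, pow_succ] at this
    exact mul_right_cancel₀ x.ne_zero (by rw [this, one_mul])
  rw [FiniteField.forall_pow_eq_one_iff] at h1
  have h2 := Nat.le_of_dvd (by have := Nat.one_lt_pow (by omega : j ≠ 0) hp.one_lt; omega) h1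
  rw [Nat.card_eq_fintype_card]
  have h3 := pow_pos hp.pos j
  have h4 : 0 < Fintype.card k := Fintype.card_pos
  generalize p ^ j = q at *
  omega

end GoodPrimes

section GoodPrimes2

set_option linter.style.haveILetI false

open NumberField IsDedekindDomain

variable {M : Type*} [Field M] [NumberField M] {d Δ : ℤ} {c s : M}

/-- the size of the residue field. -/
lemma residue_card {O k : Type*} [CommRing O] [Field k] {p : ℕ} [Fact p.Prime] [CharP k p] (φ : O →+* k) (P : Ideal O)
    [hP : P.IsMaximal] [Finite (O ⧸ P)] (hφ : RingHom.ker φ = P)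
    (h2 : ∀ x, (φ x ^ p) ^ p = φ x) :
    (Nat.card (O ⧸ P) = p ∧ ∀ x, φ x ^ p = φ x) ∨ (Nat.card (O ⧸ P) = p ^ 2 ∧ ¬ ∀ x, φ x ^ p = φ x) := by
  have hp : p.Prime := Fact.out
  letI := Ideal.Quotient.field P
  have hmem : ∀ x, φ x = 0 ↔ Ideal.Quotient.mk P x = 0 := by
    intro x
    rw [Ideal.Quotient.eq_zero_iff_mem, ← hφ, RingHom.mem_ker]
  have hchar : CharP (O ⧸ P) p := by
    constructor
    intro n
    have := hmem (n : O)
    rw [map_natCast, map_natCast] at this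
    rw [← this, CharP.cast_eq_zero_iff k p]
  have hpow : ∀ j, (∀ x, φ x ^ p ^ j = φ x) ↔ ∀ y : O ⧸ P, y ^ p ^ j = y := by
    intro j
    constructor
    · intro h y
      obtain ⟨x, rfl⟩ := Ideal.Quotient.mk_surjective y
      have := (hmem (x ^ p ^ j - x)).mp (by rw [map_sub, map_pow, h, sub_self])
      rw [map_sub, map_pow] at this
      exact sub_eq_zero.mp this
    · intro h x
      have := (hmem (x ^ p ^ j - x)).mpr (by rw [map_sub, map_pow, h, sub_self])
      rw [map_sub, map_pow] at this
      exact sub_eq_zero.mp this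
  letI : Fintype (O ⧸ P) := Fintype.ofFinite _
  obtain ⟨n, -, hn⟩ := FiniteField.card (O ⧸ P) p
  have hc : Nat.card (O ⧸ P) = p ^ (n : ℕ) := by rw [Nat.card_eq_fintype_card, hn]
  have hle2 : Nat.card (O ⧸ P) ≤ p ^ 2 := by
    apply card_field_of_pow p 2 (by norm_num)
    rw [← hpow]
    intro x
    rw [sq, pow_mul, h2]
  have hn2 : (n : ℕ) ≤ 2 := by
    rw [hc] at hle2
    exact (Nat.pow_le_pow_iff_right hp.one_lt).mp hle2
  have hn1 : 1 ≤ (n : ℕ) := n.2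
  by_cases hfix : ∀ x, φ x ^ p = φ x
  · left
    refine ⟨?_, hfix⟩
    have hle1 : Nat.card (O ⧸ P) ≤ p ^ 1 := by
      apply card_field_of_pow p 1 le_rfl
      rw [← hpow]
      simpa using hfix
    rw [hc] at hle1 ⊢
    have := (Nat.pow_le_pow_iff_right hp.one_lt).mp hle1
    rw [show (n : ℕ) = 1 by omega, pow_one]
  · right
    refine ⟨?_, hfix⟩
    rw [hc]
    congr 1
    by_contra hne
    have hn' : (n : ℕ) = 1 := by omega
    apply hfix
    have := (hpow 1).mpr (by
      intro y
      have := FiniteField.pow_card y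
      rw [hn, hn'] at this
      exact this)
    simpa using this

lemma Biq.fiber (h : Biq d Δ M c s) {k : Type*} [Field k] (p : ℕ) [Fact p.Prime] [CharP k p]
    (hp2 : p ≠ 2) (hn : ((8 * d : ℤ) : k) ≠ 0) (r t r' t' : k)
    (hr : r ^ 2 = (d : k)) (ht : t ^ 2 = (Δ : k)) (hr' : r' ^ 2 = (d : k)) (ht' : t' ^ 2 = (Δ : k)) :
    RingHom.ker (h.hom hn r' t' hr' ht') = RingHom.ker (h.hom hn r t hr ht) ↔
      (r' = r ∧ t' = t) ∨ (r' = r ^ p ∧ t' = t ^ p) := by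
  have hp : p.Prime := Fact.out
  constructor
  · intro hker
    have hdk : (d : k) ≠ 0 := by
      intro h0; apply hn; push_cast; rw [h0, mul_zero]
    have hr0 : r ≠ 0 := by rintro rfl; apply hdk; rw [← hr]; ring
    have hε : legendreSym p d = 1 ∨ legendreSym p d = -1 := by
      apply legendreSym.eq_one_or_neg_one
      intro h0
      rw [ZMod.intCast_zmod_eq_zero_iff_dvd] at h0
      exact hdk ((CharP.intCast_eq_zero_iff k p _).mpr h0)
    have h1 : legendreSym p d ≠ -1 → r' = r := by
      intro h1
      have := ker_det _ _ hker h.cO d h.cO_sq h1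
      rwa [h.hom_cO, h.hom_cO] at this
    have h2 : legendreSym p Δ ≠ -1 → t' = t := by
      intro h1
      have := ker_det _ _ hker h.sO Δ h.sO_sq h1
      rwa [h.hom_sO, h.hom_sO] at this
    have h3 : legendreSym p d * legendreSym p Δ ≠ -1 → r' * t' = r * t := by
      intro h1
      have := ker_det _ _ hker (h.cO * h.sO) (d * Δ) (by rw [mul_pow, h.cO_sq, h.sO_sq]; push_cast; rfl)
        (by rwa [legendreSym.mul])
      rwa [map_mul, map_mul, h.hom_sO, h.hom_sO, h.hom_cO, h.hom_cO] at this
    have hrr : r' = r ∨ r' = -r := sq_eq_sq_iff_eq_or_eq_neg.mp (by rw [hr, hr'])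
    have htt : t' = t ∨ t' = -t := sq_eq_sq_iff_eq_or_eq_neg.mp (by rw [ht, ht'])
    rw [frob_root p hp2 r d hr, frob_root p hp2 t Δ ht]
    have hχ : legendreSym p Δ = 0 ∨ legendreSym p Δ = 1 ∨ legendreSym p Δ = -1 := by
      by_cases h0 : (Δ : ZMod p) = 0
      · left; exact (legendreSym.eq_zero_iff p Δ).mpr h0
      · right; exact legendreSym.eq_one_or_neg_one p h0
    have ht0 : legendreSym p Δ = 0 → t = 0 := by
      intro h0
      rw [legendreSym.eq_zero_iff, ZMod.intCast_zmod_eq_zero_iff_dvd] at h0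
      rw [(CharP.intCast_eq_zero_iff k p _).mpr h0] at ht
      exact pow_eq_zero_iff (two_ne_zero) |>.mp ht
    rcases hε with hε | hε <;> rcases hχ with hχ | hχ | hχ <;> rw [hε] at h1 h3 ⊢ <;>
      rw [hχ] at h2 h3 ht0 ⊢ <;> norm_num at h1 h2 h3 ⊢
    · exact Or.inl ⟨h1, h2⟩
    · exact ⟨h1, h2⟩
    · rcases htt with rfl | rfl
      · exact Or.inl ⟨h1, rfl⟩
      · exact Or.inr ⟨h1, rfl⟩
    · rw [ht0 rfl] at h2 ⊢
      rcases hrr with h | h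
      · exact Or.inl ⟨h, h2⟩
      · exact Or.inr ⟨h, h2⟩
    · rcases hrr with h | h
      · exact Or.inl ⟨h, h2⟩
      · exact Or.inr ⟨h, h2⟩
    · rcases hrr with rfl | rfl
      · left
        exact ⟨rfl, mul_left_cancel₀ hr0 h3⟩
      · right
        refine ⟨rfl, mul_left_cancel₀ hr0 (by linear_combination -h3)⟩
  · rintro (⟨rfl, rfl⟩ | ⟨rfl, rfl⟩)
    · rfl
    · ext x
      rw [RingHom.mem_ker, RingHom.mem_ker, h.hom_apply, h.hom_apply, ← h.ev_frob p, pow_eq_zero_iff hp.ne_zero]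

lemma Biq.locf_good (h : Biq d Δ M c s) (p : ℕ) [Fact p.Prime] (hpd : ¬ (p : ℤ) ∣ 8 * d) (σ : ℝ) (hσ : 0 < σ) :
    locf M σ p = (1 - (p : ℝ) ^ (-σ)) * (1 - (legendreSym p d : ℝ) * (p : ℝ) ^ (-σ)) *
      (1 - (legendreSym p Δ : ℝ) * (p : ℝ) ^ (-σ)) *
      (1 - (legendreSym p d : ℝ) * (legendreSym p Δ : ℝ) * (p : ℝ) ^ (-σ)) := by
  classical
  have hp : p.Prime := Fact.out
  have hp2 : p ≠ 2 := by
    rintro rfl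
    exact hpd ⟨4 * d, by push_cast; ring⟩
  let Ω := AlgebraicClosure (ZMod p)
  haveI : CharP Ω p := inferInstanceAs (CharP (AlgebraicClosure (ZMod p)) p)
  have hn : ((8 * d : ℤ) : Ω) ≠ 0 := fun h0 => hpd ((CharP.intCast_eq_zero_iff Ω p _).mp h0)
  have h2Ω : (2 : Ω) ≠ 0 := by
    intro h0
    have := (CharP.cast_eq_zero_iff Ω p 2).mp (by exact_mod_cast h0)
    exact hp2 ((Nat.prime_dvd_prime_iff_eq hp Nat.prime_two).mp this)
  have hdk : (d : Ω) ≠ 0 := by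
    intro h0; apply hn; push_cast; rw [h0, mul_zero]
  obtain ⟨r0, hr0⟩ := IsAlgClosed.exists_pow_nat_eq (d : Ω) two_pos
  obtain ⟨t0, ht0⟩ := IsAlgClosed.exists_pow_nat_eq (Δ : Ω) two_pos
  have hr00 : r0 ≠ 0 := by rintro rfl; apply hdk; rw [← hr0]; ring
  have hε : legendreSym p d = 1 ∨ legendreSym p d = -1 := by
    apply legendreSym.eq_one_or_neg_one
    intro h0
    rw [ZMod.intCast_zmod_eq_zero_iff_dvd] at h0
    exact hdk ((CharP.intCast_eq_zero_iff Ω p _).mpr h0)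
  have hχ : legendreSym p Δ = 0 ∨ legendreSym p Δ = 1 ∨ legendreSym p Δ = -1 := by
    by_cases h0 : (Δ : ZMod p) = 0
    · left; exact (legendreSym.eq_zero_iff p Δ).mpr h0
    · right; exact legendreSym.eq_one_or_neg_one p h0
  have hχt : legendreSym p Δ = 0 ↔ t0 = 0 := by
    rw [legendreSym.eq_zero_iff, ZMod.intCast_zmod_eq_zero_iff_dvd, ← CharP.intCast_eq_zero_iff Ω p, ← ht0]
    exact pow_eq_zero_iff two_ne_zero
  set T : Finset (Ω × Ω) := {r0, -r0} ×ˢ {t0, -t0} with hT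
  have memT : ∀ x : Ω × Ω, x ∈ T ↔ x.1 ^ 2 = (d : Ω) ∧ x.2 ^ 2 = (Δ : Ω) := by
    intro x
    rw [hT, Finset.mem_product, ← hr0, ← ht0, sq_eq_sq_iff_eq_or_eq_neg, sq_eq_sq_iff_eq_or_eq_neg]
    simp
  have cardT : T.card = if legendreSym p Δ = 0 then 2 else 4 := by
    have neg_ne : ∀ x : Ω, x ≠ 0 → x ≠ -x := by
      intro x hx hxx
      have : 2 * x = 0 := by linear_combination hxx
      rcases mul_eq_zero.mp this with h | h
      · exact h2Ω h
      · exact hx h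
    rw [hT, Finset.card_product, Finset.card_pair (neg_ne r0 hr00)]
    split_ifs with h0
    · rw [hχt] at h0
      simp [h0]
    · rw [hχt] at h0
      rw [Finset.card_pair (neg_ne t0 h0)]
  -- the kernel map
  let g : Ω × Ω → Ideal (𝓞 M) := fun x => if hx : x.1 ^ 2 = (d : Ω) ∧ x.2 ^ 2 = (Δ : Ω) then
    RingHom.ker (h.hom hn x.1 x.2 hx.1 hx.2) else ⊥
  have hg : ∀ (x : Ω × Ω) (hx : x.1 ^ 2 = (d : Ω) ∧ x.2 ^ 2 = (Δ : Ω)),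
      g x = RingHom.ker (h.hom hn x.1 x.2 hx.1 hx.2) := fun x hx => dif_pos hx
  have hpK : (p : 𝓞 M) ≠ 0 := by exact_mod_cast hp.ne_zero
  have hgP : ∀ x ∈ T, g x ∈ (primesAbove M p).image HeightOneSpectrum.asIdeal := by
    intro x hx
    have hx' := (memT x).mp hx
    rw [hg x hx', Finset.mem_image]
    have hpm : (p : 𝓞 M) ∈ RingHom.ker (h.hom hn x.1 x.2 hx'.1 hx'.2) := by
      rw [RingHom.mem_ker, map_natCast]
      exact CharP.cast_eq_zero Ω p
    refine ⟨⟨RingHom.ker (h.hom hn x.1 x.2 hx'.1 hx'.2), RingHom.ker_isPrime _, ?_⟩, ?_, rfl⟩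
    · intro h0
      rw [h0] at hpm
      exact hpK hpm
    · rw [mem_primesAbove hp.ne_zero]
      exact hpm
  have hexP : ∀ P ∈ primesAbove M p, ∃ x ∈ T, g x = P.asIdeal := by
    intro P hP
    rw [mem_primesAbove hp.ne_zero] at hP
    haveI := P.isMaximal
    letI := Ideal.Quotient.field P.asIdeal
    haveI : Finite (𝓞 M ⧸ P.asIdeal) := Ideal.finiteQuotientOfFreeOfNeBot _ P.ne_bot
    haveI : CharP (𝓞 M ⧸ P.asIdeal) p := by
      have h0 : ((p : ℕ) : 𝓞 M ⧸ P.asIdeal) = 0 := by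
        rw [← map_natCast (Ideal.Quotient.mk P.asIdeal), Ideal.Quotient.eq_zero_iff_mem]; exact hP
      rcases CharP.exists (𝓞 M ⧸ P.asIdeal) with ⟨q, hq⟩
      have hdvd := (CharP.cast_eq_zero_iff _ q p).mp h0
      rcases (Nat.dvd_prime hp).mp hdvd with h1 | h1
      · subst h1
        exact absurd (CharP.cast_eq_zero (𝓞 M ⧸ P.asIdeal) 1) (by rw [Nat.cast_one]; exact one_ne_zero)
      · subst h1; exact hq
    letI : Algebra (ZMod p) (𝓞 M ⧸ P.asIdeal) := ZMod.algebra _ p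
    haveI : Module.Finite (ZMod p) (𝓞 M ⧸ P.asIdeal) := Module.Finite.of_finite
    let ι : (𝓞 M ⧸ P.asIdeal) →ₐ[ZMod p] Ω := IsAlgClosed.lift
    let φ : 𝓞 M →+* Ω := (ι : (𝓞 M ⧸ P.asIdeal) →+* Ω).comp (Ideal.Quotient.mk P.asIdeal)
    have hk : RingHom.ker φ = P.asIdeal := by
      ext x
      rw [RingHom.mem_ker]
      change ι (Ideal.Quotient.mk P.asIdeal x) = 0 ↔ _
      rw [map_eq_zero_iff ι (RingHom.injective (ι : (𝓞 M ⧸ P.asIdeal) →+* Ω)), Ideal.Quotient.eq_zero_iff_mem]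
    have h1 : (φ h.cO) ^ 2 = (d : Ω) := by rw [← map_pow, h.cO_sq, map_intCast]
    have h2 : (φ h.sO) ^ 2 = (Δ : Ω) := by rw [← map_pow, h.sO_sq, map_intCast]
    refine ⟨(φ h.cO, φ h.sO), (memT _).mpr ⟨h1, h2⟩, ?_⟩
    rw [hg _ ⟨h1, h2⟩, ← hk]
    congr 1
    ext x
    rw [h.hom_apply, ← h.hom_unique hn φ]
  -- fixed or not
  have hfr : ∀ x ∈ T, x.1 ^ p = (legendreSym p d : Ω) * x.1 ∧ x.2 ^ p = (legendreSym p Δ : Ω) * x.2 := by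
    intro x hx
    have hx' := (memT x).mp hx
    exact ⟨frob_root p hp2 _ _ hx'.1, frob_root p hp2 _ _ hx'.2⟩
  set fix : Prop := legendreSym p d = 1 ∧ legendreSym p Δ ≠ -1 with hfixdef
  have hne1 : ∀ x : Ω, x ≠ 0 → (-1 : Ω) * x ≠ x := by
    intro x hx hxx
    have : 2 * x = 0 := by linear_combination -hxx
    rcases mul_eq_zero.mp this with h | h
    · exact h2Ω h
    · exact hx h
  have hfix : ∀ x ∈ T, (x.1 ^ p = x.1 ∧ x.2 ^ p = x.2) ↔ fix := by
    intro x hx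
    have hx' := (memT x).mp hx
    obtain ⟨h1, h2⟩ := hfr x hx
    have hx1 : x.1 ≠ 0 := by intro h0; apply hdk; rw [← hx'.1, h0]; ring
    have hx2 : legendreSym p Δ = 0 ↔ x.2 = 0 := by
      rw [legendreSym.eq_zero_iff, ZMod.intCast_zmod_eq_zero_iff_dvd, ← CharP.intCast_eq_zero_iff Ω p, ← hx'.2]
      exact pow_eq_zero_iff two_ne_zero
    rw [h1, h2, hfixdef]
    have n1 := hne1 x.1 hx1
    rcases hε with hε | hε <;> rcases hχ with hχ | hχ | hχ <;> rw [hε] <;> rw [hχ] at hx2 ⊢ <;> push_cast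
    · have := hx2.mp rfl
      simp [this]
    · simp
    · have n2 := hne1 x.2 (fun h0 => by simp [h0] at hx2)
      simpa using n2
    · simp only [n1]; simp
    · simp only [n1]; simp
    · simp only [n1]; simp
  have hfib : ∀ P ∈ primesAbove M p, (T.filter (fun x => g x = P.asIdeal)).card = if fix then 1 else 2 := by
    intro P hP
    obtain ⟨x, hx, hxP⟩ := hexP P hP
    have hx' := (memT x).mp hx
    have hxp : (x.1 ^ p) ^ 2 = (d : Ω) ∧ (x.2 ^ p) ^ 2 = (Δ : Ω) := by
      have hd' : ((d : ℤ) : Ω) ^ p = (d : Ω) := map_intCast (frobenius Ω p) d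
      have hD' : ((Δ : ℤ) : Ω) ^ p = (Δ : Ω) := map_intCast (frobenius Ω p) Δ
      rw [← pow_mul, ← pow_mul, mul_comm, pow_mul, pow_mul, hx'.1, hx'.2]
      exact ⟨hd', hD'⟩
    have : T.filter (fun y => g y = P.asIdeal) = {x, (x.1 ^ p, x.2 ^ p)} := by
      ext y
      rw [Finset.mem_filter, Finset.mem_insert, Finset.mem_singleton, ← hxP, memT]
      constructor
      · rintro ⟨hy, hyx⟩
        rw [hg y hy, hg x hx', h.fiber p hp2 hn _ _ _ _ hx'.1 hx'.2 hy.1 hy.2] at hyx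
        rcases hyx with hh | hh
        · left; exact Prod.ext hh.1 hh.2
        · right; exact Prod.ext hh.1 hh.2
      · rintro (rfl | rfl)
        · exact ⟨hx', rfl⟩
        · refine ⟨hxp, ?_⟩
          rw [hg _ hxp, hg x hx', h.fiber p hp2 hn _ _ _ _ hx'.1 hx'.2 hxp.1 hxp.2]
          right; exact ⟨rfl, rfl⟩
    rw [this]
    split_ifs with hf
    · obtain ⟨h1, h2⟩ := (hfix x hx).mpr hf
      rw [h1, h2]; simp
    · apply Finset.card_pair
      intro heq
      apply hf
      rw [← hfix x hx]
      exact ⟨(congrArg Prod.fst heq).symm, (congrArg Prod.snd heq).symm⟩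
  have hnorm : ∀ P ∈ primesAbove M p, zfun M σ P.asIdeal = if fix then (p : ℝ) ^ (-σ) else ((p : ℝ) ^ (-σ)) ^ 2 := by
    intro P hP
    obtain ⟨x, hx, hxP⟩ := hexP P hP
    have hx' := (memT x).mp hx
    rw [hg x hx'] at hxP
    haveI := P.isMaximal
    haveI : Finite (𝓞 M ⧸ P.asIdeal) := Ideal.finiteQuotientOfFreeOfNeBot _ P.ne_bot
    obtain ⟨f1, f2⟩ := hfr x hx
    have hpp : (x.1 ^ p) ^ p = x.1 ∧ (x.2 ^ p) ^ p = x.2 := by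
      have e1 : ∀ D : ℤ, (((legendreSym p D : ℤ) : Ω)) ^ p = (legendreSym p D : Ω) :=
        fun D => map_intCast (frobenius Ω p) (legendreSym p D)
      rw [f1, f2, mul_pow, mul_pow, f1, f2, e1, e1, ← mul_assoc, ← mul_assoc]
      constructor
      · rcases hε with hε | hε <;> rw [hε] <;> push_cast <;> ring
      · rcases hχ with hχ' | hχ | hχ
        · have : x.2 = 0 := by
            rw [legendreSym.eq_zero_iff, ZMod.intCast_zmod_eq_zero_iff_dvd, ← CharP.intCast_eq_zero_iff Ω p, ← hx'.2] at hχ'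
            exact pow_eq_zero_iff two_ne_zero |>.mp hχ'
          rw [this, mul_zero]
        · rw [hχ]; push_cast; ring
        · rw [hχ]; push_cast; ring
    have key := residue_card (p := p) (h.hom hn x.1 x.2 hx'.1 hx'.2) P.asIdeal hxP (by
      intro y
      rw [h.hom_apply, h.ev_frob p, h.ev_frob p, hpp.1, hpp.2])
    have hall : (∀ y, h.hom hn x.1 x.2 hx'.1 hx'.2 y ^ p = h.hom hn x.1 x.2 hx'.1 hx'.2 y) ↔ fix := by
      rw [← hfix x hx]
      constructor
      · intro hy
        have y1 := hy h.cO
        have y2 := hy h.sO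
        rw [h.hom_cO] at y1
        rw [h.hom_sO] at y2
        exact ⟨y1, y2⟩
      · rintro ⟨y1, y2⟩ y
        rw [h.hom_apply, h.ev_frob p, y1, y2]
    rw [hall] at key
    rw [zfun, Ideal.absNorm_apply, Submodule.cardQuot_apply]
    rcases key with ⟨k1, k2⟩ | ⟨k1, k2⟩
    · rw [k1, if_pos k2]
    · rw [k1, if_neg k2]
      push_cast
      rw [← Real.rpow_natCast, ← Real.rpow_natCast, ← Real.rpow_mul (by positivity), ← Real.rpow_mul (by positivity), mul_comm]
  have hcount : T.card = (primesAbove M p).card * (if fix then 1 else 2) := by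
    rw [Finset.card_eq_sum_card_fiberwise hgP, Finset.sum_image]
    · rw [Finset.sum_congr rfl hfib, Finset.sum_const, smul_eq_mul]
    · intro P _ P' _ hPP
      exact HeightOneSpectrum.ext hPP
  have hloc : locf M σ p = (1 - (if fix then (p : ℝ) ^ (-σ) else ((p : ℝ) ^ (-σ)) ^ 2)) ^ (primesAbove M p).card := by
    unfold locf
    rw [Finset.prod_congr rfl (fun P hP => by rw [hnorm P hP]), Finset.prod_const]
  rw [hloc]
  rw [cardT] at hcount
  generalize (p : ℝ) ^ (-σ) = u at *
  generalize (primesAbove M p).card = n at *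
  by_cases hf : fix
  · rw [if_pos hf] at hcount ⊢
    obtain ⟨f1, f2⟩ := hf
    rw [f1]
    rcases hχ with hχ | hχ | hχ
    · rw [if_pos hχ] at hcount
      rw [hχ, show n = 2 by omega]
      push_cast; ring
    · rw [if_neg (by rw [hχ]; norm_num)] at hcount
      rw [hχ, show n = 4 by omega]
      push_cast; ring
    · exact absurd hχ f2
  · rw [if_neg hf] at hcount ⊢
    rcases hε with hε | hε
    · have hχ' : legendreSym p Δ = -1 := by
        by_contra h1
        exact hf ⟨hε, h1⟩
      rw [if_neg (by rw [hχ']; norm_num)] at hcount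
      rw [hε, hχ', show n = 2 by omega]
      push_cast; ring
    · rcases hχ with hχ | hχ | hχ
      · rw [if_pos hχ] at hcount
        rw [hε, hχ, show n = 1 by omega]
        push_cast; ring
      · rw [if_neg (by rw [hχ]; norm_num)] at hcount
        rw [hε, hχ, show n = 2 by omega]
        push_cast; ring
      · rw [if_neg (by rw [hχ]; norm_num)] at hcount
        rw [hε, hχ, show n = 2 by omega]
        push_cast; ring

end GoodPrimes2

section Disc

set_option linter.style.haveILetI false

open NumberField IsDedekindDomain

variable {M : Type*} [Field M] [NumberField M] {d Δ : ℤ} {c s : M}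
variable {M' : Type*} [Field M'] [NumberField M'] {Δ' : ℤ} {c' s' : M'}

lemma Biq.trace_inv (h : Biq d Δ M c s) (x : M) (φ : M →+* M) (hφ : φ x = -x) : Algebra.trace ℚ M x = 0 := by
  let ψ : M →ₐ[ℚ] M := φ.toRatAlgHom
  have hψ : Function.Bijective ψ := AlgHom.bijective ψ
  have h1 := Algebra.trace_eq_of_algEquiv (AlgEquiv.ofBijective ψ hψ) x
  have h2 : (AlgEquiv.ofBijective ψ hψ) x = -x := hφ
  rw [h2, map_neg] at h1
  linarith

lemma Biq.trace_el (h : Biq d Δ M c s) (a b e f : ℚ) : Algebra.trace ℚ M (el c s a b e f) = 4 * a := by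
  obtain ⟨φ, hφ⟩ := h.exists_hom (-c) s (by rw [neg_sq, h.hc]) h.hs
  obtain ⟨φ', hφ'⟩ := h.exists_hom c (-s) h.hc (by rw [neg_sq, h.hs])
  have e1 : Algebra.trace ℚ M (el c s 0 b 0 f) = 0 := by
    apply h.trace_inv _ φ
    rw [hφ]
    simp only [el]; push_cast; ring
  have e2 : Algebra.trace ℚ M (el c s 0 0 e 0) = 0 := by
    apply h.trace_inv _ φ'
    rw [hφ']
    simp only [el]; push_cast; ring
  have e3 : Algebra.trace ℚ M (el c s a 0 0 0) = 4 * a := by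
    have : el c s a 0 0 0 = algebraMap ℚ M a := by simp [el]
    rw [this, Algebra.trace_algebraMap, h.rank]
    simp
  have : el c s a b e f = el c s a 0 0 0 + el c s 0 b 0 f + el c s 0 0 e 0 := by
    rw [el_add, el_add]; congr 1 <;> ring
  rw [this, map_add, map_add, e1, e2, e3]
  ring

lemma Biq.discr_basis (h : Biq d Δ M c s) : Algebra.discr ℚ ![1, c, s, c * s] = 256 * d ^ 2 * Δ ^ 2 := by
  have e0 : (1 : M) = el c s 1 0 0 0 := by simp [el]
  have e1 : c = el c s 0 1 0 0 := by simp [el]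
  have e2 : s = el c s 0 0 1 0 := by simp [el]
  have e3 : c * s = el c s 0 0 0 1 := by simp [el]
  rw [Algebra.discr_def]
  have : Algebra.traceMatrix ℚ ![1, c, s, c * s] = Matrix.diagonal ![(4 : ℚ), 4 * d, 4 * Δ, 4 * d * Δ] := by
    ext i j
    rw [Algebra.traceMatrix_apply, Algebra.traceForm_apply]
    have key : ∀ a b e f a' b' e' f' : ℚ, Algebra.trace ℚ M (el c s a b e f * el c s a' b' e' f') =
        4 * (a * a' + d * b * b' + Δ * (e * e' + d * f * f')) := by
      intro a b e f a' b' e' f'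
      rw [h.el_mul, h.trace_el]
    have hv : ![1, c, s, c * s] = ![el c s 1 0 0 0, el c s 0 1 0 0, el c s 0 0 1 0, el c s 0 0 0 1] := by
      rw [← e0, ← e1, ← e2, ← e3]
    rw [hv]
    fin_cases i <;> fin_cases j <;> simp [key] <;> ring
  rw [this, Matrix.det_diagonal, Fin.prod_univ_four]
  simp only [Matrix.cons_val]
  ring

lemma Biq.discr_transfer (h : Biq d Δ M c s) (h' : Biq d Δ' M' c' s') (k : ℤ)
    (hk : Δ' = Δ + (8 * d) ^ 5 * k) : (discr M : ℚ) * (Δ' : ℚ) ^ 2 = discr M' * (Δ : ℚ) ^ 2 := by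
  have hk' : Δ = Δ' + (8 * d) ^ 5 * (-k) := by rw [hk]; ring
  let ψ : 𝓞 M ≃ₗ[ℤ] 𝓞 M' :=
    { (h.psi h' k hk).toIntLinearMap with
      invFun := h'.psi h (-k) hk'
      left_inv := h.psi_psi h' k hk hk'
      right_inv := by
        intro y
        ext
        change ((h.psi h' k hk (h'.psi h (-k) hk' y) : 𝓞 M') : M') = y
        rw [Biq.psi_coe, Biq.psi_coe, h'.map_map h] }
  have hψ : ∀ x, algebraMap (𝓞 M') M' (ψ x) = h.map c' s' (algebraMap (𝓞 M) M x) := fun x => rfl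
  have hrk : Module.finrank ℤ (𝓞 M) = 4 := by rw [RingOfIntegers.rank, h.rank]
  let b : Module.Basis (Fin 4) ℤ (𝓞 M) := Module.finBasisOfFinrankEq ℤ (𝓞 M) hrk
  let P : Matrix (Fin 4) (Fin 4) ℚ := fun i j => h.basis.repr (algebraMap (𝓞 M) M (b i)) j
  have hB : ∀ i, algebraMap (𝓞 M) M (b i) = el c s (P i 0) (P i 1) (P i 2) (P i 3) := by
    intro i
    conv_lhs => rw [← h.basis.sum_repr (algebraMap (𝓞 M) M (b i))]
    simp [Fin.sum_univ_four, h.basis_coe, Rat.smul_def, el, P]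
  have d1 : (discr M : ℚ) = P.det ^ 2 * (256 * d ^ 2 * Δ ^ 2) := by
    rw [← h.discr_basis, ← Algebra.discr_of_matrix_mulVec, ← discr_eq_discr M b]
    have := Algebra.discr_localizationLocalization ℤ (nonZeroDivisors ℤ) M b (Rₘ := ℚ)
    rw [← eq_intCast (algebraMap ℤ ℚ), ← this]
    congr 1
    ext i
    rw [Module.Basis.localizationLocalization_apply, hB]
    simp [Matrix.mulVec, dotProduct, Fin.sum_univ_four, el]
  have d2 : (discr M' : ℚ) = P.det ^ 2 * (256 * d ^ 2 * Δ' ^ 2) := by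
    rw [← h'.discr_basis, ← Algebra.discr_of_matrix_mulVec, ← discr_eq_discr M' (b.map ψ)]
    have := Algebra.discr_localizationLocalization ℤ (nonZeroDivisors ℤ) M' (b.map ψ) (Rₘ := ℚ)
    rw [← eq_intCast (algebraMap ℤ ℚ), ← this]
    congr 1
    ext i
    rw [Module.Basis.localizationLocalization_apply, Module.Basis.map_apply, hψ, hB, h.map_el]
    simp [Matrix.mulVec, dotProduct, Fin.sum_univ_four, el]
  rw [d1, d2]
  ring

/-- The signature. -/
lemma Biq.signature (h : Biq d Δ M c s) :
    (0 < d ∧ 0 < Δ → InfinitePlace.nrRealPlaces M = 4 ∧ InfinitePlace.nrComplexPlaces M = 0) ∧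
    (¬ (0 < d ∧ 0 < Δ) → InfinitePlace.nrRealPlaces M = 0 ∧ InfinitePlace.nrComplexPlaces M = 2) := by
  classical
  have hrank := InfinitePlace.card_add_two_mul_card_eq_rank M
  rw [h.rank] at hrank
  have hre : ∀ (z : ℂ) (n : ℤ), z ^ 2 = (n : ℂ) → ((starRingEnd ℂ) z = z ↔ 0 ≤ n) := by
    intro z n hz
    have h1 := congrArg Complex.re hz
    have h2 := congrArg Complex.im hz
    simp [sq] at h1 h2
    rw [Complex.conj_eq_iff_im]
    have h2' : z.re * z.im = 0 := by linarith
    constructor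
    · intro h0
      rw [h0] at h1
      have : (0 : ℝ) ≤ n := by nlinarith [mul_self_nonneg z.re]
      exact_mod_cast this
    · intro hn
      have hn' : (0 : ℝ) ≤ n := by exact_mod_cast hn
      rcases mul_eq_zero.mp h2' with h0 | h0
      · rw [h0] at h1
        have : z.im * z.im = 0 := by nlinarith [mul_self_nonneg z.im]
        exact mul_self_eq_zero.mp this
      · exact h0
  have hd0 : d ≠ 0 := by have := h.d_ne; exact_mod_cast this
  have hD0 : Δ ≠ 0 := by have := h.D_ne; exact_mod_cast this
  have hφ : ∀ φ : M →+* ℂ, ComplexEmbedding.IsReal φ ↔ (0 < d ∧ 0 < Δ) := by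
    intro φ
    have hc : (φ c) ^ 2 = (d : ℂ) := by rw [← map_pow, h.hc, map_intCast]
    have hs : (φ s) ^ 2 = (Δ : ℂ) := by rw [← map_pow, h.hs, map_intCast]
    have h1 := hre _ _ hc
    have h2 := hre _ _ hs
    rw [ComplexEmbedding.isReal_iff]
    constructor
    · intro hr
      have h3 := h1.mp (RingHom.congr_fun hr c)
      have h4 := h2.mp (RingHom.congr_fun hr s)
      exact ⟨by omega, by omega⟩
    · rintro ⟨h3, h4⟩
      ext x
      obtain ⟨a, b, e, f, rfl⟩ := h.el_surj x
      change (starRingEnd ℂ) (φ _) = φ _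
      simp [el, h1.mpr h3.le, h2.mpr h4.le]
  constructor
  · intro hh
    have := InfinitePlace.card_complex_embeddings M
    have h0 : Fintype.card { φ : M →+* ℂ // ¬ComplexEmbedding.IsReal φ } = 0 := by
      rw [Fintype.card_eq_zero_iff]
      exact ⟨fun φ => φ.2 ((hφ φ.1).mpr hh)⟩
    omega
  · intro hh
    have := InfinitePlace.card_real_embeddings M
    have h0 : Fintype.card { φ : M →+* ℂ // ComplexEmbedding.IsReal φ } = 0 := by
      rw [Fintype.card_eq_zero_iff]
      exact ⟨fun φ => hh ((hφ φ.1).mp φ.2)⟩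
    omega

/-- archimedean factor -/
noncomputable def arch (d Δ : ℤ) : ℝ :=
  if 0 < d ∧ 0 < Δ then 2 ^ 4 * 2 ^ 3 else (2 * Real.pi) ^ 2 * 2

lemma arch_pos (d Δ : ℤ) : 0 < arch d Δ := by
  unfold arch; split_ifs <;> positivity

lemma zetaTwo_eq (M : Type*) [Field M] [NumberField M] : zetaTwo M = ZZ M 2 := by
  unfold zetaTwo ZZ
  have h1 : ∀ I : {I : Ideal (𝓞 M) // I ≠ ⊥}, (((Ideal.absNorm I.1 : ℝ)) ^ 2)⁻¹ = zfun M 2 I.1 := by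
    intro I
    rw [zfun, Real.rpow_neg (by positivity)]
    norm_num
  rw [tsum_congr h1]
  exact tsum_subtype_eq_of_support_subset (s := {I : Ideal (𝓞 M) | I ≠ ⊥}) (fun I hI h0 => hI (by rw [h0]; exact zfun_bot M 2 two_ne_zero))

lemma Biq.schanuel_eq (h : Biq d Δ M c s) :
    schanuel M = arch d Δ * dedekindZeta_residue M / Real.sqrt |(discr M : ℝ)| / ZZ M 2 := by
  have hD : (0 : ℝ) < |(discr M : ℝ)| := by
    rw [abs_pos]; exact_mod_cast discr_ne_zero M
  have hw : ((Units.torsionOrder M : ℕ) : ℝ) ≠ 0 := by exact_mod_cast Units.torsionOrder_ne_zero M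
  have hZ : ZZ M 2 ≠ 0 := (ZZ_pos M 2 (by norm_num)).ne'
  rw [schanuel, zetaTwo_eq, dedekindZeta_residue_def]
  have hsq : |(discr M : ℝ)| = Real.sqrt |(discr M : ℝ)| * Real.sqrt |(discr M : ℝ)| :=
    (Real.mul_self_sqrt hD.le).symm
  have hs0 : Real.sqrt |(discr M : ℝ)| ≠ 0 := (Real.sqrt_pos.mpr hD).ne'
  rw [show |((discr M : ℤ) : ℝ)| = |(discr M : ℝ)| from rfl]
  push_cast
  unfold arch
  split_ifs with hh
  · obtain ⟨h1, h2⟩ := h.signature.1 hh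
    rw [h1, h2]
    conv_lhs => rw [hsq]
    field_simp
  · obtain ⟨h1, h2⟩ := h.signature.2 hh
    rw [h1, h2]
    conv_lhs => rw [hsq]
    field_simp
    norm_num

end Disc

section Combine

set_option linter.style.haveILetI false

open Filter Topology NumberField IsDedekindDomain

/-- The quadratic character, made to vanish off the integers coprime to `8 * d`. -/
noncomputable def chi (d D : ℤ) : ℕ →*₀ ℝ where
  toFun k := if Nat.Coprime k (8 * d.natAbs) then (jacobiSym D k : ℝ) else 0
  map_zero' := by
    rw [if_neg]
    rw [Nat.coprime_zero_left]; omega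
  map_one' := by simp
  map_mul' a b := by
    by_cases ha : Nat.Coprime a (8 * d.natAbs)
    · by_cases hb : Nat.Coprime b (8 * d.natAbs)
      · rw [if_pos ha, if_pos hb, if_pos (Nat.Coprime.mul_left ha hb)]
        have ha0 : a ≠ 0 := by rintro rfl; rw [Nat.coprime_zero_left] at ha; omega
        have hb0 : b ≠ 0 := by rintro rfl; rw [Nat.coprime_zero_left] at hb; omega
        rw [jacobiSym.mul_right' D ha0 hb0]; push_cast; rfl
      · rw [if_neg hb, if_neg (fun h => hb (Nat.Coprime.coprime_mul_left h)), mul_zero]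
    · rw [if_neg ha, if_neg (fun h => ha (Nat.Coprime.coprime_mul_right h)), zero_mul]

lemma chi_apply (d D : ℤ) (k : ℕ) :
    chi d D k = if Nat.Coprime k (8 * d.natAbs) then (jacobiSym D k : ℝ) else 0 := rfl

lemma jac_abs_le (D : ℤ) (k : ℕ) : |(jacobiSym D k : ℝ)| ≤ 1 := by
  rcases jacobiSym.trichotomy D k with h | h | h <;> rw [h] <;> simp

lemma chi_abs_le (d D : ℤ) (k : ℕ) : |chi d D k| ≤ 1 := by
  rw [chi_apply]; split_ifs
  · exact jac_abs_le D k
  · simp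

lemma chi_mul_left (d D E : ℤ) (k : ℕ) : chi d (D * E) k = chi d D k * chi d E k := by
  simp only [chi_apply]; split_ifs
  · rw [jacobiSym.mul_left]; push_cast; rfl
  · simp

/-- twisted by `k^{-s}` -/
noncomputable def tw (f : ℕ →*₀ ℝ) (s : ℝ) (_hs : s ≠ 0) : ℕ →*₀ ℝ where
  toFun k := f k * (k : ℝ) ^ (-s)
  map_zero' := by simp
  map_one' := by simp
  map_mul' a b := by
    rw [map_mul]; push_cast
    rw [Real.mul_rpow (by positivity) (by positivity)]; ring

/-- Dirichlet series. -/
noncomputable def LL (f : ℕ → ℝ) (s : ℝ) : ℝ := ∑' k : ℕ, f k * (k : ℝ) ^ (-s)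

lemma LL_summable (f : ℕ → ℝ) (hf : ∀ k, |f k| ≤ 1) (s : ℝ) (hs : 1 < s) :
    Summable (fun k : ℕ => ‖f k * (k : ℝ) ^ (-s)‖) := by
  refine Summable.of_nonneg_of_le (fun _ => norm_nonneg _) (fun k => ?_)
    ((Real.summable_nat_rpow (p := -s)).mpr (by linarith))
  rw [Real.norm_eq_abs, abs_mul, abs_of_nonneg (a := (k : ℝ) ^ (-s)) (by positivity)]
  exact mul_le_of_le_one_left (by positivity) (hf k)

lemma LL_euler (f : ℕ →*₀ ℝ) (hf : ∀ k, |f k| ≤ 1) (s : ℝ) (hs : 1 < s) :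
    Tendsto (fun N : ℕ => ∏ p ∈ N.primesBelow, (1 - f p * (p : ℝ) ^ (-s))⁻¹) atTop (𝓝 (LL f s)) := by
  have := EulerProduct.eulerProduct_completely_multiplicative (f := tw f s (by linarith))
    (LL_summable f hf s hs)
  exact this

lemma rpow_neg_lt_one (p : ℕ) (hp : p.Prime) (s : ℝ) (hs : 0 < s) : (p : ℝ) ^ (-s) < 1 :=
  Real.rpow_lt_one_of_one_lt_of_neg (by exact_mod_cast hp.one_lt) (by linarith)

lemma one_sub_pos (f : ℕ →*₀ ℝ) (hf : ∀ k, |f k| ≤ 1) (p : ℕ) (hp : p.Prime) (s : ℝ) (hs : 0 < s) :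
    0 < 1 - f p * (p : ℝ) ^ (-s) := by
  have h1 := rpow_neg_lt_one p hp s hs
  have h2 : 0 ≤ (p : ℝ) ^ (-s) := by positivity
  have h3 := (abs_le.mp (hf p)).2
  nlinarith

lemma LL_nonneg (f : ℕ →*₀ ℝ) (hf : ∀ k, |f k| ≤ 1) (s : ℝ) (hs : 1 < s) : 0 ≤ LL f s := by
  refine ge_of_tendsto' (LL_euler f hf s hs) (fun N => ?_)
  refine Finset.prod_nonneg (fun p hp => ?_)
  exact inv_nonneg.mpr (one_sub_pos f hf p (Nat.prime_of_mem_primesBelow hp) s (by linarith)).le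

/-- `L(2,f)⁻¹ = ∑ μ(n) f(n) n^{-2}` -/
lemma LL_moebius (f : ℕ →*₀ ℝ) (hf : ∀ k, |f k| ≤ 1) :
    LL f 2 * LL (fun k => (ArithmeticFunction.moebius k : ℝ) * f k) 2 = 1 := by
  set g : ℕ → ℝ := fun k => (ArithmeticFunction.moebius k : ℝ) * f k * (k : ℝ) ^ (-2 : ℝ) with hg
  have hmu : ∀ k, |(ArithmeticFunction.moebius k : ℝ) * f k| ≤ 1 := by
    intro k
    rw [abs_mul]
    have h1 : |(ArithmeticFunction.moebius k : ℝ)| ≤ 1 := by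
      exact_mod_cast ArithmeticFunction.abs_moebius_le_one (n := k)
    exact mul_le_one₀ h1 (abs_nonneg _) (hf k)
  have h1 := EulerProduct.eulerProduct (f := g) (by simp [hg]) (by
    intro m n hmn
    simp only [hg]
    rw [ArithmeticFunction.isMultiplicative_moebius.map_mul_of_coprime hmn, map_mul]
    push_cast
    rw [Real.mul_rpow (by positivity) (by positivity)]; ring)
    (LL_summable _ hmu 2 (by norm_num)) (by simp [hg])
  have h2 : ∀ p : ℕ, p.Prime → ∑' e, g (p ^ e) = 1 - f p * (p : ℝ) ^ (-2 : ℝ) := by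
    intro p hp
    rw [tsum_eq_sum (s := Finset.range 2)]
    · simp [hg, Finset.sum_range_succ, ArithmeticFunction.moebius_apply_prime hp]; ring
    · intro e he
      have he2 : 1 < e := by simpa using he
      simp only [hg]
      rw [ArithmeticFunction.moebius_apply_prime_pow hp (by omega), if_neg (by omega)]
      simp
  have h3 := LL_euler f hf 2 (by norm_num)
  have h4 := h3.mul h1
  refine tendsto_nhds_unique h4 ?_
  refine tendsto_const_nhds.congr (fun N => ?_)
  rw [← Finset.prod_mul_distrib]
  symm
  refine Finset.prod_eq_one (fun p hp => ?_)
  have hp' := Nat.prime_of_mem_primesBelow hp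
  rw [h2 p hp']
  exact inv_mul_cancel₀ (one_sub_pos f hf p hp' 2 (by norm_num)).ne'

variable {M : Type*} [Field M] [NumberField M] {d Δ : ℤ} {c s : M}

/-- product of the bad factors -/
noncomputable def badf (d : ℤ) (M : Type*) [Field M] [NumberField M] (σ : ℝ) : ℝ :=
  ∏ p ∈ (8 * d.natAbs).primeFactors, locf M σ p

lemma zfun_prime_lt (M : Type*) [Field M] [NumberField M] (σ : ℝ) (hσ : 0 < σ)
    (P : HeightOneSpectrum (𝓞 M)) : zfun M σ P.asIdeal < 1 := by
  unfold zfun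
  apply Real.rpow_lt_one_of_one_lt_of_neg _ (by linarith)
  have h0 : Ideal.absNorm P.asIdeal ≠ 0 := by
    rw [Ne, Ideal.absNorm_eq_zero_iff]; exact P.ne_bot
  have h1 : Ideal.absNorm P.asIdeal ≠ 1 := by
    rw [Ne, Ideal.absNorm_eq_one_iff]; exact P.isPrime.ne_top
  have : 1 < Ideal.absNorm P.asIdeal := by omega
  exact_mod_cast this

lemma locf_pos (M : Type*) [Field M] [NumberField M] (σ : ℝ) (hσ : 0 < σ) (p : ℕ) : 0 < locf M σ p :=
  Finset.prod_pos (fun P _ => by linarith [zfun_prime_lt M σ hσ P])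

lemma badf_pos (M : Type*) [Field M] [NumberField M] (σ : ℝ) (hσ : 0 < σ) : 0 < badf d M σ :=
  Finset.prod_pos (fun p _ => locf_pos M σ hσ p)

lemma badf_cont (M : Type*) [Field M] [NumberField M] : Continuous (fun σ => badf d M σ) := by
  unfold badf locf
  refine continuous_finsetProd _ (fun p _ => continuous_finsetProd _ (fun P _ => ?_))
  unfold zfun
  have h0 : (Ideal.absNorm P.asIdeal : ℝ) ≠ 0 := by
    have : Ideal.absNorm P.asIdeal ≠ 0 := by
      rw [Ne, Ideal.absNorm_eq_zero_iff]; exact P.ne_bot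
    exact_mod_cast this
  have : Continuous (fun σ : ℝ => (Ideal.absNorm P.asIdeal : ℝ) ^ (-σ)) := by
    refine Continuous.rpow continuous_const (by fun_prop) (fun x => Or.inl h0)
  fun_prop

lemma Biq.d_ne_zero (h : Biq d Δ M c s) : d ≠ 0 := by
  have := h.d_ne
  exact_mod_cast this

lemma Biq.ZZ_eq (h : Biq d Δ M c s) (σ : ℝ) (hσ : 1 < σ) :
    ZZ M σ * badf d M σ = LL (chi d 1) σ * LL (chi d d) σ * LL (chi d Δ) σ * LL (chi d (d * Δ)) σ := by
  have hd := h.d_ne_zero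
  have e1 := (dedekind_euler M σ hσ).inv₀ (inv_ne_zero (ZZ_pos M σ hσ).ne')
  rw [inv_inv] at e1
  have e2 := (((LL_euler (chi d 1) (chi_abs_le d 1) σ hσ).mul (LL_euler (chi d d) (chi_abs_le d d) σ hσ)).mul
    (LL_euler (chi d Δ) (chi_abs_le d Δ) σ hσ)).mul (LL_euler (chi d (d * Δ)) (chi_abs_le d _) σ hσ)
  have e3 := e1.mul_const (badf d M σ)
  refine tendsto_nhds_unique (e3.congr' ?_) e2
  filter_upwards [eventually_gt_atTop (8 * d.natAbs)] with N hN
  have hsub : (8 * d.natAbs).primeFactors ⊆ N.primesBelow := by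
    intro p hp
    rw [Nat.mem_primesBelow]
    exact ⟨lt_of_le_of_lt (Nat.le_of_mem_primeFactors hp) hN, Nat.prime_of_mem_primeFactors hp⟩
  have hb : badf d M σ = ∏ p ∈ N.primesBelow, (if p ∈ (8 * d.natAbs).primeFactors then locf M σ p else 1) := by
    rw [Finset.prod_ite_mem, Finset.inter_eq_right.mpr hsub]; rfl
  rw [hb, ← Finset.prod_inv_distrib]
  simp only [← Finset.prod_mul_distrib]
  refine Finset.prod_congr rfl (fun p hp => ?_)
  have hp' := Nat.prime_of_mem_primesBelow hp
  haveI : Fact p.Prime := ⟨hp'⟩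
  by_cases hpb : p ∈ (8 * d.natAbs).primeFactors
  · have hnc : ¬ Nat.Coprime p (8 * d.natAbs) := by
      rw [hp'.coprime_iff_not_dvd, not_not]
      exact Nat.dvd_of_mem_primeFactors hpb
    rw [if_pos hpb]
    simp only [chi_apply, if_neg hnc]
    rw [inv_mul_cancel₀ (locf_pos M σ (by linarith) p).ne']
    simp
  · have hnd : ¬ p ∣ 8 * d.natAbs := by
      intro hh; exact hpb (Nat.mem_primeFactors.mpr ⟨hp', hh, by simpa using hd⟩)
    have hcop : Nat.Coprime p (8 * d.natAbs) := hp'.coprime_iff_not_dvd.mpr hnd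
    have hnd' : ¬ (p : ℤ) ∣ 8 * d := by
      intro hh; apply hnd
      have := Int.natAbs_dvd_natAbs.mpr hh
      simpa [Int.natAbs_mul] using this
    rw [if_neg hpb, mul_one, h.locf_good p hnd' σ (by linarith)]
    simp only [chi_apply, if_pos hcop, jacobiSym.legendreSym.to_jacobiSym, jacobiSym.mul_left, jacobiSym.one_left]
    push_cast
    simp only [mul_inv, one_mul]

end Combine

section Analysis

open Filter Topology Finset

lemma abel_bound (f a : ℕ → ℝ) (B : ℝ) (hB : ∀ n, |∑ k ∈ Icc 1 n, f k| ≤ B)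
    (ha : ∀ k, 1 ≤ k → a (k + 1) ≤ a k) (ha0 : ∀ k, 0 ≤ a k) (n m : ℕ) (hnm : n ≤ m) :
    |∑ k ∈ Icc 1 m, f k * a k - ∑ k ∈ Icc 1 n, f k * a k| ≤ 2 * B * a (n + 1) := by
  have hB0 : 0 ≤ B := le_trans (abs_nonneg _) (hB 0)
  rcases hnm.eq_or_lt with rfl | hlt
  · rw [sub_self, abs_zero]; have := ha0 (n + 1); positivity
  have key : ∀ m, n + 1 ≤ m → |∑ k ∈ Icc 1 m, f k * a k - ∑ k ∈ Icc 1 n, f k * a k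
      - (∑ k ∈ Icc 1 m, f k) * a m + (∑ k ∈ Icc 1 n, f k) * a (n + 1)| ≤ B * (a (n + 1) - a m) := by
    intro m hm
    induction m, hm using Nat.le_induction with
    | base =>
      rw [sum_Icc_succ_top (by omega), sum_Icc_succ_top (by omega)]
      apply le_of_eq
      rw [sub_self, mul_zero, abs_eq_zero]; ring
    | succ m hm ih =>
      rw [sum_Icc_succ_top (by omega), sum_Icc_succ_top (by omega)]
      have h1 : |(∑ k ∈ Icc 1 m, f k) * (a m - a (m + 1))| ≤ B * (a m - a (m + 1)) := by
        rw [abs_mul, abs_of_nonneg (sub_nonneg.mpr (ha m (by omega)))]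
        exact mul_le_mul_of_nonneg_right (hB m) (sub_nonneg.mpr (ha m (by omega)))
      have h2 := abs_add_le (∑ k ∈ Icc 1 m, f k * a k - ∑ k ∈ Icc 1 n, f k * a k
        - (∑ k ∈ Icc 1 m, f k) * a m + (∑ k ∈ Icc 1 n, f k) * a (n + 1))
        ((∑ k ∈ Icc 1 m, f k) * (a m - a (m + 1)))
      refine le_trans (le_of_eq ?_) (h2.trans (le_trans (add_le_add ih h1) (le_of_eq ?_)))
      · congr 1; ring
      · ring
  have h := key m hlt
  have h1 : |(∑ k ∈ Icc 1 m, f k) * a m| ≤ B * a m := by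
    rw [abs_mul, abs_of_nonneg (ha0 m)]
    exact mul_le_mul_of_nonneg_right (hB m) (ha0 m)
  have h2 : |(∑ k ∈ Icc 1 n, f k) * a (n + 1)| ≤ B * a (n + 1) := by
    rw [abs_mul, abs_of_nonneg (ha0 _)]
    exact mul_le_mul_of_nonneg_right (hB n) (ha0 _)
  rw [abs_le] at *
  constructor <;> linarith [h.1, h.2, h1.1, h1.2, h2.1, h2.2]

lemma sum_range_eq_Icc (g : ℕ → ℝ) (h0 : g 0 = 0) (m : ℕ) :
    ∑ k ∈ range (m + 1), g k = ∑ k ∈ Icc 1 m, g k := by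
  rw [Finset.range_eq_Ico, Finset.sum_eq_sum_Ico_succ_bot (by omega), h0, zero_add]
  rfl

lemma LL_tendsto (f : ℕ → ℝ) (hf : ∀ k, |f k| ≤ 1) (s : ℝ) (hs : 1 < s) :
    Tendsto (fun m => ∑ k ∈ Icc 1 m, f k * (k : ℝ) ^ (-s)) atTop (𝓝 (LL f s)) := by
  have h1 := (LL_summable f hf s hs).of_norm.hasSum.tendsto_sum_nat
  have h2 := (tendsto_add_atTop_iff_nat 1).mpr h1
  refine h2.congr (fun m => ?_)
  refine sum_range_eq_Icc (fun k => f k * (k : ℝ) ^ (-s)) ?_ m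
  simp [Real.zero_rpow (show -s ≠ 0 by linarith)]

lemma dir_limit (f : ℕ → ℝ) (hf : ∀ k, |f k| ≤ 1) (B : ℝ) (hB : ∀ n, |∑ k ∈ Icc 1 n, f k| ≤ B) :
    ∃ l : ℝ, Tendsto (LL f) (𝓝[>] 1) (𝓝 l) ∧
      ∀ n : ℕ, |l - ∑ k ∈ Icc 1 n, f k * (k : ℝ) ^ (-1 : ℝ)| ≤ 2 * B / (n + 1) := by
  have hB0 : 0 ≤ B := le_trans (abs_nonneg _) (hB 0)
  have key : ∀ s : ℝ, 1 ≤ s → ∀ n m : ℕ, n ≤ m → |∑ k ∈ Icc 1 m, f k * (k : ℝ) ^ (-s)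
      - ∑ k ∈ Icc 1 n, f k * (k : ℝ) ^ (-s)| ≤ 2 * B / (n + 1) := by
    intro s hs n m hnm
    refine (abel_bound f (fun k => (k : ℝ) ^ (-s)) B hB ?_ (fun k => by positivity) n m hnm).trans ?_
    · intro k hk
      apply Real.rpow_le_rpow_of_nonpos (by exact_mod_cast hk) (by push_cast; linarith) (by linarith)
    · rw [div_eq_mul_inv]
      apply mul_le_mul_of_nonneg_left _ (by positivity)
      rw [← Real.rpow_neg_one]
      push_cast
      apply Real.rpow_le_rpow_of_exponent_le _ (by linarith)
      have : (0 : ℝ) ≤ n := by positivity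
      linarith
  have hlim0 : Tendsto (fun n : ℕ => 2 * B / ((n : ℝ) + 1)) atTop (𝓝 0) :=
    tendsto_const_nhds.div_atTop (tendsto_atTop_add_const_right _ _ tendsto_natCast_atTop_atTop)
  have hc : CauchySeq (fun n => ∑ k ∈ Icc 1 n, f k * (k : ℝ) ^ (-1 : ℝ)) := by
    refine cauchySeq_of_le_tendsto_0' (fun n : ℕ => 2 * B / ((n : ℝ) + 1)) (fun n m hnm => ?_) hlim0
    rw [dist_comm, Real.dist_eq]
    exact key 1 le_rfl n m hnm
  obtain ⟨l, hl⟩ := cauchySeq_tendsto_of_complete hc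
  have hl' : ∀ n : ℕ, |l - ∑ k ∈ Icc 1 n, f k * (k : ℝ) ^ (-1 : ℝ)| ≤ 2 * B / (n + 1) := by
    intro n
    refine le_of_tendsto (hl.sub_const _).abs ?_
    filter_upwards [eventually_ge_atTop n] with m hm using key 1 le_rfl n m hm
  have hs' : ∀ s : ℝ, 1 < s → ∀ n : ℕ, |LL f s - ∑ k ∈ Icc 1 n, f k * (k : ℝ) ^ (-s)| ≤ 2 * B / (n + 1) := by
    intro s hs n
    refine le_of_tendsto ((LL_tendsto f hf s hs).sub_const _).abs ?_
    filter_upwards [eventually_ge_atTop n] with m hm using key s hs.le n m hm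
  refine ⟨l, ?_, hl'⟩
  rw [Metric.tendsto_nhds]
  intro ε hε
  obtain ⟨n, hn⟩ := (hlim0.eventually_lt_const (show (0 : ℝ) < ε / 3 by linarith)).exists
  have hcont : Continuous (fun s : ℝ => ∑ k ∈ Icc 1 n, f k * (k : ℝ) ^ (-s)) := by
    refine continuous_finsetSum _ (fun k hk => ?_)
    have hk0 : (k : ℝ) ≠ 0 := by
      have := (mem_Icc.mp hk).1
      exact_mod_cast (by omega : k ≠ 0)
    exact continuous_const.mul (Continuous.rpow continuous_const (by fun_prop) (fun x => Or.inl hk0))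
  have h1 := (hcont.tendsto 1).mono_left (nhdsWithin_le_nhds (s := Set.Ioi (1 : ℝ)))
  rw [Metric.tendsto_nhds] at h1
  filter_upwards [h1 (ε / 3) (by linarith), self_mem_nhdsWithin] with s hs1 hs2
  rw [Real.dist_eq] at *
  have e1 := hs' s hs2 n
  have e2 := hl' n
  rw [abs_lt] at *
  rw [abs_le] at *
  constructor <;> linarith [e1.1, e1.2, e2.1, e2.2, hs1.1, hs1.2]

lemma tail_two (g : ℕ → ℝ) (hg : ∀ k, |g k| ≤ 1) (N : ℕ) (hN : 1 ≤ N) :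
    |LL g 2 - ∑ k ∈ Icc 1 N, g k * (k : ℝ) ^ (-2 : ℝ)| ≤ 1 / N := by
  have key : ∀ m, N ≤ m → |∑ k ∈ Icc 1 m, g k * (k : ℝ) ^ (-2 : ℝ) - ∑ k ∈ Icc 1 N, g k * (k : ℝ) ^ (-2 : ℝ)|
      ≤ 1 / N - 1 / m := by
    intro m hm
    induction m, hm using Nat.le_induction with
    | base => simp
    | succ m hm ih =>
      rw [sum_Icc_succ_top (by omega)]
      have hm0 : (0 : ℝ) < m := by exact_mod_cast (by omega : 0 < m)
      have h1 : |g (m + 1) * ((m + 1 : ℕ) : ℝ) ^ (-2 : ℝ)| ≤ 1 / m - 1 / ((m + 1 : ℕ) : ℝ) := by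
        rw [abs_mul, abs_of_nonneg (a := ((m + 1 : ℕ) : ℝ) ^ (-2 : ℝ)) (by positivity)]
        refine (mul_le_of_le_one_left (by positivity) (hg _)).trans ?_
        rw [Real.rpow_neg (by positivity), show (2 : ℝ) = ((2 : ℕ) : ℝ) by norm_num, Real.rpow_natCast]
        push_cast
        rw [div_sub_div _ _ hm0.ne' (by positivity), inv_eq_one_div, div_le_div_iff₀ (by positivity) (by positivity)]
        nlinarith
      have h2 := abs_add_le (∑ k ∈ Icc 1 m, g k * (k : ℝ) ^ (-2 : ℝ) - ∑ k ∈ Icc 1 N, g k * (k : ℝ) ^ (-2 : ℝ))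
        (g (m + 1) * ((m + 1 : ℕ) : ℝ) ^ (-2 : ℝ))
      rw [add_sub_right_comm]
      linarith
  refine le_of_tendsto ((LL_tendsto g hg 2 (by norm_num)).sub_const _).abs ?_
  filter_upwards [eventually_ge_atTop N] with m hm
  have := key m hm
  have h0 : (0 : ℝ) ≤ 1 / m := by positivity
  linarith

lemma harm_le (N : ℕ) : ∑ k ∈ Icc 1 N, (1 : ℝ) / k ≤ 1 + Real.log N := by
  have := harmonic_le_one_add_log N
  rw [harmonic_eq_sum_Icc] at this
  push_cast at this
  simpa [one_div] using this

/-- `L(1)/L(2)` as a sum. -/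
lemma G_approx (f : ℕ →*₀ ℝ) (hf : ∀ k, |f k| ≤ 1) (B l : ℝ) (hB : 0 ≤ B)
    (hl : ∀ n : ℕ, |l - ∑ k ∈ Icc 1 n, f k * (k : ℝ) ^ (-1 : ℝ)| ≤ 2 * B / (n + 1)) (N : ℕ) (hN : 1 ≤ N) :
    |l / LL f 2 - ∑ a ∈ Icc 1 N, f a * ((a.totient : ℝ) / (a : ℝ) ^ 2)| ≤ 4 * B * (1 + Real.log N) / N := by
  have hNR : (0 : ℝ) < N := by exact_mod_cast hN
  have hlog : 0 ≤ Real.log N := Real.log_nonneg (by exact_mod_cast hN)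
  have hmo := LL_moebius f hf
  set V := LL (fun k => (ArithmeticFunction.moebius k : ℝ) * f k) 2 with hV
  have hLne : LL f 2 ≠ 0 := left_ne_zero_of_mul_eq_one hmo
  have e0 : l / LL f 2 = l * V := by
    rw [div_eq_iff hLne]; linear_combination (-l) * hmo
  have hmu1 : ∀ k, |(ArithmeticFunction.moebius k : ℝ)| ≤ 1 := by
    intro k
    exact_mod_cast ArithmeticFunction.abs_moebius_le_one (n := k)
  have hmu : ∀ k, |(ArithmeticFunction.moebius k : ℝ) * f k| ≤ 1 := by
    intro k
    rw [abs_mul]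
    exact mul_le_one₀ (hmu1 k) (abs_nonneg _) (hf k)
  have ht := tail_two _ hmu N hN
  have hl0 : |l| ≤ 2 * B := by simpa using hl 0
  let F : ArithmeticFunction ℝ := ⟨fun k => (ArithmeticFunction.moebius k : ℝ) * f k / (k : ℝ) ^ 2, by simp⟩
  let H : ArithmeticFunction ℝ := ⟨fun k => f k / (k : ℝ), by simp⟩
  have hconv := ArithmeticFunction.sum_Ioc_mul_eq_sum_sum F H N
  have hFH : ∀ a ∈ Ioc 0 N, (F * H) a = f a * ((a.totient : ℝ) / (a : ℝ) ^ 2) := by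
    intro a ha
    have ha0 : 0 < a := (mem_Ioc.mp ha).1
    have haR : (0 : ℝ) < a := by exact_mod_cast ha0
    rw [ArithmeticFunction.mul_apply]
    have hh : ∀ x ∈ a.divisorsAntidiagonal, F x.1 * H x.2 =
        f a / a * ((ArithmeticFunction.moebius x.1 : ℝ) / x.1) := by
      rintro ⟨x, y⟩ hxy
      obtain ⟨hxy1, hxy2⟩ := Nat.mem_divisorsAntidiagonal.mp hxy
      simp only at hxy1
      have hx : (x : ℝ) ≠ 0 := by
        have : x ≠ 0 := by rintro rfl; simp at hxy1; omega
        exact_mod_cast this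
      have hy : (y : ℝ) ≠ 0 := by
        have : y ≠ 0 := by rintro rfl; simp at hxy1; omega
        exact_mod_cast this
      simp only [F, H, ArithmeticFunction.coe_mk]
      rw [← hxy1, map_mul]; push_cast
      field_simp
    rw [sum_congr rfl hh, ← mul_sum, Nat.sum_divisorsAntidiagonal (fun i _ => (ArithmeticFunction.moebius i : ℝ) / i),
      sum_moebius_div a ha0]
    field_simp
  rw [sum_congr rfl hFH] at hconv
  have hIoc : ∀ n, Ioc 0 n = Icc 1 n := fun n => by ext; simp; omega
  simp only [hIoc] at hconv
  rw [e0, hconv]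
  have hin : ∀ n : ℕ, ∑ k ∈ Icc 1 n, f k * (k : ℝ) ^ (-1 : ℝ) = ∑ k ∈ Icc 1 n, H k := by
    intro n
    refine sum_congr rfl (fun k _ => ?_)
    simp only [H, ArithmeticFunction.coe_mk]
    rw [Real.rpow_neg_one, div_eq_mul_inv]
  have hout : ∑ k ∈ Icc 1 N, (ArithmeticFunction.moebius k : ℝ) * f k * (k : ℝ) ^ (-2 : ℝ) = ∑ k ∈ Icc 1 N, F k := by
    refine sum_congr rfl (fun k _ => ?_)
    simp only [F, ArithmeticFunction.coe_mk]
    rw [Real.rpow_neg (by positivity), show (2 : ℝ) = ((2 : ℕ) : ℝ) by norm_num, Real.rpow_natCast, div_eq_mul_inv]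
  rw [hout] at ht
  simp only [hin] at hl
  have split : l * V - ∑ n ∈ Icc 1 N, F n * ∑ m ∈ Icc 1 (N / n), H m
      = l * (V - ∑ n ∈ Icc 1 N, F n) + ∑ n ∈ Icc 1 N, F n * (l - ∑ m ∈ Icc 1 (N / n), H m) := by
    simp only [mul_sub, sum_sub_distrib, ← sum_mul]
    ring
  rw [split]
  have b1 : |l * (V - ∑ n ∈ Icc 1 N, F n)| ≤ 2 * B * (1 / N) := by
    rw [abs_mul]; exact mul_le_mul hl0 ht (abs_nonneg _) (by positivity)
  have b2 : |∑ n ∈ Icc 1 N, F n * (l - ∑ m ∈ Icc 1 (N / n), H m)| ≤ ∑ n ∈ Icc 1 N, (2 * B / N) * (1 / n) := by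
    refine (abs_sum_le_sum_abs _ _).trans (sum_le_sum (fun n hn => ?_))
    have hn1 := (mem_Icc.mp hn).1
    have hnR : (0 : ℝ) < n := by exact_mod_cast hn1
    rw [abs_mul]
    have c1 : |F n| ≤ 1 / (n : ℝ) ^ 2 := by
      simp only [F, ArithmeticFunction.coe_mk]
      rw [abs_div, abs_of_pos (a := (n : ℝ) ^ 2) (by positivity)]
      exact div_le_div_of_nonneg_right (hmu n) (by positivity)
    have c2 : |l - ∑ m ∈ Icc 1 (N / n), H m| ≤ 2 * B * (n / N) := by
      refine (hl (N / n)).trans ?_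
      rw [div_eq_mul_inv]
      refine mul_le_mul_of_nonneg_left ?_ (by positivity)
      rw [inv_eq_one_div, div_le_div_iff₀ (by positivity) hNR, one_mul]
      have : N < n * (N / n + 1) := Nat.lt_mul_div_succ N hn1
      exact_mod_cast this.le
    refine (mul_le_mul c1 c2 (abs_nonneg _) (by positivity)).trans (le_of_eq ?_)
    field_simp
  rw [← mul_sum] at b2
  have b3 := mul_le_mul_of_nonneg_left (harm_le N) (show 0 ≤ 2 * B / N by positivity)
  have b4 := abs_add_le (l * (V - ∑ n ∈ Icc 1 N, F n)) (∑ n ∈ Icc 1 N, F n * (l - ∑ m ∈ Icc 1 (N / n), H m))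
  have b5 : 4 * B * (1 + Real.log N) / N = 2 * B * (1 / N) + 2 * B / N * (1 + Real.log N) + 2 * B / N * Real.log N := by
    field_simp; ring
  have b6 : 0 ≤ 2 * B / N * Real.log N := by positivity
  linarith

end Analysis

section Periodic

open Filter Topology Finset

/-- The big modulus. -/
def QQ (d : ℤ) : ℕ := (8 * d.natAbs) ^ 5

lemma QQ_pos (d : ℤ) (hd : d ≠ 0) : 0 < QQ d := by
  have := Int.natAbs_pos.mpr hd
  unfold QQ; positivity

lemma dvd_QQ (d : ℤ) : 8 * d.natAbs ∣ QQ d := dvd_pow_self _ (by norm_num)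

lemma coprime_QQ (d : ℤ) (k : ℕ) : Nat.Coprime k (QQ d) ↔ Nat.Coprime k (8 * d.natAbs) :=
  Nat.coprime_pow_right_iff (by norm_num) _ _

lemma odd_of_coprime (d : ℤ) (k : ℕ) (h : Nat.Coprime k (8 * d.natAbs)) : Odd k := by
  have h1 : Nat.Coprime k 2 := h.coprime_dvd_right ⟨4 * d.natAbs, by ring⟩
  exact Nat.coprime_two_right.mp h1

lemma chi_modEq (d t : ℤ) (ht : 4 * t.natAbs ∣ QQ d) (k r : ℕ) (h : k ≡ r [MOD QQ d]) :
    chi d t k = chi d t r := by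
  have h8 : k ≡ r [MOD 8 * d.natAbs] := h.of_dvd (dvd_QQ d)
  have hc : Nat.Coprime k (8 * d.natAbs) ↔ Nat.Coprime r (8 * d.natAbs) := by
    unfold Nat.Coprime; rw [h8.gcd_eq]
  rw [chi_apply, chi_apply]
  by_cases hk : Nat.Coprime k (8 * d.natAbs)
  · rw [if_pos hk, if_pos (hc.mp hk), jacobiSym.mod_right t (odd_of_coprime d k hk),
      jacobiSym.mod_right t (odd_of_coprime d r (hc.mp hk))]
    have : k % (4 * t.natAbs) = r % (4 * t.natAbs) := h.of_dvd ht
    rw [this]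
  · rw [if_neg hk, if_neg (fun h => hk (hc.mpr h))]

lemma sum_classes (Q : ℕ) (hQ : 0 < Q) (g : ℕ → ℝ) (n : ℕ) :
    haveI : NeZero Q := ⟨hQ.ne'⟩
    ∑ k ∈ Icc 1 n, g k = ∑ c : ZMod Q, ∑ k ∈ (Icc 1 n).filter (fun k : ℕ => (k : ZMod Q) = c), g k := by
  haveI : NeZero Q := ⟨hQ.ne'⟩
  rw [Finset.sum_fiberwise]

lemma chi_bound (d t : ℤ) (hd : d ≠ 0) (ht : 4 * t.natAbs ∣ QQ d) (m : ℕ) (hm : Odd m)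
    (hcop : Nat.Coprime (QQ d) m) (hns : ¬ IsSquare m) (n : ℕ) :
    |∑ k ∈ Icc 1 n, chi d (t * m) k| ≤ 2 * QQ d * (Real.sqrt m * (1 + Real.log m)) := by
  have hQ := QQ_pos d hd
  haveI : NeZero (QQ d) := ⟨hQ.ne'⟩
  rw [sum_classes (QQ d) hQ]
  refine (abs_sum_le_sum_abs _ _).trans ?_
  have key : ∀ c : ZMod (QQ d), |∑ k ∈ (Icc 1 n).filter (fun k : ℕ => (k : ZMod (QQ d)) = c), chi d (t * m) k|
      ≤ 2 * (Real.sqrt m * (1 + Real.log m)) := by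
    intro c
    have h1 := jac_ap (QQ d) m hQ hm hcop c n
    rw [if_neg hns, sub_zero] at h1
    have hcong : ∀ k : ℕ, (k : ZMod (QQ d)) = c → k ≡ c.val [MOD QQ d] := by
      intro k hk
      rw [← ZMod.natCast_eq_natCast_iff, hk, ZMod.natCast_val, ZMod.cast_id', id]
    have h2 : ∀ k ∈ (Icc 1 n).filter (fun k : ℕ => (k : ZMod (QQ d)) = c),
        chi d (t * m) k = (chi d t c.val * (qrSign c.val m : ℝ)) * (jacobiSym (k : ℤ) m : ℝ) := by
      intro k hk
      have hk' := hcong k (mem_filter.mp hk).2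
      rw [chi_mul_left, chi_modEq d t ht k c.val hk']
      by_cases hco : Nat.Coprime k (8 * d.natAbs)
      · have e1 : chi d (m : ℤ) k = (jacobiSym (m : ℤ) k : ℝ) := by rw [chi_apply, if_pos hco]
        rw [e1, jacobiSym.quadratic_reciprocity' hm (odd_of_coprime d k hco)]
        have h4 : k ≡ c.val [MOD 4] := hk'.of_dvd (dvd_trans ⟨2 * d.natAbs, by ring⟩ (dvd_QQ d))
        have e2 : qrSign k m = qrSign c.val m := by
          unfold qrSign
          rw [(ZMod.natCast_eq_natCast_iff k c.val 4).mpr h4]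
        rw [e2]; push_cast; ring
      · have e1 : chi d t c.val = 0 := by
          rw [← chi_modEq d t ht k c.val hk', chi_apply, if_neg hco]
        rw [e1]; ring
    rw [sum_congr rfl h2, ← mul_sum, abs_mul]
    refine (mul_le_of_le_one_left (abs_nonneg _) ?_).trans h1
    rw [abs_mul]
    exact mul_le_one₀ (chi_abs_le d t _) (abs_nonneg _) (jac_abs_le _ _)
  refine (sum_le_sum (fun c _ => key c)).trans ?_
  rw [sum_const, card_univ, ZMod.card, nsmul_eq_mul]
  apply le_of_eq; ring

lemma periodic_bound (Q : ℕ) (hQ : 0 < Q) (g : ℕ → ℝ) (hg : ∀ k, |g k| ≤ 1) (hper : ∀ k, g (k + Q) = g k)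
    (h0 : ∑ k ∈ range Q, g k = 0) (n : ℕ) : |∑ k ∈ Icc 1 n, g k| ≤ Q + 1 := by
  set h : ℕ → ℝ := fun n => ∑ k ∈ range n, g k with hh
  have hp : Function.Periodic h Q := by
    intro n
    induction n with
    | zero => simp [hh, h0]
    | succ n ih =>
      have e1 : h (n + 1 + Q) = h (n + Q) + g (n + Q) := by
        simp only [hh]; rw [show n + 1 + Q = (n + Q) + 1 by ring, sum_range_succ]
      have e2 : h (n + 1) = h n + g n := by simp only [hh]; rw [sum_range_succ]
      rw [e1, e2, ih, hper]
  have h1 : ∑ k ∈ Icc 1 n, g k = h (n + 1) - g 0 := by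
    simp only [hh]
    rw [Finset.range_eq_Ico, Finset.sum_eq_sum_Ico_succ_bot (by omega)]
    simp only [zero_add, add_sub_cancel_left]; rfl
  have h2 : h (n + 1) = h ((n + 1) % Q) := (hp.map_mod_nat (n + 1)).symm
  have h3 : |h ((n + 1) % Q)| ≤ Q := by
    refine (abs_sum_le_sum_abs _ _).trans ((sum_le_sum (fun k _ => hg k)).trans ?_)
    rw [sum_const, card_range, nsmul_eq_mul, mul_one]
    exact_mod_cast (Nat.mod_lt _ hQ).le
  rw [h1, h2]
  refine (abs_sub _ _).trans ?_
  linarith [hg 0]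

lemma chi_period (d t : ℤ) (ht : 4 * t.natAbs ∣ QQ d) (k : ℕ) : chi d t (k + QQ d) = chi d t k :=
  chi_modEq d t ht _ _ (by simp [Nat.ModEq])

lemma four_d_dvd (d : ℤ) : 4 * d.natAbs ∣ QQ d := dvd_trans ⟨2, by ring⟩ (dvd_QQ d)

lemma exists_neg (d : ℤ) (hsq : Squarefree d) (hd1 : d ≠ 1) : ∃ k, chi d d k = -1 := by
  have hd0 : d ≠ 0 := hsq.ne_zero
  have hn : Squarefree d.natAbs := Int.squarefree_natAbs.mpr hsq
  obtain ⟨u, m, hdum, hu, hm⟩ : ∃ (u : ℤ) (m : ℕ), d = u * m ∧ (u = 1 ∨ u = -1 ∨ u = 2 ∨ u = -2) ∧ Odd m := by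
    have hs : d = d.natAbs ∨ d = -d.natAbs := by omega
    rcases Nat.even_or_odd d.natAbs with he | ho
    · obtain ⟨m, hm⟩ := he
      have hmo : Odd m := by
        by_contra hcon
        rw [Nat.not_odd_iff_even] at hcon
        obtain ⟨j, hj⟩ := hcon
        have := hn 2 ⟨j, by omega⟩
        norm_num at this
      rcases hs with hs | hs
      · exact ⟨2, m, by omega, by simp, hmo⟩
      · exact ⟨-2, m, by omega, by simp, hmo⟩
    · rcases hs with hs | hs
      · exact ⟨1, d.natAbs, by omega, by simp, ho⟩
      · exact ⟨-1, d.natAbs, by omega, by simp, ho⟩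
  have hmd : m ∣ d.natAbs := by
    rw [hdum, Int.natAbs_mul]; simp
  by_cases hm1 : m = 1
  · subst hm1
    rw [Nat.cast_one, mul_one] at hdum
    subst hdum
    rcases hu with rfl | rfl | rfl | rfl
    · exact absurd rfl hd1
    · refine ⟨3, ?_⟩
      rw [chi_apply, if_pos (by norm_num)]; norm_num
    · refine ⟨3, ?_⟩
      rw [chi_apply, if_pos (by norm_num)]; norm_num
    · refine ⟨5, ?_⟩
      rw [chi_apply, if_pos (by norm_num)]; norm_num
  · obtain ⟨p, hp, hpm⟩ := Nat.exists_prime_and_dvd hm1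
    have hpo : Odd p := Odd.of_dvd_nat hm hpm
    have h8p : Nat.Coprime 8 p := by
      have : Nat.Coprime 2 p := (Nat.coprime_two_left).mpr hpo
      exact Nat.Coprime.pow_left 3 this
    obtain ⟨c, hc8, -, hcj⟩ := exists_twist m hm (hn.squarefree_of_dvd hmd) 8 p hp hpm h8p
    have hc8' : c % 8 = 1 := hc8
    have hco : Odd c := Nat.odd_iff.mpr (by omega)
    have hcm : Nat.Coprime c m := by
      by_contra hcon
      have : jacobiSym (c : ℤ) m = 0 := by
        rw [jacobiSym.eq_zero_iff]
        exact ⟨hm.pos.ne', by simpa [Int.gcd_natCast_natCast] using hcon⟩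
      omega
    have hc2 : Nat.Coprime c 2 := Nat.coprime_two_right.mpr hco
    have hcu : Nat.Coprime c u.natAbs := by
      rcases hu with rfl | rfl | rfl | rfl <;> simp [hco]
    have hcd : Nat.Coprime c (8 * d.natAbs) := by
      rw [hdum, Int.natAbs_mul]
      exact Nat.Coprime.mul_right (Nat.Coprime.pow_right 3 hc2) (Nat.Coprime.mul_right hcu (by simpa using hcm))
    refine ⟨c, ?_⟩
    rw [chi_apply, if_pos hcd]
    have h1 : jacobiSym d c = jacobiSym u c * jacobiSym m c := by
      conv_lhs => rw [hdum]
      rw [jacobiSym.mul_left]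
    have h2 : jacobiSym u c = 1 := by
      rw [jacobiSym.mod_right u hco]
      have : c % (4 * u.natAbs) = 1 := by
        rcases hu with rfl | rfl | rfl | rfl <;> simp <;> omega
      rw [this, jacobiSym.one_right]
    have h3 : jacobiSym m c = -1 := by
      rw [jacobiSym.quadratic_reciprocity_one_mod_four' hm (by omega), hcj]
    rw [h1, h2, h3]; norm_num

lemma chi_period_sum (d : ℤ) (hsq : Squarefree d) (hd1 : d ≠ 1) : ∑ k ∈ range (QQ d), chi d d k = 0 := by
  have hd0 : d ≠ 0 := hsq.ne_zero
  have hQ := QQ_pos d hd0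
  haveI : NeZero (QQ d) := ⟨hQ.ne'⟩
  obtain ⟨k0, hk0⟩ := exists_neg d hsq hd1
  have hco : Nat.Coprime k0 (QQ d) := by
    rw [coprime_QQ]
    by_contra hcon
    rw [chi_apply, if_neg hcon] at hk0
    norm_num at hk0
  have e1 : ∑ k ∈ range (QQ d), chi d d k = ∑ c : ZMod (QQ d), chi d d c.val := by
    refine Finset.sum_bij' (fun k _ => (k : ZMod (QQ d))) (fun c _ => c.val) (by simp)
      (fun c _ => by simpa using ZMod.val_lt c) ?_ ?_ ?_
    · intro k hk
      exact ZMod.val_cast_of_lt (by simpa using hk)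
    · intro c _; simp
    · intro k hk
      rw [ZMod.val_cast_of_lt (by simpa using hk)]
  rw [e1]
  let u := ZMod.unitOfCoprime k0 hco
  have e2 : ∑ c : ZMod (QQ d), chi d d c.val = ∑ c : ZMod (QQ d), chi d d ((u.mulLeft c).val) :=
    (Equiv.sum_comp u.mulLeft (fun c => chi d d c.val)).symm
  have e3 : ∀ c : ZMod (QQ d), chi d d ((u.mulLeft c).val) = -chi d d c.val := by
    intro c
    have : chi d d ((u.mulLeft c).val) = chi d d (k0 * c.val) := by
      apply chi_modEq d d (four_d_dvd d)
      rw [← ZMod.natCast_eq_natCast_iff]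
      simp [u]
    rw [this, map_mul, hk0]; ring
  simp only [e3, sum_neg_distrib] at e2
  linarith

lemma chi_d_bound (d : ℤ) (hsq : Squarefree d) (hd1 : d ≠ 1) (n : ℕ) :
    |∑ k ∈ Icc 1 n, chi d d k| ≤ QQ d + 1 :=
  periodic_bound (QQ d) (QQ_pos d hsq.ne_zero) _ (chi_abs_le d d) (chi_period d d (four_d_dvd d))
    (chi_period_sum d hsq hd1) n

lemma chi_one_limit (d : ℤ) (hd : d ≠ 0) :
    ∃ α : ℝ, Tendsto (fun s => (s - 1) * LL (chi d 1) s) (𝓝[>] 1) (𝓝 α) := by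
  have hQ := QQ_pos d hd
  have hQR : (0 : ℝ) < QQ d := by exact_mod_cast hQ
  set α : ℝ := (∑ k ∈ range (QQ d), chi d 1 k) / QQ d with hα
  have h01 : ∀ k, 0 ≤ chi d 1 k ∧ chi d 1 k ≤ 1 := by
    intro k; rw [chi_apply, jacobiSym.one_left]; split_ifs <;> norm_num
  have hα0 : 0 ≤ α := div_nonneg (sum_nonneg (fun k _ => (h01 k).1)) hQR.le
  have hα1 : α ≤ 1 := by
    rw [hα, div_le_one hQR]
    refine (sum_le_sum (fun k _ => (h01 k).2)).trans ?_
    simp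
  set f : ℕ → ℝ := fun k => chi d 1 k - α with hf
  have hf1 : ∀ k, |f k| ≤ 1 := by
    intro k; rw [abs_le]; simp only [hf]; constructor <;> linarith [(h01 k).1, (h01 k).2]
  have h4 : 4 * (1 : ℤ).natAbs ∣ QQ d := dvd_trans ⟨2 * d.natAbs, by simp; ring⟩ (dvd_QQ d)
  have hB := periodic_bound (QQ d) hQ f hf1 (fun k => by simp only [hf]; rw [chi_period d 1 h4]) (by
    simp only [hf]; rw [sum_sub_distrib, sum_const, card_range, nsmul_eq_mul, hα]; field_simp; ring)
  obtain ⟨l, hl, -⟩ := dir_limit f hf1 _ hB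
  refine ⟨α, ?_⟩
  have h1 : Tendsto (fun s : ℝ => (s - 1)) (𝓝[>] 1) (𝓝 0) := by
    have : Tendsto (fun s : ℝ => (s - 1)) (𝓝 1) (𝓝 (1 - 1)) := by
      exact (continuous_id.sub continuous_const).tendsto 1
    rw [sub_self] at this
    exact this.mono_left nhdsWithin_le_nhds
  have h2 := (h1.mul hl).add (tendsto_sub_mul_tsum_nat_rpow.const_mul α)
  rw [zero_mul, zero_add, mul_one] at h2
  refine h2.congr' ?_
  filter_upwards [self_mem_nhdsWithin] with s hs
  have hs : 1 < s := hs
  have e1 : LL (chi d 1) s = LL f s + α * ∑' (n : ℕ), 1 / (n : ℝ) ^ s := by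
    unfold LL
    rw [← tsum_mul_left, ← Summable.tsum_add (LL_summable f hf1 s hs).of_norm
      ((Real.summable_one_div_nat_rpow.mpr hs).mul_left α)]
    refine tsum_congr (fun k => ?_)
    simp only [hf]
    rw [Real.rpow_neg (by positivity)]; ring
  rw [e1]; ring

end Periodic

section Formula

open Filter Topology Finset NumberField

/-- The analytic size of the characters. -/
noncomputable def BB (d Δ : ℤ) : ℝ :=
  2 * QQ d * (Real.sqrt Δ.natAbs * (1 + Real.log Δ.natAbs))

lemma decomp (d Δ : ℤ) (hd : d ≠ 0) (hf : ∃ m : ℤ, Squarefree m ∧ (Δ = m ∨ Δ = 4 * m)) :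
    ∃ (t : ℤ) (m : ℕ), Δ = t * m ∧ 4 * t.natAbs ∣ QQ d ∧ 4 * (d * t).natAbs ∣ QQ d ∧ Odd m ∧
      Nat.Coprime (QQ d) m ∧ (8 * d.natAbs < Δ.natAbs → ¬ IsSquare m) ∧ m ≤ Δ.natAbs ∧ 1 ≤ m := by
  obtain ⟨m, hm, hΔ⟩ := hf
  have hm0 : m ≠ 0 := hm.ne_zero
  have hn : Squarefree m.natAbs := Int.squarefree_natAbs.mpr hm
  obtain ⟨m', hm'⟩ : Nat.gcd m.natAbs (2 * d.natAbs) ∣ m.natAbs := Nat.gcd_dvd_left _ _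
  set g := Nat.gcd m.natAbs (2 * d.natAbs) with hg
  have hgd : g ∣ 2 * d.natAbs := Nat.gcd_dvd_right _ _
  have hm'0 : m' ≠ 0 := by rintro rfl; rw [mul_zero] at hm'; omega
  have hcop : Nat.Coprime m' (2 * d.natAbs) := by
    rw [Nat.coprime_iff_gcd_eq_one]
    by_contra hcon
    obtain ⟨p, hp, hpd⟩ := Nat.exists_prime_and_dvd hcon
    have h1 : p ∣ m' := hpd.trans (Nat.gcd_dvd_left _ _)
    have h2 : p ∣ 2 * d.natAbs := hpd.trans (Nat.gcd_dvd_right _ _)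
    have h3 : p ∣ g := Nat.dvd_gcd (hm' ▸ h1.mul_left g) h2
    have h4 := hn p (hm' ▸ mul_dvd_mul h3 h1)
    exact hp.one_lt.ne' (Nat.isUnit_iff.mp h4)
  have hodd : Odd m' := Nat.coprime_two_right.mp (hcop.coprime_dvd_right ⟨_, rfl⟩)
  have hcop8 : Nat.Coprime m' (8 * d.natAbs) :=
    Nat.Coprime.mul_right (Nat.Coprime.pow_right 3 (Nat.coprime_two_right.mpr hodd))
      (hcop.coprime_dvd_right ⟨2, by ring⟩)
  -- the sign
  obtain ⟨t, ht, hte⟩ : ∃ t : ℤ, Δ = t * m' ∧ t.natAbs ∣ 4 * g := by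
    have hsg : m = g * m' ∨ m = -(g * m') := by
      have : m = m.natAbs ∨ m = -m.natAbs := by omega
      rw [hm'] at this; push_cast at this; exact this
    rcases hΔ with rfl | rfl <;> rcases hsg with hs | hs
    · exact ⟨g, hs, by simp⟩
    · exact ⟨-g, by rw [hs]; ring, by simp⟩
    · exact ⟨4 * g, by rw [hs]; ring, by simp [Int.natAbs_mul]⟩
    · exact ⟨-(4 * g), by rw [hs]; ring, by simp [Int.natAbs_mul]⟩
  have ht8 : t.natAbs ∣ 8 * d.natAbs := by
    refine hte.trans ((mul_dvd_mul_left 4 hgd).trans ⟨1, by ring⟩)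
  have hpow : ∀ x : ℕ, x * (8 * d.natAbs) ^ 2 ∣ x * QQ d := fun x => mul_dvd_mul_left x (pow_dvd_pow _ (by norm_num))
  have hnat : Δ.natAbs = t.natAbs * m' := by rw [ht, Int.natAbs_mul]; simp
  have ht0 : 0 < t.natAbs := by
    rcases Nat.eq_zero_or_pos t.natAbs with h | h
    · exfalso
      rw [h, zero_mul] at hnat
      rcases hΔ with rfl | rfl
      · omega
      · omega
    · exact h
  refine ⟨t, m', ht, ?_, ?_, hodd, ?_, ?_, ?_, by omega⟩
  · have h1 : 4 * t.natAbs ∣ (8 * d.natAbs) * (8 * d.natAbs) := mul_dvd_mul ⟨2 * d.natAbs, by ring⟩ ht8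
    exact h1.trans ⟨(8 * d.natAbs) ^ 3, by unfold QQ; ring⟩
  · have h1 : 4 * (d * t).natAbs ∣ (8 * d.natAbs) * (8 * d.natAbs) := by
      rw [Int.natAbs_mul, ← mul_assoc]
      exact mul_dvd_mul ⟨2, by ring⟩ ht8
    exact h1.trans ⟨(8 * d.natAbs) ^ 3, by unfold QQ; ring⟩
  · exact ((coprime_QQ d m').mpr hcop8).symm
  · intro hlt hsq
    obtain ⟨r, hr⟩ := hsq
    have h1 := hn r ⟨g, by rw [hm', hr]; ring⟩
    rw [Nat.isUnit_iff] at h1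
    subst h1
    have := Nat.le_of_dvd (by have := Int.natAbs_pos.mpr hd; omega) ht8
    rw [hnat, hr] at hlt
    omega
  · rw [hnat]; exact Nat.le_mul_of_pos_left _ ht0

lemma size_mono (m n : ℕ) (hm : 1 ≤ m) (hmn : m ≤ n) :
    Real.sqrt m * (1 + Real.log m) ≤ Real.sqrt n * (1 + Real.log n) := by
  have h1 : (1 : ℝ) ≤ m := by exact_mod_cast hm
  have h2 : (m : ℝ) ≤ n := by exact_mod_cast hmn
  have := Real.log_nonneg h1
  exact mul_le_mul (Real.sqrt_le_sqrt h2) (by linarith [Real.log_le_log (by linarith) h2]) (by linarith)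
    (Real.sqrt_nonneg _)

lemma chi_Delta_bound (d Δ : ℤ) (hd : d ≠ 0) (hf : ∃ m : ℤ, Squarefree m ∧ (Δ = m ∨ Δ = 4 * m))
    (hlarge : 8 * d.natAbs < Δ.natAbs) (n : ℕ) :
    |∑ k ∈ Icc 1 n, chi d Δ k| ≤ BB d Δ ∧ |∑ k ∈ Icc 1 n, chi d (d * Δ) k| ≤ BB d Δ := by
  obtain ⟨t, m, h1, h2, h3, h4, h5, h6, h7, h8⟩ := decomp d Δ hd hf
  have hb : 2 * QQ d * (Real.sqrt m * (1 + Real.log m)) ≤ BB d Δ :=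
    mul_le_mul_of_nonneg_left (size_mono m _ h8 h7) (by positivity)
  constructor
  · have := chi_bound d t hd h2 m h4 h5 (h6 hlarge) n
    rw [← h1] at this
    exact this.trans hb
  · have := chi_bound d (d * t) hd h3 m h4 h5 (h6 hlarge) n
    rw [mul_assoc, ← h1] at this
    exact this.trans hb

/-- `L(1,f)/L(2,f)` -/
noncomputable def Gc (d D : ℤ) : ℝ := limUnder (𝓝[>] 1) (LL (chi d D)) / LL (chi d D) 2

lemma Gc_spec (d D : ℤ) (B : ℝ) (hB : ∀ n, |∑ k ∈ Icc 1 n, chi d D k| ≤ B) :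
    Tendsto (LL (chi d D)) (𝓝[>] 1) (𝓝 (Gc d D * LL (chi d D) 2)) ∧
    ∀ N : ℕ, 1 ≤ N → |Gc d D - ∑ a ∈ Icc 1 N, chi d D a * ((a.totient : ℝ) / (a : ℝ) ^ 2)|
      ≤ 4 * B * (1 + Real.log N) / N := by
  obtain ⟨l, hl, hl2⟩ := dir_limit (chi d D) (chi_abs_le d D) B hB
  have hB0 : 0 ≤ B := le_trans (abs_nonneg _) (hB 0)
  have h1 : limUnder (𝓝[>] 1) (LL (chi d D)) = l := hl.limUnder_eq
  have h2 : LL (chi d D) 2 ≠ 0 := left_ne_zero_of_mul_eq_one (LL_moebius (chi d D) (chi_abs_le d D))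
  constructor
  · rw [Gc, h1, div_mul_cancel₀ _ h2]; exact hl
  · intro N hN
    rw [Gc, h1]
    exact G_approx (chi d D) (chi_abs_le d D) B l hB0 hl2 N hN

lemma LL_two_ne (d D : ℤ) : LL (chi d D) 2 ≠ 0 :=
  left_ne_zero_of_mul_eq_one (LL_moebius (chi d D) (chi_abs_le d D))

lemma LL_two_pos (d D : ℤ) : 0 < LL (chi d D) 2 :=
  lt_of_le_of_ne (LL_nonneg (chi d D) (chi_abs_le d D) 2 (by norm_num)) (LL_two_ne d D).symm

/-- The constant from `ζ` and `L(χ_d)`. -/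
noncomputable def Ac (d : ℤ) : ℝ :=
  limUnder (𝓝[>] 1) (fun s => (s - 1) * LL (chi d 1) s) / LL (chi d 1) 2 * Gc d d

lemma Gc_d_nonneg (d : ℤ) (hsq : Squarefree d) (hd1 : d ≠ 1) : 0 ≤ Gc d d := by
  have h := (Gc_spec d d _ (chi_d_bound d hsq hd1)).1
  have h2 : 0 ≤ Gc d d * LL (chi d d) 2 := by
    refine ge_of_tendsto h ?_
    filter_upwards [self_mem_nhdsWithin] with s hs
    exact LL_nonneg _ (chi_abs_le d d) s hs
  exact nonneg_of_mul_nonneg_left h2 (LL_two_pos d d)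

lemma Ac_nonneg (d : ℤ) (hsq : Squarefree d) (hd1 : d ≠ 1) : 0 ≤ Ac d := by
  obtain ⟨α, hα⟩ := chi_one_limit d hsq.ne_zero
  unfold Ac
  rw [hα.limUnder_eq]
  refine mul_nonneg (div_nonneg ?_ (LL_two_pos d 1).le) (Gc_d_nonneg d hsq hd1)
  refine ge_of_tendsto hα ?_
  filter_upwards [self_mem_nhdsWithin] with s hs
  have hs : 1 < s := hs
  exact mul_nonneg (by linarith) (LL_nonneg _ (chi_abs_le d 1) s hs)

variable {M : Type*} [Field M] [NumberField M] {d Δ : ℤ} {c s : M}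
variable {M' : Type*} [Field M'] [NumberField M'] {Δ' : ℤ} {c' s' : M'}

/-- The factor depending only on the class. -/
noncomputable def kap (d Δ : ℤ) (M : Type*) [Field M] [NumberField M] : ℝ :=
  arch d Δ * (|(Δ : ℝ)| / Real.sqrt |(discr M : ℝ)|) * (badf d M 2 / badf d M 1)

lemma Biq.kap_pos (h : Biq d Δ M c s) : 0 < kap d Δ M := by
  have h1 : (0 : ℝ) < |(discr M : ℝ)| := abs_pos.mpr (by exact_mod_cast discr_ne_zero M)
  have h2 : (0 : ℝ) < |(Δ : ℝ)| := abs_pos.mpr (by have := h.D_ne; exact_mod_cast this)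
  exact mul_pos (mul_pos (arch_pos d Δ) (div_pos h2 (Real.sqrt_pos.mpr h1)))
    (div_pos (badf_pos M 2 (by norm_num)) (badf_pos M 1 (by norm_num)))

lemma Biq.kap_transfer (h : Biq d Δ M c s) (h' : Biq d Δ' M' c' s') (k : ℤ) (hk : Δ' = Δ + (8 * d) ^ 5 * k)
    (hs : 0 < Δ ↔ 0 < Δ') : kap d Δ M = kap d Δ' M' := by
  have e1 : arch d Δ = arch d Δ' := by unfold arch; simp only [hs]
  have e2 : ∀ σ, badf d M σ = badf d M' σ := by
    intro σ
    refine Finset.prod_congr rfl (fun p hp => ?_)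
    refine h.locf_transfer h' k hk p (Nat.prime_of_mem_primeFactors hp) ?_ σ
    have := Nat.dvd_of_mem_primeFactors hp
    rw [Int.natCast_dvd]
    simpa [Int.natAbs_mul] using this
  have e3 : |(Δ : ℝ)| / Real.sqrt |(discr M : ℝ)| = |(Δ' : ℝ)| / Real.sqrt |(discr M' : ℝ)| := by
    have h1 : (0 : ℝ) < |(discr M : ℝ)| := abs_pos.mpr (by exact_mod_cast discr_ne_zero M)
    have h2 : (0 : ℝ) < |(discr M' : ℝ)| := abs_pos.mpr (by exact_mod_cast discr_ne_zero M')
    rw [div_eq_div_iff (Real.sqrt_pos.mpr h1).ne' (Real.sqrt_pos.mpr h2).ne',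
      ← Real.sqrt_sq (abs_nonneg (Δ : ℝ)), ← Real.sqrt_sq (abs_nonneg (Δ' : ℝ)),
      ← Real.sqrt_mul (by positivity), ← Real.sqrt_mul (by positivity), sq_abs, sq_abs]
    congr 1
    have h3 := h.discr_transfer h' k hk
    have h4 : (discr M : ℝ) * (Δ' : ℝ) ^ 2 = discr M' * (Δ : ℝ) ^ 2 := by exact_mod_cast h3
    have h5 := congrArg abs h4
    rw [abs_mul, abs_mul, abs_of_nonneg (sq_nonneg (Δ' : ℝ)), abs_of_nonneg (sq_nonneg (Δ : ℝ))] at h5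
    linarith
  unfold kap
  rw [e1, e2, e2, e3]

lemma Biq.residue_tendsto (h : Biq d Δ M c s) :
    Tendsto (fun σ => (σ - 1) * (LL (chi d 1) σ * LL (chi d d) σ * LL (chi d Δ) σ * LL (chi d (d * Δ)) σ))
      (𝓝[>] 1) (𝓝 (dedekindZeta_residue M * badf d M 1)) := by
  have h1 := (ZZ_tendsto M).mul (((badf_cont (d := d) M).tendsto 1).mono_left (nhdsWithin_le_nhds (s := Set.Ioi (1 : ℝ))))
  refine h1.congr' ?_
  filter_upwards [self_mem_nhdsWithin] with σ hσ
  rw [← h.ZZ_eq σ hσ]; ring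

lemma Biq.schanuel_unique (h : Biq d Δ M c s) (h' : Biq d Δ M' c' s') : schanuel M = schanuel M' := by
  have hk := h.kap_transfer h' 0 (by ring) Iff.rfl
  have hr := tendsto_nhds_unique h.residue_tendsto h'.residue_tendsto
  have hz := (h.ZZ_eq 2 (by norm_num)).trans (h'.ZZ_eq 2 (by norm_num)).symm
  have hD : (0 : ℝ) < |(Δ : ℝ)| := abs_pos.mpr (by have := h.D_ne; exact_mod_cast this)
  have key : ∀ (N : Type _) [Field N] [NumberField N] (x y : N), Biq d Δ N x y →
      schanuel N * |(Δ : ℝ)| = kap d Δ N * (dedekindZeta_residue N * badf d N 1) / (ZZ N 2 * badf d N 2) := by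
    intro N _ _ x y hN
    have b1 := (badf_pos (d := d) N 1 (by norm_num)).ne'
    have b2 := (badf_pos (d := d) N 2 (by norm_num)).ne'
    have b3 := (ZZ_pos N 2 (by norm_num)).ne'
    rw [hN.schanuel_eq, kap]
    field_simp
  have key' : ∀ (N : Type _) [Field N] [NumberField N] (x y : N), Biq d Δ N x y →
      schanuel N * |(Δ : ℝ)| = kap d Δ N * (dedekindZeta_residue N * badf d N 1) / (ZZ N 2 * badf d N 2) := by
    intro N _ _ x y hN
    have b1 := (badf_pos (d := d) N 1 (by norm_num)).ne'
    have b2 := (badf_pos (d := d) N 2 (by norm_num)).ne'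
    have b3 := (ZZ_pos N 2 (by norm_num)).ne'
    rw [hN.schanuel_eq, kap]
    field_simp
  have a1 := key M c s h
  have a2 := key' M' c' s' h'
  rw [hk, hr, hz, ← a2] at a1
  exact mul_right_cancel₀ hD.ne' a1

lemma Biq.fund_pos (h : Biq d Δ M c s) (hd1 : d ≠ 1) (hl : 8 * d.natAbs < Δ.natAbs) :
    schanuel M * |(Δ : ℝ)| = kap d Δ M * (Ac d * (Gc d Δ * Gc d (d * Δ))) ∧ 0 < Ac d := by
  have hB := chi_Delta_bound d Δ h.d_ne_zero h.fund hl
  have t1 := (Gc_spec d Δ _ (fun n => (hB n).1)).1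
  have t2 := (Gc_spec d (d * Δ) _ (fun n => (hB n).2)).1
  have t3 := (Gc_spec d d _ (chi_d_bound d h.sqd hd1)).1
  obtain ⟨α, hα⟩ := chi_one_limit d h.d_ne_zero
  have t := ((hα.mul t3).mul t1).mul t2
  have hr := tendsto_nhds_unique h.residue_tendsto (t.congr (fun σ => by ring))
  have hz := h.ZZ_eq 2 (by norm_num)
  have n1 := LL_two_ne d 1
  have n2 := LL_two_ne d d
  have n3 := LL_two_ne d Δ
  have n4 := LL_two_ne d (d * Δ)
  have b1 := (badf_pos (d := d) M 1 (by norm_num))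
  have b2 := (badf_pos (d := d) M 2 (by norm_num))
  have b3 := (ZZ_pos M 2 (by norm_num))
  have hA : Ac d = α / LL (chi d 1) 2 * Gc d d := by rw [Ac, hα.limUnder_eq]
  constructor
  · have e1 : dedekindZeta_residue M / ZZ M 2 = badf d M 2 / badf d M 1 * (Ac d * (Gc d Δ * Gc d (d * Δ))) := by
      have hz' : badf d M 2 = LL (chi d 1) 2 * LL (chi d d) 2 * LL (chi d Δ) 2 * LL (chi d (d * Δ)) 2 / ZZ M 2 := by
        rw [← hz]; field_simp
      have hr' : dedekindZeta_residue M = α * (Gc d d * LL (chi d d) 2) * (Gc d Δ * LL (chi d Δ) 2) *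
        (Gc d (d * Δ) * LL (chi d (d * Δ)) 2) / badf d M 1 := by rw [← hr]; field_simp
      rw [hr', hz', hA]
      field_simp
    have e2 : schanuel M * |(Δ : ℝ)| = arch d Δ * (|(Δ : ℝ)| / Real.sqrt |(discr M : ℝ)|) *
        (dedekindZeta_residue M / ZZ M 2) := by
      rw [h.schanuel_eq]; ring
    rw [e2, e1, kap]; ring
  · refine lt_of_le_of_ne (Ac_nonneg d h.sqd hd1) (fun h0 => ?_)
    have hres : 0 < dedekindZeta_residue M * badf d M 1 := mul_pos (dedekindZeta_residue_pos M) b1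
    rw [hr] at hres
    have h1 : α * Gc d d = 0 := by
      rw [hA] at h0
      field_simp at h0
      linarith
    have : α * (Gc d d * LL (chi d d) 2) * (Gc d Δ * LL (chi d Δ) 2) * (Gc d (d * Δ) * LL (chi d (d * Δ)) 2) =
      (α * Gc d d) * (LL (chi d d) 2 * (Gc d Δ * LL (chi d Δ) 2) * (Gc d (d * Δ) * LL (chi d (d * Δ)) 2)) := by ring
    rw [this, h1, zero_mul] at hres
    exact lt_irrefl _ hres

end Formula

section Sieve

open Filter Topology Finset

open scoped Classical in
/-- indicator of not being divisible by the square of a prime not dividing `Q` -/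
noncomputable def sqs (Q j : ℕ) : ℝ := if ∀ p : ℕ, p.Prime → ¬ p ∣ Q → ¬ p ^ 2 ∣ j then 1 else 0

lemma sqs_formula (Q j Z : ℕ) (hj : 1 ≤ j) (hZ : j ≤ Z) :
    sqs Q j = ∑ l ∈ (Icc 1 Z).filter (fun l => Nat.Coprime l Q),
      (ArithmeticFunction.moebius l : ℝ) * (if l ^ 2 ∣ j then 1 else 0) := by
  classical
  set S := (Icc 1 Z).filter (fun l => Nat.Coprime l Q ∧ l ^ 2 ∣ j) with hS
  have memS : ∀ l, l ∈ S ↔ Nat.Coprime l Q ∧ l ^ 2 ∣ j := by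
    intro l
    rw [hS, mem_filter]
    refine ⟨fun h => h.2, fun h => ⟨?_, h⟩⟩
    have h1 : l ^ 2 ≤ j := Nat.le_of_dvd (by omega) h.2
    have h2 : l ≠ 0 := by rintro rfl; have := h.2; simp at this; omega
    rw [mem_Icc]
    constructor
    · omega
    · nlinarith [Nat.pos_of_ne_zero h2]
  set F := S.lcm id with hF
  have hP : ∀ T : Finset ℕ, T ⊆ S → T.lcm id ∈ S := by
    intro T
    induction T using Finset.induction_on with
    | empty => intro _; rw [memS]; simp
    | insert a T ha ih =>
      intro hT
      have h1 := (memS _).mp (hT (mem_insert_self a T))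
      have h2 := (memS _).mp (ih (fun x hx => hT (mem_insert_of_mem hx)))
      rw [Finset.lcm_insert, memS]
      simp only [id]
      constructor
      · exact Nat.Coprime.coprime_dvd_left (Nat.lcm_dvd_mul _ _) (h1.1.mul_left h2.1)
      · have : lcm a (T.lcm id) = Nat.lcm a (T.lcm id) := rfl
        rw [this, ← Nat.pow_lcm_pow]
        exact Nat.lcm_dvd h1.2 h2.2
  have hFS := hP S subset_rfl
  have hFS' := (memS _).mp hFS
  have hF0 : F ≠ 0 := by
    have := (mem_Icc.mp (mem_filter.mp hFS).1).1
    omega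
  have hdiv : S = F.divisors := by
    ext l
    rw [Nat.mem_divisors]
    constructor
    · intro h; exact ⟨Finset.dvd_lcm (f := id) h, hF0⟩
    · rintro ⟨h, -⟩
      rw [memS]
      exact ⟨hFS'.1.coprime_dvd_left h, (pow_dvd_pow_of_dvd h 2).trans hFS'.2⟩
  have h1 : ∑ l ∈ (Icc 1 Z).filter (fun l => Nat.Coprime l Q),
      (ArithmeticFunction.moebius l : ℝ) * (if l ^ 2 ∣ j then 1 else 0) = ∑ l ∈ S, (ArithmeticFunction.moebius l : ℝ) := by
    simp only [mul_ite, mul_one, mul_zero]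
    rw [← sum_filter, filter_filter]
  have h2 : ∑ l ∈ F.divisors, (ArithmeticFunction.moebius l : ℝ) = if F = 1 then 1 else 0 := by
    have := congrArg (fun g : ArithmeticFunction ℤ => g F) ArithmeticFunction.moebius_mul_coe_zeta
    simp only [ArithmeticFunction.coe_mul_zeta_apply, ArithmeticFunction.one_apply] at this
    have h3 := congrArg (Int.cast : ℤ → ℝ) this
    push_cast at h3
    rw [h3]
  rw [h1, hdiv, h2]
  unfold sqs
  congr 1
  rw [eq_iff_iff]
  constructor
  · intro h
    by_contra hne
    obtain ⟨p, hp, hpF⟩ := Nat.exists_prime_and_dvd hne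
    have hpS : p ∈ S := by rw [hdiv, Nat.mem_divisors]; exact ⟨hpF, hF0⟩
    have := (memS p).mp hpS
    exact h p hp (hp.coprime_iff_not_dvd.mp this.1) this.2
  · intro h p hp hpQ hpj
    have hpS : p ∈ S := (memS p).mpr ⟨hp.coprime_iff_not_dvd.mpr hpQ, hpj⟩
    rw [hdiv, h] at hpS
    simp at hpS
    exact hp.one_lt.ne' hpS

lemma sum_inv_sq (L Z : ℕ) (hL : 1 ≤ L) (hLZ : L ≤ Z) : ∑ l ∈ Ioc L Z, (1 : ℝ) / (l : ℝ) ^ 2 ≤ 1 / L := by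
  have key : ∑ l ∈ Ioc L Z, (1 : ℝ) / (l : ℝ) ^ 2 ≤ 1 / L - 1 / Z := by
    induction Z, hLZ using Nat.le_induction with
    | base => simp
    | succ m hm ih =>
      rw [Finset.sum_Ioc_succ_top hm]
      have hm0 : (0 : ℝ) < m := by exact_mod_cast (by omega : 0 < m)
      have : (1 : ℝ) / ((m + 1 : ℕ) : ℝ) ^ 2 ≤ 1 / m - 1 / ((m + 1 : ℕ) : ℝ) := by
        push_cast
        rw [div_sub_div _ _ hm0.ne' (by positivity), div_le_div_iff₀ (by positivity) (by positivity)]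
        nlinarith
      linarith
  have : (0 : ℝ) ≤ 1 / Z := by positivity
  linarith

/-- the weight -/
noncomputable def ww (Q m : ℕ) : ℝ :=
  (m.totient : ℝ) / m * LL (fun l => if Nat.Coprime l Q then
    (if Nat.Coprime l m then (ArithmeticFunction.moebius l : ℝ) else 0) else 0) 2

lemma mu_abs (l : ℕ) : |(ArithmeticFunction.moebius l : ℝ)| ≤ 1 := by
  exact_mod_cast ArithmeticFunction.abs_moebius_le_one (n := l)

/-- inner sum, with `l²` dividing -/
noncomputable def DD (Q m : ℕ) (c : ZMod Q) (X l : ℕ) : ℝ :=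
  ∑ j ∈ (Icc 1 X).filter (fun j : ℕ => (j : ZMod Q) = c), (jacobiSym (j : ℤ) m : ℝ) * (if l ^ 2 ∣ j then 1 else 0)

lemma DD_trivial (Q m : ℕ) (c : ZMod Q) (X l : ℕ) : |DD Q m c X l| ≤ X * (1 / (l : ℝ) ^ 2) := by
  have h1 : |DD Q m c X l| ≤ ∑ j ∈ Ioc 0 X, (if l ^ 2 ∣ j then (1 : ℝ) else 0) := by
    unfold DD
    refine (abs_sum_le_sum_abs _ _).trans ?_
    have hI : Ioc 0 X = Icc 1 X := by ext; simp; omega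
    rw [hI]
    refine le_trans (sum_le_sum_of_subset_of_nonneg (filter_subset _ _) (fun _ _ _ => abs_nonneg _)) ?_
    refine sum_le_sum (fun j _ => ?_)
    rw [abs_mul]
    refine (mul_le_of_le_one_left (abs_nonneg _) (jac_abs_le _ _)).trans ?_
    split_ifs <;> simp
  refine h1.trans ?_
  rw [Finset.sum_boole, Nat.Ioc_filter_dvd_card_eq_div]
  have := Nat.cast_div_le (α := ℝ) (m := X) (n := l ^ 2)
  push_cast at this
  rw [mul_one_div]; exact this

lemma DD_main (Q m : ℕ) (hQ : 0 < Q) (hodd : Odd m) (hcop : Nat.Coprime Q m) (c : ZMod Q) (X l : ℕ)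
    (hl : Nat.Coprime l Q) (hl1 : 1 ≤ l) :
    |DD Q m c X l - (if Nat.Coprime l m then (if IsSquare m then (X : ℝ) / Q * ((m.totient : ℝ) / m) else 0)
      * (1 / (l : ℝ) ^ 2) else 0)| ≤ 3 * (Real.sqrt m * (1 + Real.log m)) := by
  classical
  have hl2 : 0 < l ^ 2 := by positivity
  have hm1 : (1 : ℝ) ≤ m := by exact_mod_cast hodd.pos
  have hE : 1 ≤ Real.sqrt m * (1 + Real.log m) := by
    have a := Real.one_le_sqrt.mpr hm1
    have b := Real.log_nonneg hm1
    nlinarith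
  let u := ZMod.unitOfCoprime l hl
  have hre : DD Q m c X l = ∑ k ∈ (Icc 1 (X / l ^ 2)).filter (fun k : ℕ => (k : ZMod Q) = (↑(u⁻¹ ^ 2) : ZMod Q) * c),
      (jacobiSym ((l ^ 2 * k : ℕ) : ℤ) m : ℝ) := by
    unfold DD
    simp only [mul_ite, mul_one, mul_zero]
    rw [← sum_filter, filter_filter]
    symm
    refine Finset.sum_bij (fun k _ => l ^ 2 * k) ?_ ?_ ?_ ?_
    · intro k hk
      rw [mem_filter, mem_Icc] at hk ⊢
      obtain ⟨⟨h1, h2⟩, h3⟩ := hk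
      refine ⟨⟨Nat.mul_pos hl2 h1, ?_⟩, ?_, dvd_mul_right _ _⟩
      · have := (Nat.le_div_iff_mul_le hl2).mp h2
        rw [mul_comm]; exact this
      · push_cast
        rw [h3, ← mul_assoc]
        have : (l : ZMod Q) = (u : ZMod Q) := (ZMod.coe_unitOfCoprime l hl).symm
        rw [this, ← Units.val_pow_eq_pow_val, ← Units.val_mul, ← mul_pow, mul_inv_cancel, one_pow, Units.val_one, one_mul]
    · intro a _ b _ hab
      exact Nat.eq_of_mul_eq_mul_left hl2 hab
    · intro j hj
      rw [mem_filter, mem_Icc] at hj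
      obtain ⟨⟨h1, h2⟩, h3, k, rfl⟩ := hj
      refine ⟨k, ?_, rfl⟩
      rw [mem_filter, mem_Icc]
      refine ⟨⟨Nat.pos_of_mul_pos_left h1, ?_⟩, ?_⟩
      · rw [Nat.le_div_iff_mul_le hl2, mul_comm]; exact h2
      · rw [← h3]; push_cast
        have : (l : ZMod Q) = (u : ZMod Q) := (ZMod.coe_unitOfCoprime l hl).symm
        rw [this, ← mul_assoc, ← Units.val_pow_eq_pow_val, ← Units.val_pow_eq_pow_val, ← Units.val_mul, ← mul_pow,
          inv_mul_cancel, one_pow, Units.val_one, one_mul]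
    · intro k _; rfl
  have hjac : ∀ k : ℕ, (jacobiSym ((l ^ 2 * k : ℕ) : ℤ) m : ℝ) = (if Nat.Coprime l m then 1 else 0) * (jacobiSym (k : ℤ) m : ℝ) := by
    intro k
    push_cast
    rw [jacobiSym.mul_left]
    split_ifs with h
    · rw [jacobiSym.sq_one' (by simpa [Int.gcd_natCast_natCast] using h)]; push_cast; ring
    · rw [jacobiSym.pow_left]
      have : jacobiSym (l : ℤ) m = 0 := by
        rw [jacobiSym.eq_zero_iff]
        exact ⟨hodd.pos.ne', by simpa [Int.gcd_natCast_natCast] using h⟩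
      rw [this]; simp
  rw [hre]
  simp only [hjac]
  rw [← mul_sum]
  by_cases hlm : Nat.Coprime l m
  · rw [if_pos hlm, if_pos hlm, one_mul]
    have h1 := jac_ap Q m hQ hodd hcop ((↑(u⁻¹ ^ 2) : ZMod Q) * c) (X / l ^ 2)
    have h2 : |(if IsSquare m then (((X / l ^ 2 : ℕ) : ℝ)) / Q * ((m.totient : ℝ) / m) else 0) -
        (if IsSquare m then (X : ℝ) / Q * ((m.totient : ℝ) / m) else 0) * (1 / (l : ℝ) ^ 2)| ≤ 1 := by
      split_ifs
      · have hQ1 : (1 : ℝ) ≤ Q := by exact_mod_cast hQ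
        have ht : (m.totient : ℝ) / m ≤ 1 := by
          rw [div_le_one (by linarith)]; exact_mod_cast Nat.totient_le m
        have ht0 : 0 ≤ (m.totient : ℝ) / m := by positivity
        have e : (((X / l ^ 2 : ℕ) : ℝ)) / Q * ((m.totient : ℝ) / m) - (X : ℝ) / Q * ((m.totient : ℝ) / m) * (1 / (l : ℝ) ^ 2)
          = -(((X : ℝ) / (l : ℝ) ^ 2 - ((X / l ^ 2 : ℕ) : ℝ)) * (1 / Q * ((m.totient : ℝ) / m))) := by
          field_simp; ring
        rw [e, abs_neg]
        have f1 : ((X / l ^ 2 : ℕ) : ℝ) ≤ (X : ℝ) / (l : ℝ) ^ 2 := by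
          have := Nat.cast_div_le (α := ℝ) (m := X) (n := l ^ 2)
          push_cast at this; exact this
        have f2 : (X : ℝ) / (l : ℝ) ^ 2 ≤ ((X / l ^ 2 : ℕ) : ℝ) + 1 := by
          rw [div_le_iff₀ (by positivity)]
          have := (Nat.lt_mul_div_succ X hl2).le
          have h : (X : ℝ) ≤ ((l ^ 2 * (X / l ^ 2 + 1) : ℕ) : ℝ) := by exact_mod_cast this
          rw [Nat.cast_mul, Nat.cast_add, Nat.cast_one, Nat.cast_pow, mul_comm] at h
          exact h
        have f3 : 1 / (Q : ℝ) * ((m.totient : ℝ) / m) ≤ 1 :=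
          mul_le_one₀ ((div_le_one (by linarith)).mpr hQ1) ht0 ht
        rw [abs_of_nonneg (mul_nonneg (by linarith) (by positivity))]
        exact mul_le_one₀ (by linarith) (by positivity) f3
      · simp
    have h3 := abs_sub_le (∑ k ∈ (Icc 1 (X / l ^ 2)).filter (fun k : ℕ => (k : ZMod Q) = (↑(u⁻¹ ^ 2) : ZMod Q) * c), (jacobiSym (k : ℤ) m : ℝ))
      (if IsSquare m then (((X / l ^ 2 : ℕ) : ℝ)) / Q * ((m.totient : ℝ) / m) else 0)
      ((if IsSquare m then (X : ℝ) / Q * ((m.totient : ℝ) / m) else 0) * (1 / (l : ℝ) ^ 2))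
    linarith
  · rw [if_neg hlm, if_neg hlm]
    simp only [zero_mul, sub_zero, abs_zero]
    linarith

/-- The sieved sum of Jacobi symbols in a progression. -/
lemma sieve_sum (Q m : ℕ) (hQ : 0 < Q) (hodd : Odd m) (hcop : Nat.Coprime Q m) (c : ZMod Q) (X L : ℕ) (hL : 1 ≤ L) :
    |∑ j ∈ (Icc 1 X).filter (fun j : ℕ => (j : ZMod Q) = c), sqs Q j * (jacobiSym (j : ℤ) m : ℝ)
      - (if IsSquare m then (X : ℝ) / Q * ww Q m else 0)| ≤ 3 * L * (Real.sqrt m * (1 + Real.log m)) + 2 * (X / L) := by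
  classical
  have hLR : (0 : ℝ) < L := by exact_mod_cast hL
  have hm1 : (1 : ℝ) ≤ m := by exact_mod_cast hodd.pos
  set E := Real.sqrt m * (1 + Real.log m) with hE
  have hE0 : 0 ≤ E := mul_nonneg (Real.sqrt_nonneg _) (by linarith [Real.log_nonneg hm1])
  set a : ℕ → ℝ := fun l => if Nat.Coprime l Q then (ArithmeticFunction.moebius l : ℝ) else 0 with ha
  have ha1 : ∀ l, |a l| ≤ 1 := by
    intro l; simp only [ha]; split_ifs
    · exact mu_abs l
    · simp
  have e1 : ∑ j ∈ (Icc 1 X).filter (fun j : ℕ => (j : ZMod Q) = c), sqs Q j * (jacobiSym (j : ℤ) m : ℝ)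
      = ∑ l ∈ Icc 1 (L + X), a l * DD Q m c X l := by
    have : ∀ j ∈ (Icc 1 X).filter (fun j : ℕ => (j : ZMod Q) = c), sqs Q j * (jacobiSym (j : ℤ) m : ℝ)
        = ∑ l ∈ Icc 1 (L + X), a l * ((jacobiSym (j : ℤ) m : ℝ) * (if l ^ 2 ∣ j then 1 else 0)) := by
      intro j hj
      have hj' := mem_Icc.mp (mem_filter.mp hj).1
      rw [sqs_formula Q j (L + X) hj'.1 (by omega), sum_filter, sum_mul]
      refine sum_congr rfl (fun l _ => ?_)
      simp only [ha]; split_ifs <;> ring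
    rw [sum_congr rfl this, sum_comm]
    refine sum_congr rfl (fun l _ => ?_)
    rw [DD, mul_sum]
  have e2 : ∑ l ∈ Icc 1 (L + X), a l * DD Q m c X l = ∑ l ∈ Icc 1 L, a l * DD Q m c X l + ∑ l ∈ Ioc L (L + X), a l * DD Q m c X l := by
    rw [← sum_union]
    · congr 1; ext x; simp only [mem_union, mem_Icc, mem_Ioc]; omega
    · rw [disjoint_left]; intro x hx hx'; rw [mem_Icc] at hx; rw [mem_Ioc] at hx'; omega
  set Y : ℝ := (if IsSquare m then (X : ℝ) / Q * ((m.totient : ℝ) / m) else 0) with hY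
  have hYb : |Y| ≤ X := by
    simp only [hY]; split_ifs
    · have hQ1 : (1 : ℝ) ≤ Q := by exact_mod_cast hQ
      have ht : (m.totient : ℝ) / m ≤ 1 := by
        rw [div_le_one (by linarith)]; exact_mod_cast Nat.totient_le m
      rw [abs_of_nonneg (by positivity)]
      refine (mul_le_of_le_one_right (by positivity) ht).trans ?_
      exact div_le_self (by positivity) hQ1
    · simp
  set g : ℕ → ℝ := fun l => if Nat.Coprime l Q then
    (if Nat.Coprime l m then (ArithmeticFunction.moebius l : ℝ) else 0) else 0 with hg
  have hg1 : ∀ l, |g l| ≤ 1 := by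
    intro l; simp only [hg]; split_ifs
    · exact mu_abs l
    · simp
    · simp
  have e3 : (if IsSquare m then (X : ℝ) / Q * ww Q m else 0) = Y * LL g 2 := by
    simp only [hY, ww]; split_ifs <;> ring
  have b1 : |∑ l ∈ Icc 1 L, a l * DD Q m c X l - Y * ∑ l ∈ Icc 1 L, g l * (l : ℝ) ^ (-2 : ℝ)| ≤ L * (3 * E) := by
    rw [mul_sum, ← sum_sub_distrib]
    refine (abs_sum_le_sum_abs _ _).trans ?_
    have : ∀ l ∈ Icc 1 L, |a l * DD Q m c X l - Y * (g l * (l : ℝ) ^ (-2 : ℝ))| ≤ 3 * E := by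
      intro l hl
      have hl1 := (mem_Icc.mp hl).1
      by_cases hlQ : Nat.Coprime l Q
      · have h := DD_main Q m hQ hodd hcop c X l hlQ hl1
        have e : a l * DD Q m c X l - Y * (g l * (l : ℝ) ^ (-2 : ℝ)) = a l * (DD Q m c X l - (if Nat.Coprime l m then Y
            * (1 / (l : ℝ) ^ 2) else 0)) := by
          rw [Real.rpow_neg (by positivity), show (2 : ℝ) = ((2 : ℕ) : ℝ) by norm_num, Real.rpow_natCast]
          simp only [ha, hg, if_pos hlQ]; split_ifs <;> ring
        rw [e, abs_mul]
        exact (mul_le_of_le_one_left (abs_nonneg _) (ha1 l)).trans h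
      · simp only [ha, hg, if_neg hlQ]
        simp only [zero_mul, mul_zero, sub_zero, abs_zero]
        positivity
    refine (sum_le_sum this).trans ?_
    simp
  have b2 : |∑ l ∈ Ioc L (L + X), a l * DD Q m c X l| ≤ X / L := by
    refine (abs_sum_le_sum_abs _ _).trans ?_
    have : ∀ l ∈ Ioc L (L + X), |a l * DD Q m c X l| ≤ X * (1 / (l : ℝ) ^ 2) := by
      intro l _
      rw [abs_mul]
      exact (mul_le_of_le_one_left (abs_nonneg _) (ha1 l)).trans (DD_trivial Q m c X l)
    refine (sum_le_sum this).trans ?_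
    rw [← mul_sum, div_eq_mul_one_div]
    exact mul_le_mul_of_nonneg_left (sum_inv_sq L (L + X) hL (by omega)) (by positivity)
  have b3 : |Y * (LL g 2 - ∑ l ∈ Icc 1 L, g l * (l : ℝ) ^ (-2 : ℝ))| ≤ X / L := by
    rw [abs_mul, div_eq_mul_one_div]
    exact mul_le_mul hYb (tail_two g hg1 L hL) (abs_nonneg _) (by positivity)
  rw [e1, e2, e3]
  rw [abs_le] at *
  constructor <;> linarith [b1.1, b1.2, b2.1, b2.2, b3.1, b3.2]

end Sieve

section SingSeries

open Filter Topology Finset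

/-- nonnegativity of the local factor -/
lemma local_nonneg (p : ℕ) (hp : p.Prime) (v : ℕ) (e : ℝ) (he : e = -1 ∨ e = 0 ∨ e = 1) :
    0 ≤ ∑ i ∈ range (2 * v + 1), ((p ^ i).totient : ℝ) * (((p ^ (2 * v - i)).totient : ℝ) * e ^ (2 * v - i)) := by
  rcases he with rfl | rfl | rfl
  · rcases Nat.eq_zero_or_pos v with rfl | hv
    · simp
    obtain ⟨w, rfl⟩ : ∃ w, v = w + 1 := ⟨v - 1, by omega⟩
    have hp1 : (1 : ℝ) ≤ p := by exact_mod_cast hp.one_lt.le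
    have hphi : ∀ i, ((p ^ (i + 1)).totient : ℝ) = (p : ℝ) ^ i * (p - 1) := by
      intro i
      rw [Nat.totient_prime_pow_succ hp]
      push_cast [hp.one_lt.le]; ring
    rw [sum_range_succ, show 2 * (w + 1) = (2 * w + 1) + 1 by ring, sum_range_succ']
    have hmid : ∀ i ∈ range (2 * w + 1), ((p ^ (i + 1)).totient : ℝ) * (((p ^ (2 * w + 1 + 1 - (i + 1))).totient : ℝ)
        * (-1 : ℝ) ^ (2 * w + 1 + 1 - (i + 1))) = -((p : ℝ) ^ (2 * w) * (p - 1) ^ 2) * (-1) ^ i := by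
      intro i hi
      rw [mem_range] at hi
      have e1 : 2 * w + 1 + 1 - (i + 1) = (2 * w - i) + 1 := by omega
      rw [e1, hphi, hphi]
      have e2 : (p : ℝ) ^ (2 * w) = p ^ i * p ^ (2 * w - i) := by rw [← pow_add]; congr 1; omega
      have e3 : (-1 : ℝ) ^ (2 * w - i) = (-1) ^ i := by
        have : (-1 : ℝ) ^ (2 * w - i) * (-1) ^ i = 1 := by
          rw [← pow_add, show 2 * w - i + i = 2 * w by omega, pow_mul]; simp
        rcases neg_one_pow_eq_or ℝ i with h | h <;> rw [h] at this ⊢ <;> linarith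
      rw [e2, pow_succ (-1 : ℝ), e3]; ring
    rw [sum_congr rfl hmid, ← mul_sum, neg_one_geom_sum, if_neg (by simp)]
    rw [show 2 * w + 1 + 1 - 0 = 2 * w + 1 + 1 by omega, Nat.sub_self, pow_zero, Nat.totient_one, hphi]
    have e4 : (-1 : ℝ) ^ (2 * w + 1 + 1) = 1 := by
      rw [show 2 * w + 1 + 1 = 2 * (w + 1) by ring, pow_mul]; simp
    rw [e4]
    have : 0 ≤ (p : ℝ) ^ (2 * w) * ((p - 1) * (p + 1)) := by
      have : (0 : ℝ) ≤ p - 1 := by linarith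
      positivity
    rw [pow_succ (p : ℝ) (2 * w)]
    push_cast
    nlinarith
  · exact sum_nonneg fun i _ => by positivity
  · exact sum_nonneg fun i _ => by positivity

/-- `∑_{ab=n} φ(a)φ(b)ε(b) ≥ 0` for square `n`. -/
lemma conv_nonneg (ε : ℕ →*₀ ℝ) (hε : ∀ k, ε k = -1 ∨ ε k = 0 ∨ ε k = 1) (k : ℕ) (hk : k ≠ 0) :
    0 ≤ ∑ x ∈ (k ^ 2).divisorsAntidiagonal, (x.1.totient : ℝ) * ((x.2.totient : ℝ) * ε x.2) := by
  let f : ArithmeticFunction ℝ := ⟨fun n => (n.totient : ℝ), by simp⟩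
  let g : ArithmeticFunction ℝ := ⟨fun n => (n.totient : ℝ) * ε n, by simp⟩
  have hf : f.IsMultiplicative := by
    refine ⟨by simp [f], fun {m n} h => ?_⟩
    simp [f, Nat.totient_mul h]
  have hg : g.IsMultiplicative := by
    refine ⟨by simp [g], fun {m n} h => ?_⟩
    simp only [g, ArithmeticFunction.coe_mk, Nat.totient_mul h, map_mul]
    push_cast; ring
  have hm := hf.mul hg
  have e : ∑ x ∈ (k ^ 2).divisorsAntidiagonal, (x.1.totient : ℝ) * ((x.2.totient : ℝ) * ε x.2) = (f * g) (k ^ 2) := by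
    rw [ArithmeticFunction.mul_apply]; rfl
  rw [e, hm.multiplicative_factorization _ (pow_ne_zero 2 hk)]
  refine Finset.prod_nonneg fun p hp => ?_
  have hpp : p.Prime := by
    rw [Nat.support_factorization] at hp
    exact Nat.prime_of_mem_primeFactors hp
  have e2 : (k ^ 2).factorization p = 2 * k.factorization p := by simp
  rw [e2]
  change 0 ≤ (f * g) (p ^ (2 * k.factorization p))
  rw [ArithmeticFunction.mul_apply]
  rw [Nat.sum_divisorsAntidiagonal (fun a b => f a * g b), Nat.sum_divisors_prime_pow hpp]
  refine (local_nonneg p hpp (k.factorization p) (ε p) (hε p)).trans_eq ?_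
  refine sum_congr rfl fun i hi => ?_
  rw [mem_range] at hi
  rw [Nat.pow_div (by omega) hpp.pos]
  simp [f, g]

lemma ww_LL (Q m : ℕ) (hQ : Even Q) :
    |LL (fun l => if Nat.Coprime l Q then
    (if Nat.Coprime l m then (ArithmeticFunction.moebius l : ℝ) else 0) else 0) 2 - 1| ≤ 1 / 2 := by
  have h := tail_two (fun l => if Nat.Coprime l Q then
    (if Nat.Coprime l m then (ArithmeticFunction.moebius l : ℝ) else 0) else 0)
    (fun k => by
      have := mu_abs k
      split_ifs <;> simp [this]) 2 (by norm_num)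
  have h2 : ¬ Nat.Coprime 2 Q := by
    rw [Nat.Prime.coprime_iff_not_dvd Nat.prime_two, not_not]
    exact hQ.two_dvd
  rw [show Icc 1 2 = {1, 2} from rfl, sum_pair (by norm_num), if_neg h2] at h
  simpa using h

lemma ww_nonneg (Q m : ℕ) (hQ : Even Q) : 0 ≤ ww Q m := by
  have := abs_le.mp (ww_LL Q m hQ)
  exact mul_nonneg (by positivity) (by linarith)

lemma ww_le (Q m : ℕ) (hQ : Even Q) : ww Q m ≤ 2 := by
  have := abs_le.mp (ww_LL Q m hQ)
  have h1 : (m.totient : ℝ) / m ≤ 1 := by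
    apply div_le_one_of_le₀ _ (by positivity)
    exact_mod_cast Nat.totient_le m
  unfold ww
  calc _ ≤ 1 * (2 : ℝ) := mul_le_mul h1 (by linarith) (by linarith) (by norm_num)
    _ = 2 := by norm_num

lemma ww_one (Q : ℕ) (hQ : Even Q) : 0 < ww Q 1 := by
  have := abs_le.mp (ww_LL Q 1 hQ)
  exact mul_pos (by norm_num) (by linarith)

lemma QQ_even (d : ℤ) : Even (QQ d) :=
  even_iff_two_dvd.mpr ((Dvd.intro (4 * d.natAbs) (by ring)).trans (dvd_QQ d))

/-- coefficients of the double sum -/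
noncomputable def kf (d : ℤ) (x : ℕ × ℕ) : ℝ :=
  ((x.1.totient : ℝ) / (x.1 : ℝ) ^ 2) * (chi d d x.2 * ((x.2.totient : ℝ) / (x.2 : ℝ) ^ 2))

lemma tot_div (a : ℕ) : (a.totient : ℝ) / (a : ℝ) ^ 2 ≤ 1 / a := by
  rcases Nat.eq_zero_or_pos a with rfl | ha
  · simp
  have : (0 : ℝ) < a := by exact_mod_cast ha
  have h2 : (a.totient : ℝ) ≤ a := by exact_mod_cast Nat.totient_le a
  rw [div_le_div_iff₀ (by positivity) this]
  nlinarith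

lemma kf_abs (d : ℤ) (x : ℕ × ℕ) : |kf d x| ≤ 1 / x.1 * (1 / x.2) := by
  unfold kf
  rw [abs_mul, abs_mul, abs_of_nonneg (by positivity : (0 : ℝ) ≤ (x.1.totient : ℝ) / (x.1 : ℝ) ^ 2),
    abs_of_nonneg (by positivity : (0 : ℝ) ≤ (x.2.totient : ℝ) / (x.2 : ℝ) ^ 2)]
  have h := mul_le_mul (chi_abs_le d d x.2) (tot_div x.2) (by positivity) zero_le_one
  rw [one_mul] at h
  exact mul_le_mul (tot_div x.1) h (by positivity) (by positivity)

open scoped Classical in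
/-- the weight attached to `m = ab` -/
noncomputable def WW (d : ℤ) (m : ℕ) : ℝ :=
  if Nat.Coprime m (8 * d.natAbs) ∧ IsSquare m then ww (QQ d) m else 0

lemma WW_nonneg (d : ℤ) (m : ℕ) : 0 ≤ WW d m := by
  unfold WW; split_ifs
  · exact ww_nonneg _ _ (QQ_even d)
  · exact le_rfl

lemma WW_le (d : ℤ) (m : ℕ) : WW d m ≤ 2 := by
  unfold WW; split_ifs
  · exact ww_le _ _ (QQ_even d)
  · norm_num

noncomputable def tt (d : ℤ) (x : ℕ × ℕ) : ℝ := kf d x * WW d (x.1 * x.2)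

/-- pairs with square product -/
def SP : Set (ℕ × ℕ) := {x | 0 < x.1 ∧ 0 < x.2 ∧ IsSquare (x.1 * x.2)}

noncomputable def rr (x : ℕ × ℕ) : ℝ := SP.indicator (fun x => ((x.1 : ℝ) * x.2) ^ (-(3 / 4) : ℝ)) x

lemma rr_nonneg (x : ℕ × ℕ) : 0 ≤ rr x := Set.indicator_nonneg (fun _ _ => by positivity) x

lemma SP_param (x : ℕ × ℕ) (hx : x ∈ SP) : ∃ y : ℕ × ℕ × ℕ, x = (y.1 * y.2.1 ^ 2, y.1 * y.2.2 ^ 2) := by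
  obtain ⟨a, b⟩ := x
  obtain ⟨ha, hb, z, hz⟩ := hx
  dsimp only at ha hb hz
  obtain ⟨g, a', b', hg, hcop, rfl, rfl⟩ := Nat.exists_coprime' (Nat.gcd_pos_of_pos_left b ha)
  have hgz : g ∣ z := by
    rw [← Nat.pow_dvd_pow_iff two_ne_zero]
    exact ⟨a' * b', by rw [sq z, ← hz]; ring⟩
  obtain ⟨w, rfl⟩ := hgz
  have h1 : a' * b' = w ^ 2 := by
    have : g ^ 2 * (a' * b') = g ^ 2 * w ^ 2 := by nlinarith
    exact Nat.eq_of_mul_eq_mul_left (by positivity) this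
  obtain ⟨u, hu⟩ := exists_eq_pow_of_mul_eq_pow (by rw [Nat.isUnit_iff]; exact hcop) h1
  obtain ⟨v, hv⟩ := exists_eq_pow_of_mul_eq_pow (by rw [Nat.isUnit_iff]; exact Nat.Coprime.symm hcop)
    ((mul_comm _ _).trans h1)
  exact ⟨(g, u, v), by rw [← hu, ← hv, mul_comm g, mul_comm g]⟩

lemma rr_summable : Summable rr := by
  have hF : Summable (fun n : ℕ => (n : ℝ) ^ (-(3 / 2) : ℝ)) := Real.summable_nat_rpow.mpr (by norm_num)
  have hF2 := hF.mul_of_nonneg hF (fun n => by positivity) (fun n => by positivity)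
  have hF3 := hF.mul_of_nonneg hF2 (fun n => by positivity) (fun n => by positivity)
  choose i hi using fun x : SP => SP_param x.1 x.2
  have hinj : Function.Injective i := by
    intro x y h
    apply Subtype.ext
    rw [hi x, hi y, h]
  have h := hF3.comp_injective hinj
  have hr : rr = SP.indicator (fun x => ((x.1 : ℝ) * x.2) ^ (-(3 / 4) : ℝ)) := rfl
  rw [hr, ← summable_subtype_iff_indicator]
  refine h.congr fun x => ?_
  have e1 : x.1.1 = (i x).1 * (i x).2.1 ^ 2 := congrArg Prod.fst (hi x)
  have e2 : x.1.2 = (i x).1 * (i x).2.2 ^ 2 := congrArg Prod.snd (hi x)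
  simp only [Function.comp]
  rw [e1, e2]
  push_cast
  rw [← Real.mul_rpow (by positivity) (by positivity), ← Real.mul_rpow (by positivity) (by positivity)]
  rw [show (-(3 / 2) : ℝ) = (2 : ℕ) * (-(3 / 4) : ℝ) by norm_num, Real.rpow_mul (by positivity), Real.rpow_natCast]
  congr 1
  ring

lemma tt_abs (d : ℤ) (x : ℕ × ℕ) (P : ℝ) (hP : 0 < P) (h : P ≤ (x.1 : ℝ) * x.2) :
    |tt d x| ≤ 2 * P ^ (-(1 / 4) : ℝ) * rr x := by
  by_cases hx : x ∈ SP
  · have hr : rr x = ((x.1 : ℝ) * x.2) ^ (-(3 / 4) : ℝ) := Set.indicator_of_mem hx _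
    have hab : (0 : ℝ) < (x.1 : ℝ) * x.2 := lt_of_lt_of_le hP h
    have h1 := kf_abs d x
    have e : (1 : ℝ) / x.1 * (1 / x.2) = ((x.1 : ℝ) * x.2) ^ (-(1 / 4) : ℝ) * ((x.1 : ℝ) * x.2) ^ (-(3 / 4) : ℝ) := by
      rw [← Real.rpow_add hab, show (-(1 / 4) : ℝ) + -(3 / 4) = -1 by norm_num, Real.rpow_neg_one]
      simp [mul_comm]
    have h2 : ((x.1 : ℝ) * x.2) ^ (-(1 / 4) : ℝ) ≤ P ^ (-(1 / 4) : ℝ) :=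
      Real.rpow_le_rpow_of_nonpos hP h (by norm_num)
    unfold tt
    rw [abs_mul, abs_of_nonneg (WW_nonneg d _), hr]
    rw [e] at h1
    have h3 := h1.trans (mul_le_mul_of_nonneg_right h2 (by positivity))
    calc |kf d x| * WW d (x.1 * x.2) ≤ (P ^ (-(1 / 4) : ℝ) * ((x.1 : ℝ) * x.2) ^ (-(3 / 4) : ℝ)) * 2 :=
        mul_le_mul h3 (WW_le d _) (WW_nonneg d _) (by positivity)
      _ = _ := by ring
  · have hr : rr x = 0 := Set.indicator_of_notMem hx _
    have : tt d x = 0 := by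
      unfold tt WW
      rw [if_neg, mul_zero]
      rintro ⟨_, h2⟩
      refine hx ⟨?_, ?_, h2⟩
      · by_contra h0
        simp only [not_lt, nonpos_iff_eq_zero] at h0
        rw [h0] at h; norm_num at h; linarith
      · by_contra h0
        simp only [not_lt, nonpos_iff_eq_zero] at h0
        rw [h0] at h; norm_num at h; linarith
    rw [this, hr]; simp

lemma tt_zero (d : ℤ) (x : ℕ × ℕ) (h : x.1 = 0 ∨ x.2 = 0) : tt d x = 0 := by
  unfold tt kf
  rcases h with h | h <;> simp [h]

lemma tt_abs' (d : ℤ) (x : ℕ × ℕ) : |tt d x| ≤ 2 * rr x := by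
  by_cases h : x.1 = 0 ∨ x.2 = 0
  · rw [tt_zero d x h]; simpa using rr_nonneg x
  · push Not at h
    have := tt_abs d x 1 one_pos (by
      exact_mod_cast Nat.mul_pos (Nat.pos_of_ne_zero h.1) (Nat.pos_of_ne_zero h.2))
    simpa using this

lemma tt_summable (d : ℤ) : Summable (tt d) :=
  Summable.of_norm_bounded (rr_summable.mul_left 2) (fun x => tt_abs' d x)

/-- the singular series -/
noncomputable def SS (d : ℤ) : ℝ := ∑' x, tt d x

lemma tt_tail (d : ℤ) (N : ℕ) (hN : 1 ≤ N) :
    |∑ x ∈ Icc 1 N ×ˢ Icc 1 N, tt d x - SS d| ≤ 2 * (∑' x, rr x) * (N : ℝ) ^ (-(1 / 4) : ℝ) := by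
  classical
  have hNR : (0 : ℝ) < N := by exact_mod_cast hN
  rw [abs_sub_comm]
  set B := Icc 1 N ×ˢ Icc 1 N with hB
  have h1 : HasSum (fun x => if x ∈ B then tt d x else 0) (∑ x ∈ B, tt d x) := by
    have := hasSum_sum_of_ne_finset_zero (L := SummationFilter.unconditional _) (f := fun x => if x ∈ B then tt d x else 0) (s := B)
      (fun x hx => if_neg hx)
    rwa [sum_congr rfl (fun x hx => if_pos hx)] at this
  have h2 := (tt_summable d).hasSum.sub h1
  have hg : HasSum (fun x => 2 * (N : ℝ) ^ (-(1 / 4) : ℝ) * rr x) (2 * (N : ℝ) ^ (-(1 / 4) : ℝ) * ∑' x, rr x) :=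
    rr_summable.hasSum.mul_left _
  have h3 : ∀ x, ‖tt d x - (if x ∈ B then tt d x else 0)‖ ≤ 2 * (N : ℝ) ^ (-(1 / 4) : ℝ) * rr x := by
    intro x
    have hnn : 0 ≤ 2 * (N : ℝ) ^ (-(1 / 4) : ℝ) * rr x := mul_nonneg (by positivity) (rr_nonneg x)
    split_ifs with hx
    · simpa using hnn
    · rw [sub_zero]
      by_cases h : x.1 = 0 ∨ x.2 = 0
      · rw [tt_zero d x h]; simpa using hnn
      · push Not at h
        refine tt_abs d x N hNR ?_
        have : N ≤ x.1 * x.2 := by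
          by_contra hlt
          push Not at hlt
          apply hx
          have ha := Nat.pos_of_ne_zero h.1
          have hb := Nat.pos_of_ne_zero h.2
          rw [hB, mem_product, mem_Icc, mem_Icc]
          refine ⟨⟨ha, ?_⟩, ⟨hb, ?_⟩⟩ <;> nlinarith
        exact_mod_cast this
  have h4 := tsum_of_norm_bounded hg h3
  rw [h2.tsum_eq] at h4
  refine h4.trans_eq (by ring)

lemma chi_vals (d D : ℤ) (k : ℕ) : chi d D k = -1 ∨ chi d D k = 0 ∨ chi d D k = 1 := by
  rw [chi_apply]
  split_ifs
  · rcases jacobiSym.trichotomy D k with h | h | h <;> simp [h]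
  · simp

lemma SS_pos (d : ℤ) : 0 < SS d := by
  have h := (tt_summable d).hasSum.tsum_fiberwise (fun x : ℕ × ℕ => x.1 * x.2)
  have hfib : ∀ n : ℕ, n ≠ 0 → ∑' b : (fun x : ℕ × ℕ => x.1 * x.2) ⁻¹' {n}, tt d b = ∑ x ∈ n.divisorsAntidiagonal, tt d x := by
    intro n hn
    have : (fun x : ℕ × ℕ => x.1 * x.2) ⁻¹' {n} = (n.divisorsAntidiagonal : Set (ℕ × ℕ)) := by
      ext x; simp [hn]
    rw [this]
    exact Finset.tsum_subtype n.divisorsAntidiagonal (tt d)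
  have h0 : ∀ n, 0 ≤ ∑' b : (fun x : ℕ × ℕ => x.1 * x.2) ⁻¹' {n}, tt d b := by
    intro n
    rcases Nat.eq_zero_or_pos n with rfl | hn
    · have : ∀ b : (fun x : ℕ × ℕ => x.1 * x.2) ⁻¹' {0}, tt d b = 0 := by
        intro b
        have hb : b.1.1 * b.1.2 = 0 := b.2
        exact tt_zero d _ (Nat.mul_eq_zero.mp hb)
      simp [this]
    rw [hfib n hn.ne']
    by_cases hs : IsSquare n
    · obtain ⟨k, rfl⟩ := hs
      have hk : k ≠ 0 := by rintro rfl; simp at hn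
      have hc := conv_nonneg (chi d d) (chi_vals d d) k hk
      rw [sq] at hc
      have e : ∑ x ∈ (k * k).divisorsAntidiagonal, tt d x = WW d (k * k) / ((k * k : ℕ) : ℝ) ^ 2 *
          ∑ x ∈ (k * k).divisorsAntidiagonal, (x.1.totient : ℝ) * ((x.2.totient : ℝ) * chi d d x.2) := by
        rw [mul_sum]
        refine sum_congr rfl fun x hx => ?_
        have hx := (Nat.mem_divisorsAntidiagonal.mp hx).1
        unfold tt kf
        rw [hx, ← hx]
        push_cast
        rw [mul_pow]
        field_simp
      rw [e]
      exact mul_nonneg (div_nonneg (WW_nonneg _ _) (by positivity)) hc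
    · refine sum_nonneg fun x hx => ?_
      have hx := (Nat.mem_divisorsAntidiagonal.mp hx).1
      unfold tt WW
      rw [hx, if_neg (fun h => hs h.2), mul_zero]
  have h1 := le_hasSum h 1 (fun n _ => h0 n)
  rw [hfib 1 one_ne_zero] at h1
  refine lt_of_lt_of_le ?_ h1
  have e : Nat.divisorsAntidiagonal 1 = {(1, 1)} := by simp
  rw [e, sum_singleton]
  unfold tt kf WW
  rw [if_pos (by simp)]
  have : chi d d 1 = 1 := map_one _
  simp [this, ww_one (QQ d) (QQ_even d)]

end SingSeries

section MainSum

open Filter Topology Finset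

/-- truncated product -/
noncomputable def PN (d : ℤ) (N : ℕ) (D : ℤ) : ℝ := ∑ x ∈ Icc 1 N ×ˢ Icc 1 N, kf d x * chi d D (x.1 * x.2)

noncomputable def gN (d : ℤ) (N : ℕ) (D : ℤ) : ℝ := ∑ a ∈ Icc 1 N, chi d D a * ((a.totient : ℝ) / (a : ℝ) ^ 2)

lemma PN_eq (d : ℤ) (N : ℕ) (D : ℤ) : PN d N D = gN d N D * gN d N (d * D) := by
  unfold PN gN
  rw [sum_mul_sum, sum_product]
  refine sum_congr rfl fun a _ => sum_congr rfl fun b _ => ?_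
  unfold kf
  rw [map_mul, chi_mul_left]; ring

lemma gN_abs (d : ℤ) (N : ℕ) (D : ℤ) : |gN d N D| ≤ 1 + Real.log N := by
  refine (abs_sum_le_sum_abs _ _).trans (le_trans (sum_le_sum fun a _ => ?_) (harm_le N))
  rw [abs_mul, abs_of_nonneg (by positivity : (0 : ℝ) ≤ (a.totient : ℝ) / (a : ℝ) ^ 2)]
  have h := mul_le_mul (chi_abs_le d D a) (tot_div a) (by positivity) zero_le_one
  rwa [one_mul] at h

lemma sieve_chi (d : ℤ) (hd : d ≠ 0) (σ : ℤ) (hσ : σ = 1 ∨ σ = -1) (c : ZMod (QQ d)) (X L m : ℕ) (hL : 1 ≤ L) (hm : 1 ≤ m) :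
    |∑ j ∈ (Icc 1 X).filter (fun j : ℕ => (j : ZMod (QQ d)) = c), sqs (QQ d) j * chi d (σ * (j : ℤ)) m
      - (X : ℝ) / QQ d * WW d m| ≤ 3 * L * (Real.sqrt m * (1 + Real.log m)) + 2 * (X / L) := by
  have hm1 : (1 : ℝ) ≤ m := by exact_mod_cast hm
  have hlog := Real.log_nonneg hm1
  by_cases hc : Nat.Coprime m (8 * d.natAbs)
  · have h := sieve_sum (QQ d) m (QQ_pos d hd) (odd_of_coprime d m hc) ((coprime_QQ d m).mpr hc).symm c X L hL
    have e1 : ∑ j ∈ (Icc 1 X).filter (fun j : ℕ => (j : ZMod (QQ d)) = c), sqs (QQ d) j * chi d (σ * (j : ℤ)) m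
        = (jacobiSym σ m : ℝ) * ∑ j ∈ (Icc 1 X).filter (fun j : ℕ => (j : ZMod (QQ d)) = c), sqs (QQ d) j * (jacobiSym (j : ℤ) m : ℝ) := by
      rw [mul_sum]
      refine sum_congr rfl fun j _ => ?_
      rw [chi_apply, if_pos hc, jacobiSym.mul_left]; push_cast; ring
    have hσm : IsCoprime σ (m : ℤ) := by
      rcases hσ with rfl | rfl
      · exact isCoprime_one_left
      · exact isCoprime_one_left.neg_left
    have e2 : (X : ℝ) / QQ d * WW d m = (jacobiSym σ m : ℝ) * (if IsSquare m then (X : ℝ) / QQ d * ww (QQ d) m else 0) := by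
      unfold WW
      by_cases hs : IsSquare m
      · rw [if_pos ⟨hc, hs⟩, if_pos hs]
        have : jacobiSym σ m = 1 := by
          obtain ⟨k, rfl⟩ := hs
          have hk : k ≠ 0 := by rintro rfl; simp at hm
          have : NeZero k := ⟨hk⟩
          rw [jacobiSym.mul_right, ← sq]
          apply jacobiSym.sq_one
          rw [← Int.isCoprime_iff_gcd_eq_one]
          push_cast at hσm
          exact hσm.of_mul_right_left
        rw [this]; simp
      · rw [if_neg (fun h => hs h.2), if_neg hs]; simp
    rw [e1, e2, ← mul_sub, abs_mul]
    calc _ ≤ 1 * _ := mul_le_mul (jac_abs_le σ m) h (abs_nonneg _) zero_le_one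
      _ = _ := one_mul _
  · have e1 : ∑ j ∈ (Icc 1 X).filter (fun j : ℕ => (j : ZMod (QQ d)) = c), sqs (QQ d) j * chi d (σ * (j : ℤ)) m = 0 :=
      sum_eq_zero fun j _ => by rw [chi_apply, if_neg hc, mul_zero]
    have e2 : WW d m = 0 := by unfold WW; rw [if_neg (fun h => hc h.1)]
    rw [e1, e2]; simp; positivity

lemma sieve_box (d : ℤ) (hd : d ≠ 0) (σ : ℤ) (hσ : σ = 1 ∨ σ = -1) (c : ZMod (QQ d)) (X L N : ℕ) (hL : 1 ≤ L) (hN : 1 ≤ N) :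
    |∑ j ∈ (Icc 1 X).filter (fun j : ℕ => (j : ZMod (QQ d)) = c), sqs (QQ d) j * PN d N (σ * (j : ℤ))
      - (X : ℝ) / QQ d * ∑ x ∈ Icc 1 N ×ˢ Icc 1 N, tt d x| ≤
      (1 + Real.log N) ^ 2 * (3 * L * (N * (1 + 2 * Real.log N)) + 2 * (X / L)) := by
  have hN1 : (1 : ℝ) ≤ N := by exact_mod_cast hN
  have hlog := Real.log_nonneg hN1
  have e : ∑ j ∈ (Icc 1 X).filter (fun j : ℕ => (j : ZMod (QQ d)) = c), sqs (QQ d) j * PN d N (σ * (j : ℤ))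
      - (X : ℝ) / QQ d * ∑ x ∈ Icc 1 N ×ˢ Icc 1 N, tt d x = ∑ x ∈ Icc 1 N ×ˢ Icc 1 N, kf d x *
      (∑ j ∈ (Icc 1 X).filter (fun j : ℕ => (j : ZMod (QQ d)) = c), sqs (QQ d) j * chi d (σ * (j : ℤ)) (x.1 * x.2)
      - (X : ℝ) / QQ d * WW d (x.1 * x.2)) := by
    simp only [mul_sub, sum_sub_distrib]
    congr 1
    · unfold PN
      simp only [mul_sum]
      rw [sum_comm]
      exact sum_congr rfl fun x _ => sum_congr rfl fun j _ => by ring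
    · rw [mul_sum]
      exact sum_congr rfl fun x _ => by unfold tt; ring
  rw [e]
  set U := 3 * L * (N * (1 + 2 * Real.log N)) + 2 * ((X : ℝ) / L) with hU
  have hU0 : 0 ≤ U := by positivity
  have h1 : ∀ x ∈ Icc 1 N ×ˢ Icc 1 N, |kf d x *
      (∑ j ∈ (Icc 1 X).filter (fun j : ℕ => (j : ZMod (QQ d)) = c), sqs (QQ d) j * chi d (σ * (j : ℤ)) (x.1 * x.2)
      - (X : ℝ) / QQ d * WW d (x.1 * x.2))| ≤ (1 / x.1 * (1 / x.2)) * U := by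
    intro x hx
    rw [mem_product, mem_Icc, mem_Icc] at hx
    obtain ⟨⟨a1, a2⟩, b1, b2⟩ := hx
    rw [abs_mul]
    refine mul_le_mul (kf_abs d x) ?_ (abs_nonneg _) (by positivity)
    refine (sieve_chi d hd σ hσ c X L (x.1 * x.2) hL (Nat.mul_pos a1 b1)).trans ?_
    have := size_mono (x.1 * x.2) (N * N) (Nat.mul_pos a1 b1) (Nat.mul_le_mul a2 b2)
    have e3 : Real.sqrt ((N * N : ℕ) : ℝ) * (1 + Real.log ((N * N : ℕ) : ℝ)) = N * (1 + 2 * Real.log N) := by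
      push_cast
      rw [Real.sqrt_mul_self (by positivity), Real.log_mul (by positivity) (by positivity)]; ring
    rw [e3] at this
    rw [hU]
    gcongr
  refine (abs_sum_le_sum_abs _ _).trans ((sum_le_sum h1).trans ?_)
  rw [← sum_mul]
  refine mul_le_mul_of_nonneg_right ?_ hU0
  rw [sum_product]
  simp only [← mul_sum]
  rw [← sum_mul, sq]
  have := harm_le N
  exact mul_le_mul this this (sum_nonneg fun _ _ => by positivity) (by linarith)

lemma prod_err (G G' g g' e l : ℝ) (h1 : |G - g| ≤ e) (h2 : |G' - g'| ≤ e) (h3 : |g| ≤ l) (h4 : |g'| ≤ l) :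
    |G * G' - g * g'| ≤ e * (2 * l + e) := by
  have e1 : G * G' - g * g' = (G - g) * (G' - g') + (G - g) * g' + g * (G' - g') := by ring
  have he : 0 ≤ e := (abs_nonneg _).trans h1
  have hl : 0 ≤ l := (abs_nonneg _).trans h3
  rw [e1]
  refine (abs_add_three _ _ _).trans ?_
  rw [abs_mul, abs_mul, abs_mul]
  have a1 := mul_le_mul h1 h2 (abs_nonneg _) he
  have a2 := mul_le_mul h1 h4 (abs_nonneg _) he
  have a3 := mul_le_mul h3 h2 (abs_nonneg _) hl
  nlinarith

lemma sqs_abs (Q j : ℕ) : 0 ≤ sqs Q j ∧ sqs Q j ≤ 1 := by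
  unfold sqs; split_ifs <;> norm_num

lemma sqs_vals (Q j : ℕ) : sqs Q j = 0 ∨ sqs Q j = 1 := by
  unfold sqs; split_ifs <;> simp

lemma trunc_err (d : ℤ) (hd : d ≠ 0) (D : ℤ) (X N : ℕ) (hN : 1 ≤ N) (hNX : N ≤ X) (hDX : D.natAbs ≤ X)
    (hf : ∃ m : ℤ, Squarefree m ∧ (D = m ∨ D = 4 * m)) (hl : 8 * d.natAbs < D.natAbs) (y : ℝ) (hy : 1 ≤ y)
    (hyX : y ^ 10 = X) (hyN : y ^ 6 ≤ N) :
    |Gc d D * Gc d (d * D) - PN d N D| ≤ 80 * (QQ d : ℝ) ^ 2 * (1 + Real.log X) ^ 4 / y := by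
  have hN1 : (1 : ℝ) ≤ N := by exact_mod_cast hN
  have hNX' : (N : ℝ) ≤ X := by exact_mod_cast hNX
  have hlogN := Real.log_nonneg hN1
  have hlogX := Real.log_nonneg (hN1.trans hNX')
  have hll : Real.log N ≤ Real.log X := Real.log_le_log (by linarith) hNX'
  set l := 1 + Real.log X with hldef
  have hl1 : 1 ≤ l := by linarith
  have hQ : (1 : ℝ) ≤ QQ d := by exact_mod_cast QQ_pos d hd
  set q : ℝ := (QQ d : ℝ) with hq
  have hB := chi_Delta_bound d D hd hf hl
  have hBB : BB d D ≤ 2 * q * (y ^ 5 * l) := by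
    unfold BB
    have h0 : 1 ≤ D.natAbs := by omega
    have := size_mono D.natAbs X h0 hDX
    have e : Real.sqrt (X : ℝ) = y ^ 5 := by
      rw [← hyX, show y ^ 10 = (y ^ 5) ^ 2 by ring, Real.sqrt_sq (by positivity)]
    rw [e] at this
    exact mul_le_mul_of_nonneg_left this (by positivity)
  have herr : 4 * BB d D * (1 + Real.log N) / N ≤ 8 * q * l ^ 2 / y := by
    have hBB0 : 0 ≤ BB d D := le_trans (abs_nonneg _) (hB 0).1
    calc 4 * BB d D * (1 + Real.log N) / N ≤ 4 * (2 * q * (y ^ 5 * l)) * l / y ^ 6 := by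
          apply div_le_div₀ (by positivity) _ (by positivity) hyN
          apply mul_le_mul _ (by linarith) (by linarith) (by positivity)
          linarith
      _ = 8 * q * l ^ 2 / y := by field_simp; norm_num
  have h1 := ((Gc_spec d D _ (fun n => (hB n).1)).2 N hN).trans herr
  have h2 := ((Gc_spec d (d * D) _ (fun n => (hB n).2)).2 N hN).trans herr
  have h3 : |gN d N D| ≤ l := (gN_abs d N D).trans (by linarith)
  have h4 : |gN d N (d * D)| ≤ l := (gN_abs d N (d * D)).trans (by linarith)
  have h := prod_err _ _ _ _ _ _ h1 h2 h3 h4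
  rw [PN_eq]
  refine h.trans ?_
  have h5 : 8 * q * l ^ 2 / y ≤ 8 * q * l ^ 2 := div_le_self (by positivity) hy
  have h6 : 2 * l ≤ 2 * q * l ^ 2 := by nlinarith
  calc 8 * q * l ^ 2 / y * (2 * l + 8 * q * l ^ 2 / y) ≤ 8 * q * l ^ 2 / y * (10 * q * l ^ 2) := by
        apply mul_le_mul_of_nonneg_left _ (by positivity); linarith
    _ = _ := by ring

lemma ceil_facts (z : ℝ) (hz : 1 ≤ z) : 1 ≤ ⌈z⌉₊ ∧ z ≤ (⌈z⌉₊ : ℝ) ∧ (⌈z⌉₊ : ℝ) ≤ 2 * z := by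
  refine ⟨Nat.one_le_ceil_iff.mpr (by linarith), Nat.le_ceil z, ?_⟩
  have := Nat.ceil_lt_add_one (by linarith : 0 ≤ z)
  linarith

lemma main_sum_aux (d : ℤ) (hd : d ≠ 0) (σ : ℤ) (hσ : σ = 1 ∨ σ = -1) (c : ZMod (QQ d))
    (hc : ∀ j : ℕ, (j : ZMod (QQ d)) = c → sqs (QQ d) j = 1 → 8 * d.natAbs < j →
      ∃ m : ℤ, Squarefree m ∧ (σ * (j : ℤ) = m ∨ σ * (j : ℤ) = 4 * m)) (X : ℕ) (hX : 1 ≤ X) (y : ℝ) (hy : 1 ≤ y)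
    (hyX : y ^ 10 = X) :
    |∑ j ∈ (Icc 1 X).filter (fun j : ℕ => (j : ZMod (QQ d)) = c),
        (if 8 * d.natAbs < j then sqs (QQ d) j * (Gc d (σ * (j : ℤ)) * Gc d (d * (σ * (j : ℤ)))) else 0)
      - SS d / QQ d * X| ≤ (80 * (QQ d : ℝ) ^ 2 + 8 * d.natAbs + 26 + 2 * ∑' x, rr x) * ((1 + Real.log X) ^ 4 * y ^ 9) := by
  obtain ⟨hN, hN2, hN3⟩ := ceil_facts (y ^ 6) (one_le_pow₀ hy)
  obtain ⟨hL, hL2, hL3⟩ := ceil_facts (y ^ 2) (one_le_pow₀ hy)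
  have hNX : ⌈y ^ 6⌉₊ ≤ X := by
    rw [Nat.ceil_le, ← hyX]
    exact pow_le_pow_right₀ hy (by norm_num)
  set N := ⌈y ^ 6⌉₊
  set L := ⌈y ^ 2⌉₊
  have hN1 : (1 : ℝ) ≤ N := by exact_mod_cast hN
  have hNX' : (N : ℝ) ≤ X := by exact_mod_cast hNX
  have hlogN := Real.log_nonneg hN1
  have hll : Real.log N ≤ Real.log X := Real.log_le_log (by linarith) hNX'
  set l := 1 + Real.log X with hldef
  have hl1 : 1 ≤ l := by linarith
  have hQ : (1 : ℝ) ≤ QQ d := by exact_mod_cast QQ_pos d hd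
  set q : ℝ := (QQ d : ℝ) with hq
  set R := ∑' x, rr x with hR
  have hR0 : 0 ≤ R := tsum_nonneg rr_nonneg
  have hy9 : (1 : ℝ) ≤ y ^ 9 := one_le_pow₀ hy
  have hl4 : (1 : ℝ) ≤ l ^ 4 := one_le_pow₀ hl1
  have hX0 : (0 : ℝ) < X := by exact_mod_cast hX
  -- sieve
  have E1 := sieve_box d hd σ hσ c X L N hL hN
  have E1' : (1 + Real.log N) ^ 2 * (3 * L * (N * (1 + 2 * Real.log N)) + 2 * (X / L)) ≤ 26 * (l ^ 4 * y ^ 9) := by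
    have a1 : (1 + Real.log N) ^ 2 ≤ l ^ 2 := by gcongr; linarith
    have a2 : 3 * (L : ℝ) * (N * (1 + 2 * Real.log N)) ≤ 3 * (2 * y ^ 2) * ((2 * y ^ 6) * (2 * l)) := by
      gcongr; linarith
    have a3 : (X : ℝ) / L ≤ y ^ 8 := by
      rw [← hyX, div_le_iff₀ (by positivity)]
      calc y ^ 10 = y ^ 8 * y ^ 2 := by ring
        _ ≤ _ := by gcongr
    have a4 : y ^ 8 ≤ y ^ 9 := pow_le_pow_right₀ hy (by norm_num)
    have a5 : l ^ 3 ≤ l ^ 4 := pow_le_pow_right₀ hl1 (by norm_num)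
    have a6 : l ^ 2 ≤ l ^ 4 := pow_le_pow_right₀ hl1 (by norm_num)
    calc _ ≤ l ^ 2 * (3 * (2 * y ^ 2) * ((2 * y ^ 6) * (2 * l)) + 2 * y ^ 8) := by gcongr
      _ = 24 * (l ^ 3 * y ^ 8) + 2 * (l ^ 2 * y ^ 8) := by ring
      _ ≤ 24 * (l ^ 4 * y ^ 9) + 2 * (l ^ 4 * y ^ 9) := by gcongr
      _ = _ := by ring
  -- tail
  have E4 := tt_tail d N hN
  have E4' : |(X : ℝ) / q * ∑ x ∈ Icc 1 N ×ˢ Icc 1 N, tt d x - SS d / q * X| ≤ 2 * R * (l ^ 4 * y ^ 9) := by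
    have e : (X : ℝ) / q * ∑ x ∈ Icc 1 N ×ˢ Icc 1 N, tt d x - SS d / q * X =
      X / q * (∑ x ∈ Icc 1 N ×ˢ Icc 1 N, tt d x - SS d) := by ring
    rw [e, abs_mul, abs_of_nonneg (by positivity)]
    have b1 : (N : ℝ) ^ (-(1 / 4) : ℝ) ≤ 1 / y := by
      have : (y ^ 4 : ℝ) ≤ N := (pow_le_pow_right₀ hy (by norm_num)).trans hN2
      refine (Real.rpow_le_rpow_of_nonpos (by positivity) this (by norm_num)).trans_eq ?_
      rw [← Real.rpow_natCast, ← Real.rpow_mul (by positivity)]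
      norm_num
      rw [Real.rpow_neg_one]
    have b2 : (X : ℝ) / q ≤ y ^ 10 := by rw [hyX]; exact div_le_self (by positivity) hQ
    calc (X : ℝ) / q * |∑ x ∈ Icc 1 N ×ˢ Icc 1 N, tt d x - SS d| ≤ y ^ 10 * (2 * R * (1 / y)) := by
          apply mul_le_mul b2 _ (abs_nonneg _) (by positivity)
          refine E4.trans ?_
          gcongr
      _ = 2 * R * (1 * y ^ 9) := by field_simp
      _ ≤ _ := by gcongr
  -- truncation
  have E2 : |∑ j ∈ (Icc 1 X).filter (fun j : ℕ => (j : ZMod (QQ d)) = c),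
        (if 8 * d.natAbs < j then sqs (QQ d) j * (Gc d (σ * (j : ℤ)) * Gc d (d * (σ * (j : ℤ)))) else 0)
      - ∑ j ∈ (Icc 1 X).filter (fun j : ℕ => (j : ZMod (QQ d)) = c), sqs (QQ d) j * PN d N (σ * (j : ℤ))|
      ≤ (80 * q ^ 2 + 8 * d.natAbs) * (l ^ 4 * y ^ 9) := by
    rw [← sum_sub_distrib]
    refine (abs_sum_le_sum_abs _ _).trans ?_
    have hterm : ∀ j ∈ (Icc 1 X).filter (fun j : ℕ => (j : ZMod (QQ d)) = c),
        |(if 8 * d.natAbs < j then sqs (QQ d) j * (Gc d (σ * (j : ℤ)) * Gc d (d * (σ * (j : ℤ)))) else 0)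
          - sqs (QQ d) j * PN d N (σ * (j : ℤ))| ≤ 80 * q ^ 2 * l ^ 4 / y + (if j ≤ 8 * d.natAbs then l ^ 4 else 0) := by
      intro j hj
      rw [mem_filter, mem_Icc] at hj
      have hna : (σ * (j : ℤ)).natAbs = j := by
        rcases hσ with rfl | rfl <;> simp
      by_cases hjl : 8 * d.natAbs < j
      · rw [if_pos hjl, if_neg (by omega), add_zero]
        rcases sqs_vals (QQ d) j with h0 | h1
        · rw [h0]; simp; positivity
        · rw [h1, one_mul, one_mul]
          exact trunc_err d hd _ X N hN hNX (by rw [hna]; exact hj.1.2) (hc j hj.2 h1 hjl) (by rw [hna]; exact hjl) y hy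
            hyX hN2
      · rw [if_neg hjl, if_pos (by omega), zero_sub, abs_neg, abs_mul, PN_eq, abs_mul]
        have s1 := sqs_abs (QQ d) j
        rw [abs_of_nonneg s1.1]
        have g1 : |gN d N (σ * (j : ℤ))| ≤ l := (gN_abs d N _).trans (by linarith)
        have g2 : |gN d N (d * (σ * (j : ℤ)))| ≤ l := (gN_abs d N _).trans (by linarith)
        have : sqs (QQ d) j * (|gN d N (σ * (j : ℤ))| * |gN d N (d * (σ * (j : ℤ)))|) ≤ 1 * (l * l) :=
          mul_le_mul s1.2 (mul_le_mul g1 g2 (abs_nonneg _) (by linarith)) (by positivity) zero_le_one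
        have h24 : l ^ 2 ≤ l ^ 4 := pow_le_pow_right₀ hl1 (by norm_num)
        have : 0 ≤ 80 * q ^ 2 * l ^ 4 / y := by positivity
        nlinarith
    refine (sum_le_sum hterm).trans ?_
    refine (sum_le_sum_of_subset_of_nonneg (filter_subset _ _) (fun j _ _ => ?_)).trans ?_
    · have : 0 ≤ 80 * q ^ 2 * l ^ 4 / y := by positivity
      split_ifs <;> positivity
    rw [sum_add_distrib, sum_const, Nat.card_Icc, ← sum_filter, sum_const]
    have hcard : ((Icc 1 X).filter (fun j => j ≤ 8 * d.natAbs)).card ≤ 8 * d.natAbs := by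
      have : (Icc 1 X).filter (fun j => j ≤ 8 * d.natAbs) ⊆ Icc 1 (8 * d.natAbs) := by
        intro j hj
        rw [mem_filter, mem_Icc] at hj
        rw [mem_Icc]; omega
      simpa using card_le_card this
    have hcard' : (((Icc 1 X).filter (fun j => j ≤ 8 * d.natAbs)).card : ℝ) ≤ 8 * d.natAbs := by exact_mod_cast hcard
    simp only [nsmul_eq_mul, Nat.add_sub_cancel]
    rw [← hyX, add_mul]
    apply add_le_add
    · apply le_of_eq; field_simp
    · calc _ ≤ (8 * d.natAbs : ℝ) * (l ^ 4 * 1) := by rw [mul_one]; gcongr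
        _ ≤ _ := by gcongr
  have := abs_sub_le_iff.mp E2
  rw [abs_sub_le_iff] at E1 E4' ⊢
  constructor <;> linarith [E1.1, E1.2, E4'.1, E4'.2, this.1, this.2]

lemma main_sum (d : ℤ) (hd : d ≠ 0) (σ : ℤ) (hσ : σ = 1 ∨ σ = -1) (c : ZMod (QQ d))
    (hc : ∀ j : ℕ, (j : ZMod (QQ d)) = c → sqs (QQ d) j = 1 → 8 * d.natAbs < j →
      ∃ m : ℤ, Squarefree m ∧ (σ * (j : ℤ) = m ∨ σ * (j : ℤ) = 4 * m)) :
    ∃ K : ℝ, 0 ≤ K ∧ ∀ X : ℕ, 1 ≤ X →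
    |∑ j ∈ (Icc 1 X).filter (fun j : ℕ => (j : ZMod (QQ d)) = c),
        (if 8 * d.natAbs < j then sqs (QQ d) j * (Gc d (σ * (j : ℤ)) * Gc d (d * (σ * (j : ℤ)))) else 0)
      - SS d / QQ d * X| ≤ K * (X : ℝ) ^ (47 / 50 : ℝ) := by
  have hR0 : 0 ≤ ∑' x, rr x := tsum_nonneg rr_nonneg
  refine ⟨(80 * (QQ d : ℝ) ^ 2 + 8 * d.natAbs + 26 + 2 * ∑' x, rr x) * 101 ^ 4, by positivity, fun X hX => ?_⟩
  have hX1 : (1 : ℝ) ≤ X := by exact_mod_cast hX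
  have h := main_sum_aux d hd σ hσ c hc X hX ((X : ℝ) ^ (1 / 10 : ℝ)) (Real.one_le_rpow hX1 (by norm_num)) (by
    rw [← Real.rpow_natCast, ← Real.rpow_mul (by positivity)]; norm_num)
  refine h.trans ?_
  rw [mul_assoc]
  refine mul_le_mul_of_nonneg_left ?_ (by positivity)
  have hlog := Real.log_nonneg hX1
  have h1 : 1 + Real.log X ≤ 101 * (X : ℝ) ^ (1 / 100 : ℝ) := by
    have a := Real.log_le_rpow_div (by positivity : (0 : ℝ) ≤ X) (by norm_num : (0 : ℝ) < 1 / 100)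
    have b : 1 ≤ (X : ℝ) ^ (1 / 100 : ℝ) := Real.one_le_rpow hX1 (by norm_num)
    linarith
  calc (1 + Real.log X) ^ 4 * ((X : ℝ) ^ (1 / 10 : ℝ)) ^ 9 ≤ (101 * (X : ℝ) ^ (1 / 100 : ℝ)) ^ 4 * ((X : ℝ) ^ (1 / 10 : ℝ)) ^ 9 := by
        gcongr
    _ = 101 ^ 4 * (((X : ℝ) ^ (1 / 100 : ℝ)) ^ 4 * ((X : ℝ) ^ (1 / 10 : ℝ)) ^ 9) := by ring
    _ = 101 ^ 4 * (X : ℝ) ^ (47 / 50 : ℝ) := by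
        rw [← Real.rpow_natCast ((X : ℝ) ^ (1 / 100 : ℝ)), ← Real.rpow_natCast ((X : ℝ) ^ (1 / 10 : ℝ)),
          ← Real.rpow_mul (by positivity), ← Real.rpow_mul (by positivity),
          ← Real.rpow_add (by positivity)]
        norm_num

end MainSum

section AbelFinal

open Filter Topology Finset

lemma abel_id (u : ℕ → ℝ) (n : ℕ) : ∑ j ∈ Icc 1 n, u j / j = (∑ j ∈ Icc 1 n, u j) / n +
    ∑ j ∈ range n, (∑ i ∈ Icc 1 j, u i) / (j * (j + 1)) := by
  induction n with
  | zero => simp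
  | succ n ih =>
    rw [sum_Icc_succ_top (by omega), sum_Icc_succ_top (by omega), sum_range_succ, ih]
    rcases Nat.eq_zero_or_pos n with rfl | hn
    · simp
    have : (0 : ℝ) < n := by exact_mod_cast hn
    push_cast
    field_simp
    ring

lemma abel_log (τ : ℕ → ℝ) (C K : ℝ) (hK : 0 ≤ K)
    (h : ∀ n : ℕ, 1 ≤ n → |∑ j ∈ Icc 1 n, τ j - C * n| ≤ K * (n : ℝ) ^ (47 / 50 : ℝ)) :
    ∃ K' : ℝ, 0 ≤ K' ∧ ∀ n : ℕ, 1 ≤ n → |∑ j ∈ Icc 1 n, τ j / j - C * Real.log n| ≤ K' := by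
  have hS : Summable (fun n : ℕ => (n : ℝ) ^ (-(53 / 50) : ℝ)) := Real.summable_nat_rpow.mpr (by norm_num)
  set A := ∑' n : ℕ, (n : ℝ) ^ (-(53 / 50) : ℝ) with hA
  have hA0 : 0 ≤ A := tsum_nonneg fun n => by positivity
  refine ⟨K + K * A + |C|, by positivity, fun n hn => ?_⟩
  have hnR : (1 : ℝ) ≤ n := by exact_mod_cast hn
  set u : ℕ → ℝ := fun j => τ j - C with hu
  have hU : ∀ m : ℕ, 1 ≤ m → |∑ j ∈ Icc 1 m, u j| ≤ K * (m : ℝ) ^ (47 / 50 : ℝ) := by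
    intro m hm
    have := h m hm
    rw [hu]
    simp only [sum_sub_distrib, sum_const, Nat.card_Icc, Nat.add_sub_cancel, nsmul_eq_mul]
    rwa [mul_comm (m : ℝ) C]
  have e1 : ∑ j ∈ Icc 1 n, τ j / j = ∑ j ∈ Icc 1 n, u j / j + C * ∑ j ∈ Icc 1 n, (1 : ℝ) / j := by
    rw [mul_sum, ← sum_add_distrib]
    refine sum_congr rfl fun j _ => ?_
    rw [hu]; ring
  have b1 : |(∑ j ∈ Icc 1 n, u j) / n| ≤ K := by
    rw [abs_div, abs_of_nonneg (by linarith : (0 : ℝ) ≤ n), div_le_iff₀ (by linarith)]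
    refine (hU n hn).trans (mul_le_mul_of_nonneg_left ?_ hK)
    exact (Real.rpow_le_rpow_of_exponent_le hnR (by norm_num : (47 / 50 : ℝ) ≤ 1)).trans_eq (Real.rpow_one _)
  have b2 : |∑ j ∈ range n, (∑ i ∈ Icc 1 j, u i) / (j * (j + 1))| ≤ K * A := by
    refine (abs_sum_le_sum_abs _ _).trans ?_
    refine (sum_le_sum (g := fun j : ℕ => K * (j : ℝ) ^ (-(53 / 50) : ℝ)) fun j _ => ?_).trans ?_
    · rcases Nat.eq_zero_or_pos j with rfl | hj
      · simp
      have hjR : (0 : ℝ) < j := by exact_mod_cast hj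
      rw [abs_div, abs_of_nonneg (by positivity : (0 : ℝ) ≤ (j : ℝ) * (j + 1)), div_le_iff₀ (by positivity)]
      refine (hU j hj).trans ?_
      have e : (j : ℝ) ^ (47 / 50 : ℝ) = (j : ℝ) ^ (-(53 / 50) : ℝ) * (j * j) := by
        rw [← sq, ← Real.rpow_natCast, ← Real.rpow_add hjR]; norm_num
      rw [e, mul_assoc]
      gcongr
      linarith
    · rw [← mul_sum]
      exact mul_le_mul_of_nonneg_left (hS.sum_le_tsum _ (fun _ _ => by positivity)) hK
  have b3 : |∑ j ∈ Icc 1 n, (1 : ℝ) / j - Real.log n| ≤ 1 := by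
    have c1 := harm_le n
    have c2 := log_add_one_le_harmonic n
    rw [harmonic_eq_sum_Icc] at c2
    push_cast at c2
    have c3 : Real.log n ≤ Real.log (n + 1) := Real.log_le_log (by linarith) (by linarith)
    simp only [one_div] at c1 ⊢
    rw [abs_le]; constructor <;> linarith
  rw [e1, abel_id]
  have e2 : (∑ j ∈ Icc 1 n, u j) / n + ∑ j ∈ range n, (∑ i ∈ Icc 1 j, u i) / (j * (j + 1)) +
      C * ∑ j ∈ Icc 1 n, (1 : ℝ) / j - C * Real.log n = (∑ j ∈ Icc 1 n, u j) / n +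
      ∑ j ∈ range n, (∑ i ∈ Icc 1 j, u i) / (j * (j + 1)) + C * (∑ j ∈ Icc 1 n, (1 : ℝ) / j - Real.log n) := by ring
  rw [e2]
  refine (abs_add_three _ _ _).trans ?_
  rw [abs_mul]
  have := mul_le_mul_of_nonneg_left b3 (abs_nonneg C)
  linarith

/-- from naturals to reals -/
lemma floor_log (C : ℝ) (Y : ℝ) (hY : 2 ≤ Y) : |C * Real.log (⌊Y⌋₊ : ℝ) - C * Real.log Y| ≤ |C| * Real.log 2 := by
  have h1 : (⌊Y⌋₊ : ℝ) ≤ Y := Nat.floor_le (by linarith)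
  have h2 := Nat.lt_floor_add_one Y
  have h3 : (0 : ℝ) < ⌊Y⌋₊ := by linarith
  have h4 : Y ≤ 2 * ⌊Y⌋₊ := by linarith
  have a := Real.log_le_log h3 h1
  have b := Real.log_le_log (by linarith) h4
  rw [Real.log_mul (by norm_num) h3.ne'] at b
  rw [← mul_sub, abs_mul]
  refine mul_le_mul_of_nonneg_left ?_ (abs_nonneg C)
  rw [abs_le]; constructor <;> linarith

end AbelFinal

section Arith

open Filter Topology Finset

/-- the discriminants which are counted -/
def Cnt (d Δ : ℤ) : Prop := IsFundamentalDiscriminant Δ ∧ Δ ≠ DL d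

lemma rat_sq_int (n : ℤ) (q : ℚ) (h : q ^ 2 = n) : ∃ z : ℤ, z ^ 2 = n := by
  have : IsSquare (n : ℚ) := ⟨q, by rw [← h]; ring⟩
  obtain ⟨z, hz⟩ := Rat.isSquare_intCast_iff.mp this
  exact ⟨z, by rw [hz]; ring⟩

lemma sqfree_sq (n : ℤ) (hn : Squarefree n) (q : ℚ) (h : q ^ 2 = n) : n = 1 := by
  obtain ⟨z, rfl⟩ := rat_sq_int n q h
  have := hn z (by rw [sq])
  rcases Int.isUnit_iff.mp this with rfl | rfl <;> norm_num

lemma sqfree_mul_sq (d m : ℤ) (hd : Squarefree d) (hm : Squarefree m) (q : ℚ) (h : q ^ 2 = (d * m : ℤ)) : m = d := by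
  obtain ⟨z, hz⟩ := rat_sq_int _ q h
  have h1 : d ∣ z := (hd.dvd_pow_iff_dvd two_ne_zero).mp (Dvd.intro m hz.symm)
  obtain ⟨w, rfl⟩ := h1
  have hd0 := hd.ne_zero
  have h2 : m = d * w ^ 2 := by
    have : d * m = d * (d * w ^ 2) := by rw [← hz]; ring
    exact mul_left_cancel₀ hd0 this
  have := hm w ⟨d, by rw [h2]; ring⟩
  rcases Int.isUnit_iff.mp this with rfl | rfl <;> simpa using h2

lemma Cnt.fund {d Δ : ℤ} (h : Cnt d Δ) : ∃ m : ℤ, Squarefree m ∧ (Δ = m ∨ Δ = 4 * m) := by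
  obtain ⟨⟨_, h1 | ⟨m, h1, h2, _⟩⟩, _⟩ := h
  · exact ⟨Δ, h1.2, Or.inl rfl⟩
  · exact ⟨m, h2, Or.inr h1⟩

lemma biq_of (d Δ : ℤ) (hsq : Squarefree d) (hd1 : d ≠ 1) (h : Cnt d Δ) (M : Type) [Field M] [NumberField M]
    (hr : Module.finrank ℚ M = 4) (c s : M) (hc : c ^ 2 = (d : M)) (hs : s ^ 2 = (Δ : M)) : Biq d Δ M c s where
  hc := hc
  hs := hs
  rank := hr
  nd := fun q hq => hd1 (sqfree_sq d hsq q hq)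
  nD := by
    intro q hq
    obtain ⟨⟨h0, h1 | ⟨m, h1, h2, h3⟩⟩, _⟩ := h
    · exact h0 (sqfree_sq Δ h1.2 q hq)
    · have := sqfree_sq m h2 (q / 2) (by rw [div_pow, hq, h1]; push_cast; ring)
      omega
  ndD := by
    intro q hq
    obtain ⟨⟨h0, h1 | ⟨m, h1, h2, h3⟩⟩, h4⟩ := h
    · have := sqfree_mul_sq d Δ hsq h1.2 (d * q) (by push_cast; rw [← hq]; ring)
      apply h4
      unfold DL
      rw [this] at h1
      rw [if_pos h1.1, this]
    · have := sqfree_mul_sq d m hsq h2 (d * q / 2) (by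
        rw [h1] at hq; push_cast at hq ⊢
        have : (d : ℚ) * (d * q ^ 2) = d * (4 * m) := by rw [hq]
        rw [div_pow, mul_pow]; linarith)
      apply h4
      unfold DL
      rw [if_neg (by omega), h1, this]
  sqd := hsq
  fund := h.fund

lemma sixteen_dvd (d : ℤ) : (16 : ℤ) ∣ QQ d := by
  have : (16 : ℕ) ∣ QQ d := ⟨2048 * d.natAbs ^ 5, by unfold QQ; ring⟩
  exact_mod_cast this

lemma four_p_dvd (d : ℤ) (p : ℕ) (hp : p.Prime) (h : p ∣ QQ d) : 4 * p ^ 2 ∣ QQ d := by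
  have h1 : p ∣ 8 * d.natAbs := hp.dvd_of_dvd_pow h
  have h2 : p ^ 2 ∣ (8 * d.natAbs) ^ 2 := pow_dvd_pow_of_dvd h1 2
  have h3 : 4 ∣ (8 * d.natAbs) ^ 3 := ⟨128 * d.natAbs ^ 3, by ring⟩
  have := mul_dvd_mul h3 h2
  rw [← pow_add] at this
  exact this

lemma sqfree_int_iff (n : ℤ) : Squarefree n ↔ ∀ p : ℕ, p.Prime → ¬ ((p ^ 2 : ℕ) : ℤ) ∣ n := by
  rw [← Int.squarefree_natAbs, Nat.squarefree_iff_prime_squarefree]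
  refine forall_congr' fun p => forall_congr' fun _ => ?_
  rw [Int.natCast_dvd, sq]

lemma sqs_eq_one (Q j : ℕ) : sqs Q j = 1 ↔ ∀ p : ℕ, p.Prime → ¬ p ∣ Q → ¬ p ^ 2 ∣ j := by
  unfold sqs
  split_ifs with h
  · simp only [true_iff]; exact h
  · simp only [zero_ne_one, false_iff]; exact h

lemma Cnt.sqs_one {d Δ : ℤ} (h : Cnt d Δ) : sqs (QQ d) Δ.natAbs = 1 := by
  rw [sqs_eq_one]
  intro p hp hpQ hpd
  have hpd' : ((p ^ 2 : ℕ) : ℤ) ∣ Δ := Int.natCast_dvd.mpr hpd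
  obtain ⟨⟨_, h1 | ⟨m, h1, h2, _⟩⟩, _⟩ := h
  · exact (sqfree_int_iff Δ).mp h1.2 p hp hpd'
  · have hodd : Nat.Coprime (p ^ 2) 4 := by
      have : Nat.Coprime p 2 := (Nat.coprime_primes hp Nat.prime_two).mpr (by
        rintro rfl
        exact hpQ ((QQ_even d).two_dvd))
      exact (this.pow 2 2)
    have hc : IsCoprime ((p ^ 2 : ℕ) : ℤ) (4 : ℤ) := by
      have := Nat.isCoprime_iff_coprime.mpr hodd
      exact_mod_cast this
    rw [h1] at hpd'
    exact (sqfree_int_iff m).mp h2 p hp (hc.dvd_of_dvd_mul_left hpd')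

lemma Cnt.transfer {d Δ₀ Δ : ℤ} (h : Cnt d Δ₀) (hQ : (QQ d : ℤ) ∣ Δ - Δ₀) (hs : sqs (QQ d) Δ.natAbs = 1)
    (hl : 8 * d.natAbs < Δ.natAbs) (hd : d ≠ 0) : Cnt d Δ := by
  have hdpos := Int.natAbs_pos.mpr hd
  have h16 := (sixteen_dvd d).trans hQ
  rw [sqs_eq_one] at hs
  refine ⟨⟨?_, ?_⟩, ?_⟩
  · rintro rfl; simp at hl; omega
  · obtain ⟨⟨_, h1 | ⟨m₀, h1, h2, h3⟩⟩, _⟩ := h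
    · left
      refine ⟨by omega, ?_⟩
      rw [sqfree_int_iff]
      intro p hp hpd
      by_cases hpQ : p ∣ QQ d
      · have : ((p ^ 2 : ℕ) : ℤ) ∣ QQ d := by
          exact_mod_cast (Dvd.intro_left 4 rfl).trans (four_p_dvd d p hp hpQ)
        have h5 := dvd_sub hpd (this.trans hQ)
        rw [sub_sub_cancel] at h5
        exact (sqfree_int_iff Δ₀).mp h1.2 p hp h5
      · exact hs p hp hpQ (Int.natCast_dvd.mp hpd)
    · right
      obtain ⟨m, hm⟩ : (4 : ℤ) ∣ Δ := by omega
      refine ⟨m, hm, ?_, by omega⟩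
      rw [sqfree_int_iff]
      intro p hp hpd
      by_cases hpQ : p ∣ QQ d
      · have : ((4 * p ^ 2 : ℕ) : ℤ) ∣ QQ d := by
          exact_mod_cast (four_p_dvd d p hp hpQ)
        have h4 : ((4 * p ^ 2 : ℕ) : ℤ) ∣ Δ := by
          rw [hm]; push_cast; push_cast at hpd
          exact mul_dvd_mul_left 4 hpd
        have h5 := dvd_sub h4 (this.trans hQ)
        rw [sub_sub_cancel, h1] at h5
        push_cast at h5
        have h6 := (mul_dvd_mul_iff_left (by norm_num : (4 : ℤ) ≠ 0)).mp h5
        exact (sqfree_int_iff m₀).mp h2 p hp (by push_cast; exact h6)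
      · refine hs p hp hpQ (Int.natCast_dvd.mp ?_)
        rw [hm]; exact hpd.mul_left 4
  · rintro rfl
    unfold DL at hl
    split_ifs at hl
    · omega
    · rw [Int.natAbs_mul] at hl; simp at hl; omega

lemma exists_cnt (d : ℤ) (hd : d ≠ 0) : ∃ j : ℕ, 8 * d.natAbs < j ∧ Cnt d (j : ℤ) := by
  obtain ⟨p, hp, h1, h2⟩ := Nat.exists_prime_gt_modEq_one (k := 4) (8 * d.natAbs + 1) (by norm_num)
  have hdpos := Int.natAbs_pos.mpr hd
  refine ⟨p, by omega, ⟨?_, Or.inl ⟨?_, ?_⟩⟩, ?_⟩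
  · have := hp.one_lt; exact_mod_cast this.ne'
  · unfold Nat.ModEq at h2; omega
  · exact (Nat.prime_iff_prime_int.mp hp).squarefree
  · unfold DL
    split_ifs <;> omega

end Arith

section Assembly

open Filter Topology Finset

variable (d : ℤ) (M : ℤ → Type) [∀ Δ, Field (M Δ)] [∀ Δ, NumberField (M Δ)]

open scoped Classical in
/-- the summand -/
noncomputable def fS (Δ : ℤ) : ℝ := if Cnt d Δ then schanuel (M Δ) else 0

/-- the defining property of the family -/
def Fam : Prop := ∀ Δ, Cnt d Δ → Module.finrank ℚ (M Δ) = 4 ∧ (∃ c : M Δ, c ^ 2 = (d : M Δ)) ∧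
  ∃ s : M Δ, s ^ 2 = (Δ : M Δ)

/-- nonempty classes -/
def Cls (σ : ℤ) (c : ZMod (QQ d)) : Prop := ∃ j : ℕ, 8 * d.natAbs < j ∧ (j : ZMod (QQ d)) = c ∧ Cnt d (σ * (j : ℤ))

open scoped Classical in
noncomputable def kk (σ : ℤ) (c : ZMod (QQ d)) : ℝ :=
  if h : Cls d σ c then kap d (σ * (h.choose : ℤ)) (M (σ * (h.choose : ℤ))) else 0

open scoped Classical in
noncomputable def tauS (σ : ℤ) (j : ℕ) : ℝ := if 8 * d.natAbs < j then fS d M (σ * (j : ℤ)) * j else 0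

variable {d M}

lemma Fam.biq (hM : Fam d M) (hsq : Squarefree d) (hd1 : d ≠ 1) {Δ : ℤ} (h : Cnt d Δ) :
    ∃ c s : M Δ, Biq d Δ (M Δ) c s := by
  obtain ⟨h1, ⟨c, hc⟩, s, hs⟩ := hM Δ h
  exact ⟨c, s, biq_of d Δ hsq hd1 h (M Δ) h1 c s hc hs⟩

lemma kk_nonneg (hM : Fam d M) (hsq : Squarefree d) (hd1 : d ≠ 1) (σ : ℤ) (c : ZMod (QQ d)) : 0 ≤ kk d M σ c := by
  unfold kk
  split_ifs with h
  · obtain ⟨x, y, hb⟩ := hM.biq hsq hd1 h.choose_spec.2.2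
    exact hb.kap_pos.le
  · exact le_rfl

lemma kk_pos (hM : Fam d M) (hsq : Squarefree d) (hd1 : d ≠ 1) (σ : ℤ) (c : ZMod (QQ d)) (h : Cls d σ c) :
    0 < kk d M σ c := by
  unfold kk
  rw [dif_pos h]
  obtain ⟨x, y, hb⟩ := hM.biq hsq hd1 h.choose_spec.2.2
  exact hb.kap_pos

lemma nat_dvd_of_class (j j' : ℕ) (σ : ℤ) (h : (j : ZMod (QQ d)) = (j' : ZMod (QQ d))) :
    (QQ d : ℤ) ∣ σ * j' - σ * j := by
  rw [← mul_sub]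
  refine Dvd.dvd.mul_left ?_ σ
  have : (((j : ℤ)) : ZMod (QQ d)) = ((j' : ℤ) : ZMod (QQ d)) := by exact_mod_cast h
  exact (ZMod.intCast_eq_intCast_iff_dvd_sub _ _ _).mp this

lemma Cls.cnt {σ : ℤ} (hσ : σ = 1 ∨ σ = -1) {c : ZMod (QQ d)} (h : Cls d σ c) (hd : d ≠ 0) (j : ℕ)
    (hj : (j : ZMod (QQ d)) = c) (hl : 8 * d.natAbs < j) (hs : sqs (QQ d) j = 1) : Cnt d (σ * (j : ℤ)) := by
  obtain ⟨j₀, h1, h2, h3⟩ := h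
  have hna : (σ * (j : ℤ)).natAbs = j := by rcases hσ with rfl | rfl <;> simp
  exact h3.transfer (nat_dvd_of_class j₀ j σ (h2.trans hj.symm)) (by rw [hna]; exact hs) (by rw [hna]; exact hl) hd

lemma tau_eq (hM : Fam d M) (hsq : Squarefree d) (hd1 : d ≠ 1) {σ : ℤ} (hσ : σ = 1 ∨ σ = -1) (c : ZMod (QQ d))
    (j : ℕ) (hj : (j : ZMod (QQ d)) = c) :
    tauS d M σ j = kk d M σ c * Ac d * (if 8 * d.natAbs < j then sqs (QQ d) j *
      (Gc d (σ * (j : ℤ)) * Gc d (d * (σ * (j : ℤ)))) else 0) := by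
  unfold tauS
  by_cases hl : 8 * d.natAbs < j
  swap
  · rw [if_neg hl, if_neg hl, mul_zero]
  rw [if_pos hl, if_pos hl]
  have hna : (σ * (j : ℤ)).natAbs = j := by rcases hσ with rfl | rfl <;> simp
  by_cases hC : Cnt d (σ * (j : ℤ))
  · have hcls : Cls d σ c := ⟨j, hl, hj, hC⟩
    have hs := hC.sqs_one
    rw [hna] at hs
    obtain ⟨x, y, hb⟩ := hM.biq hsq hd1 hC
    obtain ⟨h1, h2, h3⟩ := hcls.choose_spec
    obtain ⟨x', y', hb'⟩ := hM.biq hsq hd1 h3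
    have hdv := nat_dvd_of_class _ j σ (h2.trans hj.symm)
    have e8 : (QQ d : ℤ) = (((8 * d) ^ 5).natAbs : ℤ) := by
      unfold QQ
      rw [Int.natAbs_pow, Int.natAbs_mul]; rfl
    rw [e8, Int.natAbs_dvd] at hdv
    obtain ⟨k, hk⟩ := hdv
    have hpos : 0 < σ * ((hcls.choose : ℕ) : ℤ) ↔ 0 < σ * (j : ℤ) := by
      have a : 0 < hcls.choose := by omega
      have b : 0 < j := by omega
      rcases hσ with rfl | rfl <;> constructor <;> intro _ <;> omega
    have ht := hb'.kap_transfer hb k (by rw [← hk]; ring) hpos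
    have hkk : kk d M σ c = kap d (σ * (j : ℤ)) (M (σ * (j : ℤ))) := by
      unfold kk
      rw [dif_pos hcls, ht]
    have hf := (hb.fund_pos hd1 (by rw [hna]; exact hl)).1
    have habs : |((σ * (j : ℤ) : ℤ) : ℝ)| = j := by
      rcases hσ with rfl | rfl <;> simp
    rw [habs] at hf
    unfold fS
    rw [if_pos hC, hf, hkk, hs]; ring
  · unfold fS
    rw [if_neg hC, zero_mul]
    by_cases hcls : Cls d σ c
    · have : sqs (QQ d) j = 0 := by
        rcases sqs_vals (QQ d) j with h | h
        · exact h
        · exact absurd (hcls.cnt hσ hsq.ne_zero j hj hl h) hC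
      rw [this]; ring
    · unfold kk
      rw [dif_neg hcls]; ring

lemma tau_sum (hM : Fam d M) (hsq : Squarefree d) (hd1 : d ≠ 1) {σ : ℤ} (hσ : σ = 1 ∨ σ = -1) :
    ∃ C K : ℝ, 0 ≤ K ∧ 0 ≤ C ∧ (σ = 1 → 0 < C) ∧ ∀ X : ℕ, 1 ≤ X → |∑ j ∈ Icc 1 X, tauS d M σ j - C * X| ≤ K * (X : ℝ) ^ (47 / 50 : ℝ) := by
  have hd := hsq.ne_zero
  have hQ := QQ_pos d hd
  have : NeZero (QQ d) := ⟨hQ.ne'⟩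
  have hQR : (0 : ℝ) < QQ d := by exact_mod_cast hQ
  have hA : 0 ≤ Ac d := Ac_nonneg d hsq hd1
  have hSS := SS_pos d
  have key : ∀ c : ZMod (QQ d), ∃ K : ℝ, 0 ≤ K ∧ ∀ X : ℕ, 1 ≤ X →
      |∑ j ∈ (Icc 1 X).filter (fun j : ℕ => (j : ZMod (QQ d)) = c), tauS d M σ j -
        kk d M σ c * Ac d * (SS d / QQ d) * X| ≤ K * (X : ℝ) ^ (47 / 50 : ℝ) := by
    intro c
    have hk := kk_nonneg hM hsq hd1 σ c
    have e : ∀ X : ℕ, ∑ j ∈ (Icc 1 X).filter (fun j : ℕ => (j : ZMod (QQ d)) = c), tauS d M σ j -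
        kk d M σ c * Ac d * (SS d / QQ d) * X = kk d M σ c * Ac d *
        (∑ j ∈ (Icc 1 X).filter (fun j : ℕ => (j : ZMod (QQ d)) = c),
        (if 8 * d.natAbs < j then sqs (QQ d) j * (Gc d (σ * (j : ℤ)) * Gc d (d * (σ * (j : ℤ)))) else 0)
      - SS d / QQ d * X) := by
      intro X
      rw [mul_sub, mul_sum]
      congr 1
      · exact sum_congr rfl fun j hj => tau_eq hM hsq hd1 hσ c j (mem_filter.mp hj).2
      · ring
    by_cases hcls : Cls d σ c
    · obtain ⟨K, hK, hb⟩ := main_sum d hd σ hσ c (fun j h1 h2 h3 => (hcls.cnt hσ hd j h1 h3 h2).fund)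
      refine ⟨kk d M σ c * Ac d * K, by positivity, fun X hX => ?_⟩
      rw [e, abs_mul, abs_of_nonneg (by positivity)]
      have hm := mul_le_mul_of_nonneg_left (hb X hX) (mul_nonneg hk hA)
      exact hm.trans_eq (by ring)
    · refine ⟨0, le_rfl, fun X _ => ?_⟩
      have : kk d M σ c = 0 := by unfold kk; rw [dif_neg hcls]
      rw [e, this]; simp
  choose K hK hb using key
  refine ⟨∑ c, kk d M σ c * Ac d * (SS d / QQ d), ∑ c, K c, sum_nonneg fun c _ => hK c,
    sum_nonneg fun c _ => ?_, ?_, fun X hX => ?_⟩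
  · have := kk_nonneg hM hsq hd1 σ c
    positivity
  · rintro rfl
    obtain ⟨j, hj, hj2⟩ := exists_cnt d hd
    have hj2' : Cnt d (1 * (j : ℤ)) := by rwa [one_mul]
    have hA' : 0 < Ac d := by
      obtain ⟨x, y, hbq⟩ := hM.biq hsq hd1 hj2
      exact (hbq.fund_pos hd1 (by simpa using hj)).2
    refine sum_pos' (fun c _ => ?_) ⟨(j : ZMod (QQ d)), mem_univ _, ?_⟩
    · have := kk_nonneg hM hsq hd1 1 c
      positivity
    · have := kk_pos hM hsq hd1 1 (j : ZMod (QQ d)) ⟨j, hj, rfl, hj2'⟩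
      positivity
  · rw [sum_classes (QQ d) hQ, sum_mul, sum_mul, ← sum_sub_distrib]
    exact (abs_sum_le_sum_abs _ _).trans (sum_le_sum fun c _ => hb c X hX)

lemma sym_sum (f : ℤ → ℝ) (n : ℕ) : ∑ Δ ∈ Icc (-(n : ℤ)) n, f Δ =
    f 0 + ∑ j ∈ Icc 1 n, f (1 * (j : ℤ)) + ∑ j ∈ Icc 1 n, f (-1 * (j : ℤ)) := by
  induction n with
  | zero => simp
  | succ n ih =>
    have : Icc (-((n + 1 : ℕ) : ℤ)) ((n + 1 : ℕ) : ℤ) =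
        insert ((n + 1 : ℕ) : ℤ) (insert (-((n + 1 : ℕ) : ℤ)) (Icc (-(n : ℤ)) n)) := by
      ext x
      simp only [mem_insert, mem_Icc]
      push_cast
      omega
    rw [this, sum_insert, sum_insert, ih, sum_Icc_succ_top (by omega), sum_Icc_succ_top (by omega)]
    · simp only [one_mul, neg_one_mul]; ring
    · simp only [mem_Icc]; push_cast; omega
    · simp only [mem_insert, mem_Icc]; push_cast; omega

lemma half_sum (hM : Fam d M) (hsq : Squarefree d) (hd1 : d ≠ 1) {σ : ℤ} (hσ : σ = 1 ∨ σ = -1) :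
    ∃ C K : ℝ, 0 ≤ K ∧ 0 ≤ C ∧ (σ = 1 → 0 < C) ∧ ∀ n : ℕ, 1 ≤ n →
      |∑ j ∈ Icc 1 n, fS d M (σ * (j : ℤ)) - C * Real.log n| ≤ K := by
  obtain ⟨C, K, hK, hC, hC1, hb⟩ := tau_sum hM hsq hd1 hσ
  obtain ⟨K', hK', hb'⟩ := abel_log (tauS d M σ) C K hK hb
  set E := ∑ j ∈ Icc 1 (8 * d.natAbs), |fS d M (σ * (j : ℤ))| with hE
  have hE0 : 0 ≤ E := sum_nonneg fun _ _ => abs_nonneg _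
  refine ⟨C, K' + E, by positivity, hC, hC1, fun n hn => ?_⟩
  have e : ∑ j ∈ Icc 1 n, fS d M (σ * (j : ℤ)) = ∑ j ∈ Icc 1 n, tauS d M σ j / j +
      ∑ j ∈ (Icc 1 n).filter (fun j => ¬ 8 * d.natAbs < j), fS d M (σ * (j : ℤ)) := by
    rw [sum_filter, ← sum_add_distrib]
    refine sum_congr rfl fun j hj => ?_
    have hj0 : (j : ℝ) ≠ 0 := by
      have := (mem_Icc.mp hj).1
      exact_mod_cast (by omega : j ≠ 0)
    unfold tauS
    by_cases h : 8 * d.natAbs < j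
    · rw [if_pos h, if_neg (not_not.mpr h), add_zero, mul_div_cancel_right₀ _ hj0]
    · rw [if_neg h, if_pos h, zero_div, zero_add]
  have h2 : |∑ j ∈ (Icc 1 n).filter (fun j => ¬ 8 * d.natAbs < j), fS d M (σ * (j : ℤ))| ≤ E := by
    refine (abs_sum_le_sum_abs _ _).trans (sum_le_sum_of_subset_of_nonneg ?_ (fun _ _ _ => abs_nonneg _))
    intro j hj
    rw [mem_filter, mem_Icc] at hj
    rw [mem_Icc]; omega
  rw [e, add_sub_right_comm]
  exact (abs_add_le _ _).trans (add_le_add (hb' n hn) h2)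

lemma main_fixed (hM : Fam d M) (hsq : Squarefree d) (hd1 : d ≠ 1) :
    ∃ C C' : ℝ, 0 < C ∧ 0 < C' ∧ ∀ Y : ℝ, 2 ≤ Y →
      |∑ Δ ∈ Icc ⌈-Y⌉ ⌊Y⌋, fS d M Δ - C * Real.log Y| ≤ C' := by
  obtain ⟨C1, K1, hK1, hC1, hC1', h1⟩ := half_sum hM hsq hd1 (σ := 1) (Or.inl rfl)
  obtain ⟨C2, K2, hK2, hC2, -, h2⟩ := half_sum hM hsq hd1 (σ := -1) (Or.inr rfl)
  have hC : 0 < C1 + C2 := by linarith [hC1' rfl]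
  have hl2 : 0 ≤ Real.log 2 := Real.log_nonneg (by norm_num)
  refine ⟨C1 + C2, |fS d M 0| + K1 + K2 + |C1 + C2| * Real.log 2 + 1, hC, by positivity, fun Y hY => ?_⟩
  have hn : 1 ≤ ⌊Y⌋₊ := Nat.le_floor (by push_cast; linarith)
  have e1 : ⌊Y⌋ = (⌊Y⌋₊ : ℤ) := (Int.natCast_floor_eq_floor (by linarith)).symm
  have e2 : ⌈-Y⌉ = -(⌊Y⌋₊ : ℤ) := by rw [Int.ceil_neg, e1]
  rw [e1, e2, sym_sum]
  have a1 := h1 _ hn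
  have a2 := h2 _ hn
  have a3 := floor_log (C1 + C2) Y hY
  rw [abs_le] at a1 a2 a3 ⊢
  have a4 := abs_le.mp (le_refl |fS d M 0|)
  constructor <;> linarith [a1.1, a1.2, a2.1, a2.2, a3.1, a3.2, a4.1, a4.2]

end Assembly

open scoped Classical in
/-- For every fundamental discriminant `Δ` with `Δ ≠ discr ℚ(√d)` let `M Δ` be the biquadratic
number field `ℚ(√Δ, √d)` (any realization of it). -/
theorem statement_18 (d : ℤ) (hsq : Squarefree d) (hd0 : d ≠ 0) (hd1 : d ≠ 1) :
    ∃ C_d C' : ℝ, 0 < C_d ∧ 0 < C' ∧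
      ∀ (M : ℤ → Type) (instF : ∀ Δ, Field (M Δ)) (instN : ∀ Δ, @NumberField (M Δ) (instF Δ)),
        (∀ Δ, IsFundamentalDiscriminant Δ → Δ ≠ DL d →
          (letI := instF Δ; letI := instN Δ;
            Module.finrank ℚ (M Δ) = 4 ∧ (∃ c : M Δ, c ^ 2 = (d : M Δ)) ∧
              ∃ s : M Δ, s ^ 2 = (Δ : M Δ))) →
        ∀ Y : ℝ, 2 ≤ Y →
          |(∑ Δ ∈ Finset.Icc ⌈-Y⌉ ⌊Y⌋,
              if IsFundamentalDiscriminant Δ ∧ Δ ≠ DL d then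
                (letI := instF Δ; letI := instN Δ; schanuel (M Δ))
              else 0) - C_d * Real.log Y| ≤ C' := by
  by_cases hex : ∃ (M : ℤ → Type) (instF : ∀ Δ, Field (M Δ)) (_ : ∀ Δ, NumberField (M Δ)), Fam d M
  · obtain ⟨M₀, iF, iN, hM₀⟩ := hex
    obtain ⟨C, C', hC, hC', hb⟩ := main_fixed hM₀ hsq hd1
    refine ⟨C, C', hC, hC', fun M instF instN hM Y hY => ?_⟩
    have hM' : Fam d M := fun Δ h => hM Δ h.1 h.2
    have e : ∀ Δ, (if IsFundamentalDiscriminant Δ ∧ Δ ≠ DL d then schanuel (M Δ) else 0) = fS d M₀ Δ := by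
      intro Δ
      unfold fS
      by_cases h : Cnt d Δ
      · have h' : IsFundamentalDiscriminant Δ ∧ Δ ≠ DL d := h
        rw [if_pos h', if_pos h]
        obtain ⟨x, y, b⟩ := hM'.biq hsq hd1 h
        obtain ⟨x', y', b'⟩ := hM₀.biq hsq hd1 h
        exact b.schanuel_unique b'
      · have h' : ¬ (IsFundamentalDiscriminant Δ ∧ Δ ≠ DL d) := h
        rw [if_neg h', if_neg h]
    have := hb Y hY
    rw [← Finset.sum_congr rfl (fun Δ _ => e Δ)] at this
    exact this
  · refine ⟨1, 1, one_pos, one_pos, fun M instF instN hM Y hY => ?_⟩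
    exact absurd ⟨M, instF, instN, fun Δ h => hM Δ h.1 h.2⟩ hex
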